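/- Let G be a connected affine algebraic group over ℂ with Lie algebra 𝔤, let G_red be a Levi subgroup with Lie algebra 𝔤_red, and let 𝔞_u be a finite-dimensional algebraic G-module. Then the canonical restriction map H²(𝔤, 𝔤_red, 𝔞_u) → H²(𝔤, 𝔞_u), induced by the inclusion of the relative cochain complex into the full Chevalley–Eilenberg complex, is injective. Equivalently: if ω is a 2-cocycle of 𝔤 with values in 𝔞_u that is 𝔤_red-invariant and vanishes whenever one argument lies in 𝔤_red, and if ω = d_𝔤 h for some linear map h : 𝔤 → 𝔞_u, then ω = d_𝔤 f for some linear map f : 𝔤 → 𝔞_u vanishing on 𝔤_red and 𝔤_red-equivariant. -/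

import Mathlib

noncomputable section

open MvPolynomial

/-- Points of affine `n`-space over `ℂ`. -/
abbrev Pt (n : ℕ) : Type := Fin n → ℂ

/-- A subset of `ℂ^n` is an (affine) algebraic set if it is the common zero
locus of a set of polynomials. -/
def IsAlgebraicSet {n : ℕ} (V : Set (Pt n)) : Prop :=
  ∃ S : Set (MvPolynomial (Fin n) ℂ), V = {x : Pt n | ∀ p ∈ S, eval x p = 0}

/-- A map `ℂ^n → ℂ^m` is regular (polynomial) on a subset `V ⊆ ℂ^n`. -/
def IsRegularOn {n m : ℕ} (V : Set (Pt n)) (f : Pt n → Pt m) : Prop :=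
  ∃ P : Fin m → MvPolynomial (Fin n) ℂ, ∀ x ∈ V, ∀ i, f x i = eval x (P i)

def Pt.left {n m : ℕ} (z : Pt (n + m)) : Pt n := fun i => z (Fin.castAdd m i)
def Pt.right {n m : ℕ} (z : Pt (n + m)) : Pt m := fun i => z (Fin.natAdd n i)

/-- An affine algebraic group over `ℂ`, realized as an algebraic subset of some
`ℂ^n`, with polynomial multiplication and inversion. -/
structure AffAlgGroup : Type where
  n : ℕ
  carrier : Set (Pt n)
  isAlgebraic : IsAlgebraicSet carrier
  one : Pt n
  one_mem : one ∈ carrier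
  mul : Pt n → Pt n → Pt n
  inv : Pt n → Pt n
  mul_mem : ∀ {x y : Pt n}, x ∈ carrier → y ∈ carrier → mul x y ∈ carrier
  inv_mem : ∀ {x : Pt n}, x ∈ carrier → inv x ∈ carrier
  mul_assoc' : ∀ {x y z : Pt n}, x ∈ carrier → y ∈ carrier → z ∈ carrier →
    mul (mul x y) z = mul x (mul y z)
  one_mul' : ∀ {x : Pt n}, x ∈ carrier → mul one x = x
  mul_one' : ∀ {x : Pt n}, x ∈ carrier → mul x one = x
  inv_mul' : ∀ {x : Pt n}, x ∈ carrier → mul (inv x) x = one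
  mul_regular : IsRegularOn
    {z : Pt (n + n) | Pt.left z ∈ carrier ∧ Pt.right z ∈ carrier}
    (fun z => mul (Pt.left z) (Pt.right z))
  inv_regular : IsRegularOn carrier inv

namespace AffAlgGroup

/-- The group of `ℂ`-points of `G`, as a bundled group. -/
def Gp (G : AffAlgGroup) : Type := {x : Pt G.n // x ∈ G.carrier}

instance (G : AffAlgGroup) : Group G.Gp where
  mul x y := ⟨G.mul x.1 y.1, G.mul_mem x.2 y.2⟩
  one := ⟨G.one, G.one_mem⟩
  inv x := ⟨G.inv x.1, G.inv_mem x.2⟩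
  mul_assoc a b c := Subtype.ext (G.mul_assoc' a.2 b.2 c.2)
  one_mul a := Subtype.ext (G.one_mul' a.2)
  mul_one a := Subtype.ext (G.mul_one' a.2)
  inv_mul_cancel a := Subtype.ext (G.inv_mul' a.2)

/-- The Euclidean (classical) topology on the points of `G`. -/
instance (G : AffAlgGroup) : TopologicalSpace G.Gp :=
  instTopologicalSpaceSubtype

/-- Connectedness of an affine algebraic group: the carrier cannot be divided
into two disjoint relatively (Zariski-)closed pieces. -/
def IsConnected (G : AffAlgGroup) : Prop :=
  ∀ V W : Set (Pt G.n), IsAlgebraicSet V → IsAlgebraicSet W →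
    G.carrier ⊆ V ∪ W → G.carrier ∩ (V ∩ W) = ∅ →
    G.carrier ⊆ V ∨ G.carrier ⊆ W

def IsAbelianGrp (G : AffAlgGroup) : Prop :=
  ∀ x ∈ G.carrier, ∀ y ∈ G.carrier, G.mul x y = G.mul y x

/-- `G` is a torus: it is isomorphic, as an algebraic group, to `(ℂ*)^k`;
the isomorphism and its inverse are required to be given by (Laurent)
polynomials. -/
def IsTorus (G : AffAlgGroup) : Prop :=
  ∃ (k : ℕ) (φ : (Fin k → ℂˣ) → Pt G.n),
    (∀ u, φ u ∈ G.carrier) ∧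
    Function.Injective φ ∧
    (∀ x ∈ G.carrier, ∃ u, φ u = x) ∧
    φ (fun _ => 1) = G.one ∧
    (∀ u v, φ (u * v) = G.mul (φ u) (φ v)) ∧
    (∀ i : Fin G.n, ∃ P : MvPolynomial (Fin k ⊕ Fin k) ℂ,
      ∀ u, φ u i = eval (Sum.elim (fun j => (u j : ℂ)) (fun j => ((u j)⁻¹ : ℂˣ))) P) ∧
    (∀ j : Fin k, ∃ Q : MvPolynomial (Fin G.n) ℂ, ∀ u, (u j : ℂ) = eval (φ u) Q)

end AffAlgGroup

/-- matrix entry access for a point of `ℂ^{m·m}` viewed as an `m × m` matrix -/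
def matEntry {m : ℕ} (x : Pt (m * m)) (i j : Fin m) : ℂ := x (finProdFinEquiv (i, j))

/-- matrix multiplication on points of `ℂ^{m·m}` -/
def matMulPt (m : ℕ) (x y : Pt (m * m)) : Pt (m * m) :=
  fun idx => ∑ k : Fin m,
    matEntry x (finProdFinEquiv.symm idx).1 k * matEntry y k (finProdFinEquiv.symm idx).2

/-- the identity matrix as a point of `ℂ^{m·m}` -/
def idMatPt (m : ℕ) : Pt (m * m) :=
  fun idx => if (finProdFinEquiv.symm idx).1 = (finProdFinEquiv.symm idx).2 then 1 else 0

/-- an upper triangular matrix with `1`'s on the diagonal -/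
def IsUnitriangular (m : ℕ) (x : Pt (m * m)) : Prop :=
  (∀ i : Fin m, matEntry x i i = 1) ∧ (∀ i j : Fin m, j < i → matEntry x i j = 0)

/-- `G` is unipotent: it admits a faithful polynomial representation by
upper triangular unipotent matrices. -/
def AffAlgGroup.IsUnipotent (G : AffAlgGroup) : Prop :=
  ∃ (m : ℕ) (φ : Pt G.n → Pt (m * m)),
    IsRegularOn G.carrier φ ∧
    Set.InjOn φ G.carrier ∧
    (∀ x ∈ G.carrier, IsUnitriangular m (φ x)) ∧
    (∀ x ∈ G.carrier, ∀ y ∈ G.carrier, φ (G.mul x y) = matMulPt m (φ x) (φ y))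

/-- A homomorphism of affine algebraic groups: a polynomial map which is
multiplicative on points. -/
structure AlgGroupHom (G H : AffAlgGroup) : Type where
  toFun : Pt G.n → Pt H.n
  maps_to : ∀ {x : Pt G.n}, x ∈ G.carrier → toFun x ∈ H.carrier
  map_mul : ∀ {x y : Pt G.n}, x ∈ G.carrier → y ∈ G.carrier →
    toFun (G.mul x y) = H.mul (toFun x) (toFun y)
  regular : IsRegularOn G.carrier toFun

/-- An algebraic action of `G` on `A` by group automorphisms. -/
structure AlgAction (G A : AffAlgGroup) : Type where
  act : Pt G.n → Pt A.n → Pt A.n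
  maps_to : ∀ {g : Pt G.n} {a : Pt A.n}, g ∈ G.carrier → a ∈ A.carrier →
    act g a ∈ A.carrier
  act_one : ∀ {a : Pt A.n}, a ∈ A.carrier → act G.one a = a
  act_mul : ∀ {g h : Pt G.n} {a : Pt A.n}, g ∈ G.carrier → h ∈ G.carrier →
    a ∈ A.carrier → act (G.mul g h) a = act g (act h a)
  act_map_mul : ∀ {g : Pt G.n} {a b : Pt A.n}, g ∈ G.carrier → a ∈ A.carrier →
    b ∈ A.carrier → act g (A.mul a b) = A.mul (act g a) (act g b)
  act_bij : ∀ {g : Pt G.n}, g ∈ G.carrier → ∀ a ∈ A.carrier, ∃ b ∈ A.carrier, act g b = a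
  regular : IsRegularOn
    {z : Pt (G.n + A.n) | Pt.left z ∈ G.carrier ∧ Pt.right z ∈ A.carrier}
    (fun z => act (Pt.left z) (Pt.right z))

/-- the trivial action of `G` on `A` -/
def AlgAction.IsTrivial {G A : AffAlgGroup} (ρ : AlgAction G A) : Prop :=
  ∀ g ∈ G.carrier, ∀ a ∈ A.carrier, ρ.act g a = a

/-- An extension `1 → A → E → G → 1` of affine algebraic groups inducing
(via conjugation in `E`) the action `ρ` of `G` on `A`. -/
structure AlgExtension (G A : AffAlgGroup) (ρ : AlgAction G A) : Type where
  E : AffAlgGroup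
  i : AlgGroupHom A E
  q : AlgGroupHom E G
  i_inj : Set.InjOn i.toFun A.carrier
  q_surj : ∀ g ∈ G.carrier, ∃ x ∈ E.carrier, q.toFun x = g
  exact : ∀ x ∈ E.carrier, (q.toFun x = G.one ↔ ∃ a ∈ A.carrier, i.toFun a = x)
  conj_compat : ∀ x ∈ E.carrier, ∀ a ∈ A.carrier,
    E.mul x (E.mul (i.toFun a) (E.inv x)) = i.toFun (ρ.act (q.toFun x) a)

namespace AlgExtension

variable {G A : AffAlgGroup} {ρ : AlgAction G A}

/-- An extension splits if the quotient map admits an algebraic group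
theoretic section. -/
def Splits (e : AlgExtension G A ρ) : Prop :=
  ∃ σ : AlgGroupHom G e.E, ∀ g ∈ G.carrier, e.q.toFun (σ.toFun g) = g

/-- Equivalence of extensions (via a morphism over `G` and under `A`;
such a morphism is automatically an isomorphism). -/
def Equiv (e₁ e₂ : AlgExtension G A ρ) : Prop :=
  ∃ f : AlgGroupHom e₁.E e₂.E,
    (∀ a ∈ A.carrier, f.toFun (e₁.i.toFun a) = e₂.i.toFun a) ∧
    (∀ x ∈ e₁.E.carrier, e₂.q.toFun (f.toFun x) = e₁.q.toFun x)

/-- `e₃` is a Baer sum of `e₁` and `e₂`: there is a regular map from the fiber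
product `E₁ ×_G E₂` to `E₃` which is multiplicative, lies over `G` and
restricts to the multiplication `A × A → A` on the kernels.  (This
characterizes the Baer sum up to equivalence.) -/
def IsBaerSum (e₁ e₂ e₃ : AlgExtension G A ρ) : Prop :=
  ∃ h : Pt (e₁.E.n + e₂.E.n) → Pt e₃.E.n,
    IsRegularOn {z : Pt (e₁.E.n + e₂.E.n) | Pt.left z ∈ e₁.E.carrier ∧
      Pt.right z ∈ e₂.E.carrier ∧ e₁.q.toFun (Pt.left z) = e₂.q.toFun (Pt.right z)} h ∧
    (∀ x ∈ e₁.E.carrier, ∀ y ∈ e₂.E.carrier, e₁.q.toFun x = e₂.q.toFun y →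
      h (Fin.append x y) ∈ e₃.E.carrier) ∧
    (∀ x x' y y', x ∈ e₁.E.carrier → x' ∈ e₁.E.carrier → y ∈ e₂.E.carrier →
      y' ∈ e₂.E.carrier → e₁.q.toFun x = e₂.q.toFun y → e₁.q.toFun x' = e₂.q.toFun y' →
      h (Fin.append (e₁.E.mul x x') (e₂.E.mul y y')) =
        e₃.E.mul (h (Fin.append x y)) (h (Fin.append x' y'))) ∧
    (∀ x ∈ e₁.E.carrier, ∀ y ∈ e₂.E.carrier, e₁.q.toFun x = e₂.q.toFun y →
      e₃.q.toFun (h (Fin.append x y)) = e₁.q.toFun x) ∧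
    (∀ a ∈ A.carrier, ∀ b ∈ A.carrier,
      h (Fin.append (e₁.i.toFun a) (e₂.i.toFun b)) = e₃.i.toFun (A.mul a b))

end AlgExtension

/-- A realization of the abelian group `Ext_alg(G, A)` of equivalence classes
of extensions of `G` by `A` (inducing the action `ρ`), with addition given by
the Baer sum, and zero element the class of split extensions. -/
structure IsExtGroup (G A : AffAlgGroup) (ρ : AlgAction G A)
    (Ext : Type) [AddCommGroup Ext] : Prop where
  exists_cls : ∃ cls : AlgExtension G A ρ → Ext,
    Function.Surjective cls ∧
    (∀ e₁ e₂, cls e₁ = cls e₂ ↔ Relation.EqvGen AlgExtension.Equiv e₁ e₂) ∧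
    (∀ e, cls e = 0 ↔ e.Splits) ∧
    (∀ e₁ e₂ e₃, AlgExtension.IsBaerSum e₁ e₂ e₃ → cls e₁ + cls e₂ = cls e₃)

/-- The class map itself, when we need to name it. -/
structure ExtClassMap (G A : AffAlgGroup) (ρ : AlgAction G A)
    (Ext : Type) [AddCommGroup Ext] : Type where
  cls : AlgExtension G A ρ → Ext
  surj : Function.Surjective cls
  cls_eq_iff : ∀ e₁ e₂, cls e₁ = cls e₂ ↔ Relation.EqvGen AlgExtension.Equiv e₁ e₂
  cls_eq_zero_iff : ∀ e, cls e = 0 ↔ e.Splits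
  cls_baer : ∀ e₁ e₂ e₃, AlgExtension.IsBaerSum e₁ e₂ e₃ → cls e₁ + cls e₂ = cls e₃

/-- An algebraic subgroup of `G`. -/
structure AlgSubgroup (G : AffAlgGroup) : Type where
  carrier : Set (Pt G.n)
  subset : carrier ⊆ G.carrier
  isAlgebraic : IsAlgebraicSet carrier
  one_mem : G.one ∈ carrier
  mul_mem : ∀ {x y : Pt G.n}, x ∈ carrier → y ∈ carrier → G.mul x y ∈ carrier
  inv_mem : ∀ {x : Pt G.n}, x ∈ carrier → G.inv x ∈ carrier

namespace AlgSubgroup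

variable {G : AffAlgGroup}

/-- An algebraic subgroup is itself an affine algebraic group. -/
def toGrp (H : AlgSubgroup G) : AffAlgGroup where
  n := G.n
  carrier := H.carrier
  isAlgebraic := H.isAlgebraic
  one := G.one
  one_mem := H.one_mem
  mul := G.mul
  inv := G.inv
  mul_mem := H.mul_mem
  inv_mem := H.inv_mem
  mul_assoc' hx hy hz := G.mul_assoc' (H.subset hx) (H.subset hy) (H.subset hz)
  one_mul' hx := G.one_mul' (H.subset hx)
  mul_one' hx := G.mul_one' (H.subset hx)
  inv_mul' hx := G.inv_mul' (H.subset hx)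
  mul_regular := by
    obtain ⟨P, hP⟩ := G.mul_regular
    exact ⟨P, fun z hz => hP z ⟨H.subset hz.1, H.subset hz.2⟩⟩
  inv_regular := by
    obtain ⟨P, hP⟩ := G.inv_regular
    exact ⟨P, fun x hx => hP x (H.subset hx)⟩

def IsNormal (H : AlgSubgroup G) : Prop :=
  ∀ g ∈ G.carrier, ∀ x ∈ H.carrier, G.mul g (G.mul x (G.inv g)) ∈ H.carrier

/-- `H` is the unipotent radical of `G`: the largest connected normal
unipotent algebraic subgroup. -/
def IsUnipotentRadical (H : AlgSubgroup G) : Prop :=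
  H.IsNormal ∧ H.toGrp.IsConnected ∧ H.toGrp.IsUnipotent ∧
    ∀ K : AlgSubgroup G, K.IsNormal → K.toGrp.IsConnected → K.toGrp.IsUnipotent →
      K.carrier ⊆ H.carrier

/-- `G` is reductive: its unipotent radical is trivial. -/
def _root_.AffAlgGroup.IsReductive (G : AffAlgGroup) : Prop :=
  ∀ K : AlgSubgroup G, K.IsNormal → K.toGrp.IsConnected → K.toGrp.IsUnipotent →
    K.carrier = {G.one}

end AlgSubgroup

/-- A Levi decomposition `G = G_u ⋊ G_red` of `G`:  `Gu` is the unipotent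
radical and `L` is a connected reductive algebraic subgroup with
`Gu ∩ L = 1` and `Gu · L = G`. -/
structure LeviDecomposition (G : AffAlgGroup) : Type where
  Gu : AlgSubgroup G
  L : AlgSubgroup G
  Gu_radical : Gu.IsUnipotentRadical
  L_connected : L.toGrp.IsConnected
  L_reductive : L.toGrp.IsReductive
  inter : Gu.carrier ∩ L.carrier = {G.one}
  decomp : ∀ x ∈ G.carrier, ∃ u ∈ Gu.carrier, ∃ l ∈ L.carrier, x = G.mul u l

/-- The group homomorphism on point groups induced by a morphism of algebraic
groups. -/
def AlgGroupHom.toGpHom {G H : AffAlgGroup} (f : AlgGroupHom G H) : G.Gp →* H.Gp :=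
  MonoidHom.mk' (fun x => ⟨f.toFun x.1, f.maps_to x.2⟩)
    (fun a b => Subtype.ext (f.map_mul a.2 b.2))

/-- The subgroup of the point group underlying an algebraic subgroup. -/
def AlgSubgroup.toSubgroup {G : AffAlgGroup} (H : AlgSubgroup G) : Subgroup G.Gp where
  carrier := {x : G.Gp | x.1 ∈ H.carrier}
  one_mem' := H.one_mem
  mul_mem' := fun ha hb => H.mul_mem ha hb
  inv_mem' := fun ha => H.inv_mem ha

/-- Iterated product (powers) in an algebraic group. -/
def AffAlgGroup.pow (G : AffAlgGroup) (x : Pt G.n) : ℕ → Pt G.n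
  | 0 => G.one
  | k + 1 => G.mul x (G.pow x k)

/-- The inclusion homomorphism of an algebraic subgroup. -/
def AlgSubgroup.incl {A : AffAlgGroup} (H : AlgSubgroup A) : H.toGrp.Gp →* A.Gp :=
  MonoidHom.mk' (fun x => ⟨x.1, H.subset x.2⟩) (fun _ _ => rfl)
/-! ### Tangent spaces and Lie algebras -/

/-- The (Zariski) tangent space at `x₀` of a subset `V ⊆ ℂ^n`: the directions
annihilated by the differentials at `x₀` of all polynomials vanishing on `V`. -/
def tangentAt {n : ℕ} (V : Set (Pt n)) (x₀ : Pt n) : Submodule ℂ (Pt n) where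
  carrier := {v | ∀ p : MvPolynomial (Fin n) ℂ, (∀ x ∈ V, eval x p = 0) →
    ∑ j, v j * eval x₀ (pderiv j p) = 0}
  zero_mem' := by intro p hp; simp
  add_mem' := by
    intro a b ha hb p hp
    simp only [Pi.add_apply, add_mul, Finset.sum_add_distrib, ha p hp, hb p hp, add_zero]
  smul_mem' := by
    intro t a ha p hp
    simp only [Pi.smul_apply, smul_eq_mul, mul_assoc, ← Finset.mul_sum, ha p hp, mul_zero]

/-- A family of polynomials representing the commutator map
`(x, y) ↦ x y x⁻¹ y⁻¹` of `G` on `G × G`. -/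
def IsCommutatorRep (G : AffAlgGroup) (F : Fin G.n → MvPolynomial (Fin (G.n + G.n)) ℂ) : Prop :=
  ∀ x ∈ G.carrier, ∀ y ∈ G.carrier, ∀ i,
    G.mul (G.mul x y) (G.mul (G.inv x) (G.inv y)) i = eval (Fin.append x y) (F i)

/-- `𝔤` (an abstract complex Lie algebra) is the Lie algebra of `G`, via the
linear identification `e` of `𝔤` with the tangent space of `G` at the
identity; the Lie bracket corresponds to the mixed second-order term at the
identity of the commutator map of `G`. -/
structure IsLieAlgebraOf (G : AffAlgGroup) (𝔤 : Type) [LieRing 𝔤] [LieAlgebra ℂ 𝔤]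
    (e : 𝔤 →ₗ[ℂ] Pt G.n) : Prop where
  inj : Function.Injective e
  range_eq : ∀ v : Pt G.n, (∃ u : 𝔤, e u = v) ↔ v ∈ tangentAt G.carrier G.one
  bracket_eq : ∀ F, IsCommutatorRep G F → ∀ u v : 𝔤, ∀ i : Fin G.n,
    e ⁅u, v⁆ i = ∑ j, ∑ k, e u j * e v k *
      eval (Fin.append G.one G.one)
        (pderiv (Fin.castAdd G.n j) (pderiv (Fin.natAdd G.n k) (F i)))

/-- The Lie subalgebra `𝔥 ⊆ 𝔤` corresponds to the algebraic subgroup `H ⊆ G`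
(under the identification `e` of `𝔤` with the tangent space of `G` at `1`). -/
def IsLieSubalgebraOf {G : AffAlgGroup} (H : AlgSubgroup G) {𝔤 : Type} [LieRing 𝔤]
    [LieAlgebra ℂ 𝔤] (e : 𝔤 →ₗ[ℂ] Pt G.n) (𝔥 : LieSubalgebra ℂ 𝔤) : Prop :=
  ∀ u : 𝔤, u ∈ 𝔥 ↔ e u ∈ tangentAt H.carrier G.one

/-! ### The relative Chevalley–Eilenberg complex of a pair `(𝔤, 𝔥)` -/

section CE
set_option linter.unusedSectionVars false

variable {𝔤 : Type} [LieRing 𝔤] [LieAlgebra ℂ 𝔤]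
variable {M : Type} [AddCommGroup M] [Module ℂ M] [LieRingModule 𝔤 M]

/-- `c` is an alternating `p`-multilinear map `𝔤^p → M`. -/
def IsMultilinearAlt (p : ℕ) (c : (Fin p → 𝔤) → M) : Prop :=
  (∀ (v : Fin p → 𝔤) (i : Fin p) (x y : 𝔤),
    c (Function.update v i (x + y)) = c (Function.update v i x) + c (Function.update v i y)) ∧
  (∀ (v : Fin p → 𝔤) (i : Fin p) (t : ℂ) (x : 𝔤),
    c (Function.update v i (t • x)) = t • c (Function.update v i x)) ∧
  (∀ (v : Fin p → 𝔤) (i j : Fin p), i ≠ j → v i = v j → c v = 0)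

/-- The Chevalley–Eilenberg differential (in the form valid on alternating
cochains). -/
def ceD (p : ℕ) (c : (Fin p → 𝔤) → M) : (Fin (p + 1) → 𝔤) → M := fun v =>
  (∑ i : Fin (p + 1), ((-1 : ℤ) ^ (i : ℕ)) • ⁅v i, c (fun k => v (i.succAbove k))⁆) +
  ∑ i : Fin (p + 1), ∑ j : Fin (p + 1),
    if h : i < j then
      ((-1 : ℤ) ^ ((i : ℕ) + 1)) •
        c (Function.update (fun k => v (i.succAbove k))
            (j.pred (Fin.pos_iff_ne_zero.mp (lt_of_le_of_lt (Fin.zero_le i) h)))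
            ⁅v i, v j⁆)
    else 0

lemma ceD_zero (p : ℕ) : ceD (M := M) (𝔤 := 𝔤) p 0 = 0 := by
  funext v
  simp [ceD]

lemma ceD_add (p : ℕ) (c c' : (Fin p → 𝔤) → M) :
    ceD p (c + c') = ceD p c + ceD p c' := by
  funext v
  simp only [ceD, Pi.add_apply]
  have e1 : (∑ i : Fin (p + 1), ((-1 : ℤ) ^ (i : ℕ)) •
      ⁅v i, c (fun k => v (i.succAbove k)) + c' (fun k => v (i.succAbove k))⁆)
      = (∑ i : Fin (p + 1), ((-1 : ℤ) ^ (i : ℕ)) • ⁅v i, c (fun k => v (i.succAbove k))⁆)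
      + ∑ i : Fin (p + 1), ((-1 : ℤ) ^ (i : ℕ)) • ⁅v i, c' (fun k => v (i.succAbove k))⁆ := by
    rw [← Finset.sum_add_distrib]
    exact Finset.sum_congr rfl fun i _ => by rw [lie_add, smul_add]
  rw [e1]
  have e2 : ∀ i j : Fin (p + 1),
      (if h : i < j then ((-1 : ℤ) ^ ((i : ℕ) + 1)) •
        ((c (Function.update (fun k => v (i.succAbove k))
            (j.pred (Fin.pos_iff_ne_zero.mp (lt_of_le_of_lt (Fin.zero_le i) h))) ⁅v i, v j⁆))
         + (c' (Function.update (fun k => v (i.succAbove k))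
            (j.pred (Fin.pos_iff_ne_zero.mp (lt_of_le_of_lt (Fin.zero_le i) h))) ⁅v i, v j⁆)))
       else 0)
      = (if h : i < j then ((-1 : ℤ) ^ ((i : ℕ) + 1)) •
          (c (Function.update (fun k => v (i.succAbove k))
            (j.pred (Fin.pos_iff_ne_zero.mp (lt_of_le_of_lt (Fin.zero_le i) h))) ⁅v i, v j⁆))
         else 0)
      + (if h : i < j then ((-1 : ℤ) ^ ((i : ℕ) + 1)) •
          (c' (Function.update (fun k => v (i.succAbove k))
            (j.pred (Fin.pos_iff_ne_zero.mp (lt_of_le_of_lt (Fin.zero_le i) h))) ⁅v i, v j⁆))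
         else 0) := by
    intro i j
    by_cases h : i < j <;> simp [h, smul_add]
  simp only [e2, Finset.sum_add_distrib]
  try abel

lemma ceD_neg (p : ℕ) (c : (Fin p → 𝔤) → M) : ceD p (-c) = -(ceD p c) := by
  have h := ceD_add p c (-c)
  simp only [add_neg_cancel, ceD_zero] at h
  rw [eq_comm, neg_eq_iff_add_eq_zero, eq_comm, ← h]
  try rfl

/-- `c` is a relative `p`-cochain for the pair `(𝔤, 𝔥)`: alternating
multilinear, vanishing when one argument lies in `𝔥`, and `𝔥`-equivariant. -/
def IsRelCochain (𝔥 : LieSubalgebra ℂ 𝔤) (p : ℕ) (c : (Fin p → 𝔤) → M) : Prop :=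
  IsMultilinearAlt p c ∧
  (∀ v : Fin p → 𝔤, (∃ i, v i ∈ 𝔥) → c v = 0) ∧
  (∀ x : 𝔤, x ∈ 𝔥 → ∀ v : Fin p → 𝔤,
    ⁅x, c v⁆ = ∑ i, c (Function.update v i ⁅x, v i⁆))

lemma isRelCochain_zero (𝔥 : LieSubalgebra ℂ 𝔤) (p : ℕ) :
    IsRelCochain (M := M) 𝔥 p 0 := by
  refine ⟨⟨?_, ?_, ?_⟩, ?_, ?_⟩ <;> intros <;> simp

lemma isRelCochain_add (𝔥 : LieSubalgebra ℂ 𝔤) (p : ℕ) {c c' : (Fin p → 𝔤) → M}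
    (h : IsRelCochain 𝔥 p c) (h' : IsRelCochain 𝔥 p c') :
    IsRelCochain 𝔥 p (c + c') := by
  obtain ⟨⟨hm, hs, ha⟩, hv, he⟩ := h
  obtain ⟨⟨hm', hs', ha'⟩, hv', he'⟩ := h'
  refine ⟨⟨?_, ?_, ?_⟩, ?_, ?_⟩
  · intro v i x y
    simp only [Pi.add_apply, hm, hm']
    abel
  · intro v i t x
    simp only [Pi.add_apply, hs, hs', smul_add]
  · intro v i j hij hvv
    simp only [Pi.add_apply, ha v i j hij hvv, ha' v i j hij hvv, add_zero]
  · intro v hv₀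
    simp only [Pi.add_apply, hv v hv₀, hv' v hv₀, add_zero]
  · intro x hx v
    simp only [Pi.add_apply, lie_add, he x hx v, he' x hx v, Finset.sum_add_distrib]

lemma isRelCochain_neg (𝔥 : LieSubalgebra ℂ 𝔤) (p : ℕ) {c : (Fin p → 𝔤) → M}
    (h : IsRelCochain 𝔥 p c) : IsRelCochain 𝔥 p (-c) := by
  obtain ⟨⟨hm, hs, ha⟩, hv, he⟩ := h
  refine ⟨⟨?_, ?_, ?_⟩, ?_, ?_⟩
  · intro v i x y
    simp only [Pi.neg_apply, hm]
    abel
  · intro v i t x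
    simp only [Pi.neg_apply, hs, smul_neg]
  · intro v i j hij hvv
    simp only [Pi.neg_apply, ha v i j hij hvv, neg_zero]
  · intro v hv₀
    simp only [Pi.neg_apply, hv v hv₀, neg_zero]
  · intro x hx v
    simp only [Pi.neg_apply, lie_neg, he x hx v, Finset.sum_neg_distrib]

/-- The group of relative `p`-cocycles of the pair `(𝔤, 𝔥)` with values in `M`. -/
def relZ (𝔥 : LieSubalgebra ℂ 𝔤) (M : Type) [AddCommGroup M] [Module ℂ M]
    [LieRingModule 𝔤 M] (p : ℕ) : AddSubgroup ((Fin p → 𝔤) → M) where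
  carrier := {c | IsRelCochain 𝔥 p c ∧ ∀ v, ceD p c v = 0}
  zero_mem' := ⟨isRelCochain_zero 𝔥 p, fun v => by rw [ceD_zero]; rfl⟩
  add_mem' := by
    rintro c c' ⟨hc, hcz⟩ ⟨hc', hcz'⟩
    refine ⟨isRelCochain_add 𝔥 p hc hc', fun v => ?_⟩
    rw [ceD_add]
    simp [hcz v, hcz' v]
  neg_mem' := by
    rintro c ⟨hc, hcz⟩
    refine ⟨isRelCochain_neg 𝔥 p hc, fun v => ?_⟩
    rw [ceD_neg]
    simp [hcz v]

/-- The group of relative `(p+1)`-coboundaries of the pair `(𝔤, 𝔥)`. -/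
def relB (𝔥 : LieSubalgebra ℂ 𝔤) (M : Type) [AddCommGroup M] [Module ℂ M]
    [LieRingModule 𝔤 M] (p : ℕ) : AddSubgroup ((Fin (p + 1) → 𝔤) → M) where
  carrier := {c | ∃ f : (Fin p → 𝔤) → M, IsRelCochain 𝔥 p f ∧ c = ceD p f}
  zero_mem' := ⟨0, isRelCochain_zero 𝔥 p, (ceD_zero p).symm⟩
  add_mem' := by
    rintro c c' ⟨f, hf, rfl⟩ ⟨f', hf', rfl⟩
    exact ⟨f + f', isRelCochain_add 𝔥 p hf hf', (ceD_add p f f').symm⟩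
  neg_mem' := by
    rintro c ⟨f, hf, rfl⟩
    exact ⟨-f, isRelCochain_neg 𝔥 p hf, (ceD_neg p f).symm⟩

/-- The relative Lie algebra cohomology `H^p(𝔤, 𝔥, M)` of the pair `(𝔤, 𝔥)`
with coefficients in the `𝔤`-module `M`. -/
def relH (𝔥 : LieSubalgebra ℂ 𝔤) (M : Type) [AddCommGroup M] [Module ℂ M]
    [LieRingModule 𝔤 M] : ℕ → Type
  | 0 => ↥(relZ 𝔥 M 0)
  | (p + 1) => ↥(relZ 𝔥 M (p + 1)) ⧸ ((relB 𝔥 M p).addSubgroupOf (relZ 𝔥 M (p + 1)))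

instance relH.instAddCommGroup (𝔥 : LieSubalgebra ℂ 𝔤) (M : Type) [AddCommGroup M]
    [Module ℂ M] [LieRingModule 𝔤 M] (p : ℕ) : AddCommGroup (relH 𝔥 M p) :=
  match p with
  | 0 => inferInstanceAs (AddCommGroup ↥(relZ 𝔥 M 0))
  | (p + 1) => inferInstanceAs
      (AddCommGroup (↥(relZ 𝔥 M (p + 1)) ⧸ ((relB 𝔥 M p).addSubgroupOf (relZ 𝔥 M (p + 1)))))

/-- The class in `H^{p+1}(𝔤, 𝔥, M)` of a relative cocycle. -/
def relHClass (𝔥 : LieSubalgebra ℂ 𝔤) (M : Type) [AddCommGroup M] [Module ℂ M]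
    [LieRingModule 𝔤 M] (p : ℕ) (c : ↥(relZ 𝔥 M (p + 1))) : relH 𝔥 M (p + 1) :=
  QuotientAddGroup.mk c

end CE

/-- matrix-vector action on points -/
def matVec (m : ℕ) (a : Pt (m * m)) (w : Pt m) : Pt m :=
  fun i => ∑ k : Fin m, matEntry a i k * w k

/-- A finite-dimensional algebraic representation of `G` on `ℂ^m`, given by a
regular matrix-valued multiplicative map. -/
structure AlgRep (G : AffAlgGroup) (m : ℕ) : Type where
  ρ : Pt G.n → Pt (m * m)
  regular : IsRegularOn G.carrier ρ
  map_one : ρ G.one = idMatPt m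
  map_mul : ∀ {x y : Pt G.n}, x ∈ G.carrier → y ∈ G.carrier →
    ρ (G.mul x y) = matMulPt m (ρ x) (ρ y)

/-- The (abstract) `𝔤`-module structure on `ℂ^m` is the derived action of the
algebraic representation `r` of `G` (under the identification `e : 𝔤 ≅ L(G)`),
i.e. it is given by differentiating `r` at the identity. -/
def IsDerivedAction {G : AffAlgGroup} {m : ℕ} (r : AlgRep G m) {𝔤 : Type} [LieRing 𝔤]
    [LieAlgebra ℂ 𝔤] (e : 𝔤 →ₗ[ℂ] Pt G.n) [LieRingModule 𝔤 (Pt m)] : Prop :=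
  ∀ R : Fin (m * m) → MvPolynomial (Fin G.n) ℂ,
    (∀ x ∈ G.carrier, ∀ idx, r.ρ x idx = eval x (R idx)) →
    ∀ (u : 𝔤) (w : Pt m) (i : Fin m),
      ⁅u, w⁆ i = ∑ k : Fin m,
        (∑ j, e u j * eval G.one (pderiv j (R (finProdFinEquiv (i, k))))) * w k

/-- The `𝔤`-module structure on `M` (identified via `eA` with the Lie algebra
of `A`) is the derived action of the algebraic action `ρ` of `G` on `A`: the
bracket is the mixed second-order term of `ρ.act` at `(1, 1)`. -/
def IsDerivedActionOnLie {G A : AffAlgGroup} (ρ : AlgAction G A) {𝔤 M : Type}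
    [LieRing 𝔤] [LieAlgebra ℂ 𝔤] [AddCommGroup M] [Module ℂ M] [LieRingModule 𝔤 M]
    (e : 𝔤 →ₗ[ℂ] Pt G.n) (eA : M →ₗ[ℂ] Pt A.n) : Prop :=
  ∀ S : Fin A.n → MvPolynomial (Fin (G.n + A.n)) ℂ,
    (∀ g ∈ G.carrier, ∀ a ∈ A.carrier, ∀ i, ρ.act g a i = eval (Fin.append g a) (S i)) →
    ∀ (u : 𝔤) (w : M) (i : Fin A.n),
      eA ⁅u, w⁆ i = ∑ j, ∑ k, e u j * eA w k *
        eval (Fin.append G.one A.one)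
          (pderiv (Fin.castAdd A.n j) (pderiv (Fin.natAdd G.n k) (S i)))

section Weyl
open LieAlgebra LieModule

universe u v
variable {𝔮 : Type u} [LieRing 𝔮] [LieAlgebra ℂ 𝔮] [FiniteDimensional ℂ 𝔮]
  [HasTrivialRadical ℂ 𝔮]

/-- A Lie algebra with trivial radical is perfect. -/
lemma lie_top_top_eq_top_of_hasTrivialRadical : ⁅(⊤ : LieIdeal ℂ 𝔮), (⊤ : LieIdeal ℂ 𝔮)⁆ = ⊤ := by
  set D : LieIdeal ℂ 𝔮 := ⁅(⊤ : LieIdeal ℂ 𝔮), (⊤ : LieIdeal ℂ 𝔮)⁆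
  obtain ⟨J, hJ⟩ := exists_isCompl D
  have hab : ∀ x ∈ J, ∀ y ∈ J, ⁅x, y⁆ = 0 := by
    intro x hx y hy
    have h1 : ⁅x, y⁆ ∈ J := lie_mem_right ℂ 𝔮 J x y hy
    have h2 : ⁅x, y⁆ ∈ D := LieSubmodule.lie_mem_lie (LieSubmodule.mem_top x) (LieSubmodule.mem_top y)
    have := hJ.disjoint.le_bot (show ⁅x, y⁆ ∈ D ⊓ J from ⟨h2, h1⟩)
    simpa using this
  have : IsLieAbelian J := ⟨fun x y => Subtype.ext (hab x x.2 y y.2)⟩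
  have hs : IsSolvable J := inferInstance
  have : J = ⊥ := HasTrivialRadical.eq_bot_of_isSolvable J
  rw [this] at hJ
  simpa using hJ.codisjoint.eq_top

variable {N : Type v} [AddCommGroup N] [Module ℂ N] [LieRingModule 𝔮 N] [LieModule ℂ 𝔮 N]

/-- A module with vanishing trace form over a Lie algebra with trivial radical is trivial. -/
lemma lie_eq_zero_of_traceForm_eq_zero [FiniteDimensional ℂ N] (h : traceForm ℂ 𝔮 N = 0) (x : 𝔮) (n : N) :
    ⁅x, n⁆ = 0 := by
  have hn := isNilpotent_derivedSeries_of_traceForm_eq_zero h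
  rw [isNilpotent_iff_forall' (R := ℂ)] at hn
  have htop : derivedSeries ℂ 𝔮 1 = ⊤ := by
    simpa [derivedSeries_def, derivedSeriesOfIdeal_succ] using
      lie_top_top_eq_top_of_hasTrivialRadical (𝔮 := 𝔮)
  have hnil : LieModule.IsNilpotent 𝔮 N := by
    rw [isNilpotent_iff_forall' (R := ℂ)]
    intro y
    exact hn ⟨y, by rw [htop]; trivial⟩
  have key : ∀ k, ∀ (x : 𝔮) (n : N), ⁅x, n⁆ ∈ lowerCentralSeries ℂ 𝔮 N (k + 1) := by
    intro k
    induction k with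
    | zero =>
      intro x n
      rw [lowerCentralSeries_succ]
      exact LieSubmodule.lie_mem_lie (LieSubmodule.mem_top x) (by simp)
    | succ k ih =>
      intro x n
      have hx : x ∈ (⁅(⊤ : LieIdeal ℂ 𝔮), (⊤ : LieIdeal ℂ 𝔮)⁆ : LieIdeal ℂ 𝔮) := by
        rw [lie_top_top_eq_top_of_hasTrivialRadical]; trivial
      rw [← LieSubmodule.mem_toSubmodule, LieSubmodule.lieIdeal_oper_eq_linear_span'] at hx
      induction hx using Submodule.span_induction with
      | mem x hx =>
        obtain ⟨a, -, b, -, rfl⟩ := hx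
        rw [lie_lie, lowerCentralSeries_succ]
        exact sub_mem (LieSubmodule.lie_mem_lie (LieSubmodule.mem_top _) (ih _ _))
          (LieSubmodule.lie_mem_lie (LieSubmodule.mem_top _) (ih _ _))
      | zero => simp
      | add a b _ _ ha hb => rw [add_lie]; exact add_mem ha hb
      | smul t a _ ha => rw [smul_lie]; exact SMulMemClass.smul_mem t ha
  obtain ⟨k, hk⟩ := (isNilpotent_iff ℂ 𝔮 N).mp hnil
  have h1 := key k x n
  have h2 : lowerCentralSeries ℂ 𝔮 N (k + 1) = ⊥ := by
    rw [lowerCentralSeries_succ, hk]; simp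
  rw [h2] at h1
  simpa using h1

/-- The Casimir operator of a module with nonzero trace form. -/
lemma exists_casimir (h : traceForm ℂ 𝔮 N ≠ 0) : ∃ c : Module.End ℂ N,
    (∀ x : 𝔮, ∀ n, c ⁅x, n⁆ = ⁅x, c n⁆) ∧
    (∀ l : N →ₗ[ℂ] ℂ, (∀ (x : 𝔮) n, l ⁅x, n⁆ = 0) → ∀ n, l (c n) = 0) ∧
    LinearMap.trace ℂ N c ≠ 0 := by
  classical
  set β := traceForm ℂ 𝔮 N with hβ
  have inv : ∀ x y z : 𝔮, β ⁅x, y⁆ z = - β y ⁅x, z⁆ := by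
    intro x y z
    rw [hβ, ← traceForm_apply_lie_apply' ]
  let K : LieIdeal ℂ 𝔮 :=
    { LinearMap.ker β with
      lie_mem := by
        intro x y hy
        have hy' : β y = 0 := hy
        change β ⁅x, y⁆ = 0
        ext z
        rw [inv, hy']; simp }
  obtain ⟨J, hJ⟩ := exists_isCompl K
  have hKJ : ∀ x : 𝔮, ∃ k ∈ K, ∃ j ∈ J, x = k + j := by
    intro x
    have : x ∈ K ⊔ J := by rw [hJ.codisjoint.eq_top]; trivial
    obtain ⟨k, hk, j, hj, e⟩ := (LieSubmodule.mem_sup _ _ _).mp this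
    exact ⟨k, hk, j, hj, e.symm⟩
  let W : Submodule ℂ 𝔮 := J.toSubmodule
  let B : LinearMap.BilinForm ℂ W := β.domRestrict₁₂ W W
  have hBapp : ∀ x y : W, B x y = β x y := fun x y => rfl
  have hB : B.Nondegenerate := by
    have key : ∀ x : W, (∀ y, B x y = 0) → x = 0 := by
      intro x hx
      have : (x : 𝔮) ∈ K := by
        change β x = 0
        ext y
        obtain ⟨k, hk, j, hj, rfl⟩ := hKJ y
        have hk' : β k = 0 := hk
        rw [map_add, traceForm_comm ℂ 𝔮 N x k, ← hβ, hk']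
        have := hx ⟨j, hj⟩
        rw [hBapp] at this
        simpa using this
      have := hJ.disjoint.le_bot (show (x : 𝔮) ∈ K ⊓ J from ⟨this, x.2⟩)
      exact Subtype.ext (by simpa using this)
    refine ⟨fun x hx => key x hx, fun x hx => key x fun y => ?_⟩
    rw [hBapp, traceForm_comm]; exact hx y
  let b := Module.finBasis ℂ W
  let d := B.dualBasis hB b
  have hd : ∀ i j, β (d i) (b j) = if j = i then 1 else 0 := fun i j =>
    LinearMap.BilinForm.apply_dualBasis_left hB b i j
  have hd' : ∀ i j, β (b j) (d i) = if j = i then 1 else 0 := fun i j => by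
    rw [hβ, traceForm_comm]; exact hd i j
  have exp_b : ∀ w ∈ J, w = ∑ j, β w (d j) • (b j : 𝔮) := by
    intro w hw
    have h1 := congrArg (Subtype.val) (b.sum_repr ⟨w, hw⟩)
    simp only [Submodule.coe_sum, Submodule.coe_smul] at h1
    have h2 : ∀ j, β w (d j) = b.repr ⟨w, hw⟩ j := by
      intro j
      conv_lhs => rw [← h1]
      simp [map_sum, hd']
    simp only [h2, h1]
  have exp_d : ∀ w ∈ J, w = ∑ j, β w (b j) • (d j : 𝔮) := by
    intro w hw
    have h1 := congrArg (Subtype.val) (d.sum_repr ⟨w, hw⟩)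
    simp only [Submodule.coe_sum, Submodule.coe_smul] at h1
    have h2 : ∀ j, β w (b j) = d.repr ⟨w, hw⟩ j := by
      intro j
      conv_lhs => rw [← h1]
      simp [map_sum, hd]
    simp only [h2, h1]
  let c : Module.End ℂ N := ∑ i, toEnd ℂ 𝔮 N (b i : 𝔮) * toEnd ℂ 𝔮 N (d i : 𝔮)
  have hc : ∀ n, c n = ∑ i, ⁅(b i : 𝔮), ⁅(d i : 𝔮), n⁆⁆ := by
    intro n; simp [c, LinearMap.sum_apply]
  refine ⟨c, ?_, ?_, ?_⟩
  · intro x n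
    have e1 : ⁅x, c n⁆ - c ⁅x, n⁆ = ∑ i, (⁅⁅x, (b i : 𝔮)⁆, ⁅(d i : 𝔮), n⁆⁆ +
        ⁅(b i : 𝔮), ⁅⁅x, (d i : 𝔮)⁆, n⁆⁆) := by
      rw [hc, hc, lie_sum, ← Finset.sum_sub_distrib]
      refine Finset.sum_congr rfl fun i _ => ?_
      rw [leibniz_lie x (b i : 𝔮), leibniz_lie x (d i : 𝔮) n, lie_add]
      abel
    have e2 : ∑ i, (⁅⁅x, (b i : 𝔮)⁆, ⁅(d i : 𝔮), n⁆⁆ + ⁅(b i : 𝔮), ⁅⁅x, (d i : 𝔮)⁆, n⁆⁆) = 0 := by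
      rw [Finset.sum_add_distrib]
      have f1 : ∀ i, ⁅⁅x, (b i : 𝔮)⁆, ⁅(d i : 𝔮), n⁆⁆ =
          ∑ j, β ⁅x, (b i : 𝔮)⁆ (d j) • ⁅(b j : 𝔮), ⁅(d i : 𝔮), n⁆⁆ := by
        intro i
        conv_lhs => rw [exp_b ⁅x, (b i : 𝔮)⁆ (lie_mem_right ℂ 𝔮 J _ _ (b i).2)]
        rw [sum_lie]; simp only [smul_lie]
      have f2 : ∀ i, ⁅(b i : 𝔮), ⁅⁅x, (d i : 𝔮)⁆, n⁆⁆ =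
          ∑ j, β ⁅x, (d i : 𝔮)⁆ (b j) • ⁅(b i : 𝔮), ⁅(d j : 𝔮), n⁆⁆ := by
        intro i
        conv_lhs => rw [exp_d ⁅x, (d i : 𝔮)⁆ (lie_mem_right ℂ 𝔮 J _ _ (d i).2)]
        rw [sum_lie, lie_sum]; simp only [smul_lie, lie_smul]
      simp only [f1, f2]
      rw [Finset.sum_comm, ← Finset.sum_add_distrib]
      refine Finset.sum_eq_zero fun i _ => ?_
      rw [← Finset.sum_add_distrib]
      refine Finset.sum_eq_zero fun j _ => ?_
      rw [← add_smul, inv x (b j : 𝔮) (d i), hβ, traceForm_comm ℂ 𝔮 N (b j : 𝔮), neg_add_cancel, zero_smul]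
    rw [e2, sub_eq_zero] at e1
    exact e1.symm
  · intro l hl n
    rw [hc, map_sum]
    exact Finset.sum_eq_zero fun i _ => hl _ _
  · have : LinearMap.trace ℂ N c = Module.finrank ℂ W := by
      simp only [c, map_sum]
      have : ∀ i, LinearMap.trace ℂ N (toEnd ℂ 𝔮 N (b i : 𝔮) * toEnd ℂ 𝔮 N (d i : 𝔮)) = 1 := by
        intro i
        have := hd' i i
        rw [hβ, traceForm_apply_apply] at this
        simpa [Module.End.mul_eq_comp] using this
      simp [this]
    rw [this]
    intro h0
    have h0' : Module.finrank ℂ W = 0 := by exact_mod_cast h0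
    apply h
    ext1 x
    obtain ⟨k, hk, j, hj, rfl⟩ := hKJ x
    have hj0 : j = 0 := by
      have := Submodule.finrank_eq_zero.mp h0'
      have hj' : j ∈ W := hj
      rw [this] at hj'; simpa using hj'
    have hk' : β k = 0 := hk
    rw [hj0, add_zero, hk']; simp
end Weyl

section WeylMain
open LieAlgebra LieModule

universe u v
variable {𝔮 : Type u} [LieRing 𝔮] [LieAlgebra ℂ 𝔮]

/-- The kernel of an invariant functional. -/
def invKer {N : Type v} [AddCommGroup N] [Module ℂ N] [LieRingModule 𝔮 N] [LieModule ℂ 𝔮 N]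
    (l : N →ₗ[ℂ] ℂ) (hl : ∀ (x : 𝔮) n, l ⁅x, n⁆ = 0) : LieSubmodule ℂ 𝔮 N :=
  { LinearMap.ker l with lie_mem := fun {x n} _ => hl x n }

/-- The sum of a submodule `V` and the line through a vector invariant modulo `V`. -/
def addLine {N : Type v} [AddCommGroup N] [Module ℂ N] [LieRingModule 𝔮 N] [LieModule ℂ 𝔮 N]
    (V : LieSubmodule ℂ 𝔮 N) (n₀ : N) (h : ∀ x : 𝔮, ⁅x, n₀⁆ ∈ V) : LieSubmodule ℂ 𝔮 N where
  carrier := {n | ∃ t : ℂ, n - t • n₀ ∈ V}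
  add_mem' := by
    rintro a b ⟨s, hs⟩ ⟨t, ht⟩
    refine ⟨s + t, ?_⟩
    have : a + b - (s + t) • n₀ = (a - s • n₀) + (b - t • n₀) := by rw [add_smul]; abel
    rw [this]; exact add_mem hs ht
  zero_mem' := ⟨0, by simp⟩
  smul_mem' := by
    rintro c a ⟨s, hs⟩
    refine ⟨c * s, ?_⟩
    have : c • a - (c * s) • n₀ = c • (a - s • n₀) := by rw [smul_sub, smul_smul]
    rw [this]; exact SMulMemClass.smul_mem c hs
  lie_mem := by
    rintro x a ⟨s, hs⟩
    refine ⟨0, ?_⟩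
    have : ⁅x, a⁆ - (0 : ℂ) • n₀ = ⁅x, a - s • n₀⁆ + s • ⁅x, n₀⁆ := by
      rw [lie_sub, lie_smul]; simp
    rw [this]
    exact add_mem (V.lie_mem hs) (SMulMemClass.smul_mem s (h x))

variable [FiniteDimensional ℂ 𝔮] [HasTrivialRadical ℂ 𝔮]

/-- Over a Lie algebra with trivial radical, invariant functionals lift to invariant vectors. -/
theorem exists_invariant_of_hasTrivialRadical (d : ℕ) :
    ∀ {N : Type v} [AddCommGroup N] [Module ℂ N] [LieRingModule 𝔮 N] [LieModule ℂ 𝔮 N]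
      [FiniteDimensional ℂ N], Module.finrank ℂ N = d →
      ∀ l : N →ₗ[ℂ] ℂ, (∀ (x : 𝔮) n, l ⁅x, n⁆ = 0) → l ≠ 0 →
      ∃ n, (∀ x : 𝔮, ⁅x, n⁆ = 0) ∧ l n = 1 := by
  induction d using Nat.strong_induction_on with
  | _ d ih =>
  intro N _ _ _ _ _ hN l hl hl0
  have hsurj : ∃ n, l n = 1 := by
    obtain ⟨n, hn⟩ : ∃ n, l n ≠ 0 := by
      by_contra! h
      exact hl0 (LinearMap.ext h)
    exact ⟨(l n)⁻¹ • n, by simp [hn]⟩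
  obtain ⟨n₁, hn₁⟩ := hsurj
  by_cases hred : ∃ V' : LieSubmodule ℂ 𝔮 N, V' ≠ ⊥ ∧ V' < invKer l hl
  · obtain ⟨V', hV'0, hV'⟩ := hred
    have hle : V'.toSubmodule ≤ LinearMap.ker l := fun x hx => hV'.le hx
    let l' : (N ⧸ V') →ₗ[ℂ] ℂ := V'.toSubmodule.liftQ l hle
    have hmk : ∀ n, l' (LieSubmodule.Quotient.mk' V' n) = l n := fun n => rfl
    have hfr : Module.finrank ℂ (N ⧸ V') < d := by
      have h1 := Submodule.finrank_quotient_add_finrank V'.toSubmodule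
      have h2 : Module.finrank ℂ V'.toSubmodule ≠ 0 := by
        intro h0
        apply hV'0
        have := Submodule.finrank_eq_zero.mp h0
        exact LieSubmodule.toSubmodule_eq_bot V' |>.mp this
      have h3 : Module.finrank ℂ (N ⧸ V') = Module.finrank ℂ (N ⧸ V'.toSubmodule) := rfl
      omega
    obtain ⟨q, hq, hq1⟩ := ih _ hfr (N := N ⧸ V') rfl l'
      (by
        intro x q
        obtain ⟨n, rfl⟩ := LieSubmodule.Quotient.surjective_mk' V' q
        rw [← LieModuleHom.map_lie, hmk, hl])
      (by
        intro h0
        have := hmk n₁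
        rw [h0, hn₁] at this
        simp at this)
    obtain ⟨n₀, rfl⟩ := LieSubmodule.Quotient.surjective_mk' V' q
    rw [hmk] at hq1
    have hV0 : ∀ x : 𝔮, ⁅x, n₀⁆ ∈ V' := by
      intro x
      have := hq x
      rw [← LieModuleHom.map_lie] at this
      exact (LieSubmodule.Quotient.mk_eq_zero').mp this
    let P := addLine V' n₀ hV0
    have hn₀P : n₀ ∈ P := ⟨1, by simp⟩
    have hP : Module.finrank ℂ P < d := by
      rw [← hN]
      apply Submodule.finrank_lt (s := P.toSubmodule)
      intro htop
      obtain ⟨v, hv, hv'⟩ := SetLike.exists_of_lt hV'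
      have : v ∈ P.toSubmodule := by rw [htop]; trivial
      obtain ⟨t, ht⟩ := this
      have h1 : l (v - t • n₀) = 0 := hle ht
      have h2 : l v = 0 := hv
      have h3 : t = 0 := by simpa [h2, hq1] using h1
      rw [h3, zero_smul, sub_zero] at ht
      exact hv' ht
    obtain ⟨p, hp, hp1⟩ := ih _ hP (N := P) rfl (l ∘ₗ P.toSubmodule.subtype)
      (by intro x p; exact hl x p)
      (by
        intro h0
        have : l n₀ = 0 := LinearMap.congr_fun h0 ⟨n₀, hn₀P⟩
        rw [hq1] at this
        exact one_ne_zero this)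
    exact ⟨p, fun x => congrArg Subtype.val (hp x), hp1⟩
  · push Not at hred
    by_cases hβ : traceForm ℂ 𝔮 N = 0
    · exact ⟨n₁, fun x => lie_eq_zero_of_traceForm_eq_zero hβ x n₁, hn₁⟩
    · obtain ⟨c, hc, hcl, hct⟩ := exists_casimir hβ
      -- Schur lemma on the kernel
      by_cases hV : invKer l hl = ⊥
      · refine ⟨n₁, fun x => ?_, hn₁⟩
        have : ⁅x, n₁⁆ ∈ invKer l hl := hl x n₁
        rw [hV] at this; simpa using this
      have hcV : ∀ n ∈ LinearMap.ker l, c n ∈ LinearMap.ker l := fun n _ => hcl l hl n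
      let cV : Module.End ℂ (LinearMap.ker l) := c.restrict hcV
      have : Nontrivial (LinearMap.ker l) := by
        rw [Submodule.nontrivial_iff_ne_bot]
        intro h0
        exact hV (LieSubmodule.toSubmodule_eq_bot (invKer l hl) |>.mp h0)
      obtain ⟨a, ha⟩ := Module.End.exists_eigenvalue cV
      obtain ⟨v, hv, hv0⟩ := ha.exists_hasEigenvector
      have hv' : c v = a • (v : N) := congrArg Subtype.val (Module.End.mem_eigenspace_iff.mp hv)
      let E : LieSubmodule ℂ 𝔮 N :=
        { LinearMap.ker l ⊓ LinearMap.ker (c - algebraMap ℂ (Module.End ℂ N) a) with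
          lie_mem := by
            rintro x n ⟨hn1, hn2⟩
            refine ⟨hl x n, ?_⟩
            have h2 : c n - a • n = 0 := hn2
            change c ⁅x, n⁆ - a • ⁅x, n⁆ = 0
            rw [hc, ← lie_smul, ← lie_sub, h2, lie_zero] }
      have hE : E = invKer l hl := by
        by_contra hne
        have hle : E ≤ invKer l hl := fun x hx => hx.1
        refine hred E ?_ (lt_of_le_of_ne hle hne)
        intro h0
        have : (v : N) ∈ E := ⟨v.2, by change c v - a • (v : N) = 0; rw [hv', sub_self]⟩
        rw [h0] at this
        exact hv0 (Subtype.ext (by simpa using this))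
      have hscal : ∀ n, l n = 0 → c n = a • n := by
        intro n hn
        have : n ∈ E := by rw [hE]; exact hn
        exact sub_eq_zero.mp this.2
      have ha0 : a ≠ 0 := by
        rintro rfl
        apply hct
        have hsq : c ^ 2 = 0 := by
          ext n
          rw [pow_two, Module.End.mul_apply, hscal _ (hcl l hl n)]; simp
        exact (LinearMap.isNilpotent_trace_of_isNilpotent ⟨2, hsq⟩).eq_zero
      refine ⟨n₁ - a⁻¹ • c n₁, fun x => ?_, by rw [map_sub, map_smul, hcl l hl, hn₁]; simp⟩
      rw [lie_sub, lie_smul, ← hc, hscal _ (hl x n₁), smul_smul, inv_mul_cancel₀ ha0, one_smul,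
        sub_self]
end WeylMain

section FixSection
open LieAlgebra LieModule

universe u v
variable {𝔥 : Type u} [LieRing 𝔥] [LieAlgebra ℂ 𝔥] [FiniteDimensional ℂ 𝔥]

/-- The quotient of a Lie algebra by its radical has trivial radical. -/
lemma hasTrivialRadical_quotient_radical : HasTrivialRadical ℂ (𝔥 ⧸ radical ℂ 𝔥) := by
  apply hasTrivialRadical_of_no_solvable_ideals
  intro I hI
  obtain ⟨k, hk⟩ := hI.solvable (R := ℂ)
  rw [LieIdeal.derivedSeries_eq_bot_iff] at hk
  obtain ⟨r, hr⟩ := (radicalIsSolvable (R := ℂ) (L := 𝔥)).solvable (R := ℂ)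
  rw [LieIdeal.derivedSeries_eq_bot_iff] at hr
  let I' : LieIdeal ℂ 𝔥 :=
    { I.toSubmodule.comap (radical ℂ 𝔥).toSubmodule.mkQ with
      lie_mem := by
        intro x y hy
        exact lie_mem_right ℂ (𝔥 ⧸ radical ℂ 𝔥) I
          (LieSubmodule.Quotient.mk x) (LieSubmodule.Quotient.mk y) hy }
  have hI' : ∀ x, x ∈ I' ↔ (LieSubmodule.Quotient.mk x : 𝔥 ⧸ radical ℂ 𝔥) ∈ I := fun x => Iff.rfl
  have key : ∀ j, ∀ x ∈ derivedSeriesOfIdeal ℂ 𝔥 j I',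
      (LieSubmodule.Quotient.mk x : 𝔥 ⧸ radical ℂ 𝔥) ∈ derivedSeriesOfIdeal ℂ _ j I := by
    intro j
    induction j with
    | zero => intro x hx; exact hx
    | succ j ih =>
      intro x hx
      rw [derivedSeriesOfIdeal_succ, ← LieSubmodule.mem_toSubmodule,
        LieSubmodule.lieIdeal_oper_eq_linear_span'] at hx
      rw [derivedSeriesOfIdeal_succ]
      induction hx using Submodule.span_induction with
      | mem x hx =>
        obtain ⟨a, ha, b, hb, rfl⟩ := hx
        rw [LieSubmodule.Quotient.mk_bracket]
        exact LieSubmodule.lie_mem_lie (ih a ha) (ih b hb)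
      | zero => exact zero_mem _
      | add a b _ _ ha hb => exact add_mem ha hb
      | smul t a _ ha => exact SMulMemClass.smul_mem t ha
  have hsol : IsSolvable I' := by
    refine IsSolvable.mk (R := ℂ) (k := r + k) ?_
    rw [LieIdeal.derivedSeries_eq_bot_iff, derivedSeriesOfIdeal_add, eq_bot_iff, ← hr]
    apply derivedSeriesOfIdeal_mono
    intro x hx
    have := key k x hx
    rw [hk] at this
    exact LieSubmodule.Quotient.mk_eq_zero'.mp (by simpa using this)
  have hle := (LieIdeal.solvable_iff_le_radical ℂ 𝔥 I').mp hsol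
  rw [eq_bot_iff]
  intro q hq
  obtain ⟨x, rfl⟩ := LieSubmodule.Quotient.surjective_mk' _ q
  have : x ∈ radical ℂ 𝔥 := hle ((hI' x).mpr hq)
  exact (LieSubmodule.mem_bot _).mpr (LieSubmodule.Quotient.mk_eq_zero'.mpr this)

/-- Invariant functionals lift to invariant vectors when the radical is central and acts
semisimply. -/
theorem exists_invariant_of_central_radical
    (hcen : ∀ z ∈ radical ℂ 𝔥, ∀ x : 𝔥, ⁅x, z⁆ = 0) (d : ℕ) :
    ∀ {X : Type v} [AddCommGroup X] [Module ℂ X] [LieRingModule 𝔥 X] [LieModule ℂ 𝔥 X]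
      [FiniteDimensional ℂ X], Module.finrank ℂ X = d →
      (∀ z ∈ radical ℂ 𝔥, (toEnd ℂ 𝔥 X z).IsSemisimple) →
      ∀ l : X →ₗ[ℂ] ℂ, (∀ (x : 𝔥) n, l ⁅x, n⁆ = 0) → l ≠ 0 →
      ∃ n, (∀ x : 𝔥, ⁅x, n⁆ = 0) ∧ l n = 1 := by
  induction d using Nat.strong_induction_on with
  | _ d ih =>
  intro X _ _ _ _ _ hX hss l hl hl0
  by_cases hz : ∃ z ∈ radical ℂ 𝔥, toEnd ℂ 𝔥 X z ≠ 0
  · obtain ⟨z, hz, hz0⟩ := hz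
    let P : LieSubmodule ℂ 𝔥 X :=
      { LinearMap.ker (toEnd ℂ 𝔥 X z) with
        lie_mem := by
          intro x n hn
          have hn' : ⁅z, n⁆ = 0 := hn
          change ⁅z, ⁅x, n⁆⁆ = 0
          rw [leibniz_lie, hn', lie_zero, add_zero, ← lie_skew, hcen z hz x]; simp }
    have hPd : Module.finrank ℂ P < d := by
      rw [← hX]
      apply Submodule.finrank_lt (s := P.toSubmodule)
      intro htop
      exact hz0 (LinearMap.ker_eq_top.mp htop)
    obtain ⟨p, hp, hp1⟩ := ih _ hPd (X := P) rfl
      (by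
        intro w hw
        exact (hss w hw).restrict (p := P.toSubmodule) (by
          intro n hn; exact P.lie_mem hn))
      (l ∘ₗ P.toSubmodule.subtype) (fun x n => hl x n)
      (by
        intro h0
        apply hl0
        have hsup : LinearMap.ker (toEnd ℂ 𝔥 X z) ⊔ LinearMap.range (toEnd ℂ 𝔥 X z) = ⊤ := by
          have hs := hss z hz
          rw [Module.End.isSemisimple_iff] at hs
          obtain ⟨q, hq, hcomp⟩ := hs (LinearMap.ker (toEnd ℂ 𝔥 X z))
            (by intro n hn; simp [show ⁅z, n⁆ = 0 from hn])
          rw [eq_top_iff, ← hcomp.codisjoint.eq_top]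
          refine sup_le_sup_left ?_ _
          have hmap : q.map (toEnd ℂ 𝔥 X z) = q := by
            have hle : q.map (toEnd ℂ 𝔥 X z) ≤ q := by
              rw [Submodule.map_le_iff_le_comap]; exact hq
            apply Submodule.eq_of_le_of_finrank_eq hle
            have hinj : Function.Injective ((toEnd ℂ 𝔥 X z).domRestrict q) := by
              rw [← LinearMap.ker_eq_bot, eq_bot_iff]
              intro w hw
              have := hcomp.disjoint.le_bot (show (w : X) ∈ _ ⊓ q from ⟨hw, w.2⟩)
              exact Subtype.ext (by simpa using this)
            have := LinearMap.finrank_range_of_inj hinj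
            rwa [LinearMap.range_domRestrict] at this
          rw [← hmap]
          exact LinearMap.map_le_range
        ext n
        have : n ∈ LinearMap.ker (toEnd ℂ 𝔥 X z) ⊔ LinearMap.range (toEnd ℂ 𝔥 X z) := by
          rw [hsup]; trivial
        obtain ⟨a, ha, b, ⟨c, rfl⟩, rfl⟩ := Submodule.mem_sup.mp this
        have h1 : l a = 0 := LinearMap.congr_fun h0 ⟨a, ha⟩
        have h2 : l (toEnd ℂ 𝔥 X z c) = 0 := hl z c
        rw [map_add, h1, h2]; simp)
    exact ⟨p, fun x => congrArg Subtype.val (hp x), hp1⟩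
  · push Not at hz
    let t : (𝔥 ⧸ radical ℂ 𝔥) →ₗ[ℂ] Module.End ℂ X :=
      (radical ℂ 𝔥).toSubmodule.liftQ (toEnd ℂ 𝔥 X : 𝔥 →ₗ[ℂ] Module.End ℂ X) (fun z h => hz z h)
    have ht : ∀ x n, t (LieSubmodule.Quotient.mk x) n = ⁅x, n⁆ := fun x n => rfl
    have hmk := LieSubmodule.Quotient.surjective_mk' (radical ℂ 𝔥)
    let : LieRingModule (𝔥 ⧸ radical ℂ 𝔥) X :=
      { bracket := fun q n => t q n
        add_lie := by intro a b n; change t (a + b) n = t a n + t b n; simp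
        lie_add := by intro a n m; simp
        leibniz_lie := by
          intro a b n
          obtain ⟨a, rfl⟩ := hmk a
          obtain ⟨b, rfl⟩ := hmk b
          exact leibniz_lie a b n }
    let : LieModule ℂ (𝔥 ⧸ radical ℂ 𝔥) X :=
      { smul_lie := by intro c a n; change t (c • a) n = c • t a n; simp
        lie_smul := by intro c a n; change t a (c • n) = c • t a n; simp }
    have := hasTrivialRadical_quotient_radical (𝔥 := 𝔥)
    have : FiniteDimensional ℂ (𝔥 ⧸ radical ℂ 𝔥) :=
      inferInstanceAs (FiniteDimensional ℂ (𝔥 ⧸ (radical ℂ 𝔥).toSubmodule))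
    obtain ⟨n, hn, hn1⟩ := exists_invariant_of_hasTrivialRadical (𝔮 := 𝔥 ⧸ radical ℂ 𝔥) d hX l
      (by
        intro x n
        obtain ⟨x, rfl⟩ := hmk x
        exact hl x n) hl0
    exact ⟨n, fun x => hn (LieSubmodule.Quotient.mk x), hn1⟩
end FixSection

/-! ### Abstract affine groups and their point derivations -/

/-- A group together with its algebra of regular functions. -/
structure RegGroup (Γ : Type) [Group Γ] where
  A : Subalgebra ℂ (Γ → ℂ)
  fg : A.FG
  comul : ∀ f ∈ A, ∃ (k : ℕ) (a b : Fin k → A), ∀ g h,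
    f (g * h) = ∑ j, (a j : Γ → ℂ) g * (b j : Γ → ℂ) h
  inv : ∀ f ∈ A, (fun g => f g⁻¹) ∈ A
  pts : ∀ χ : A →ₐ[ℂ] ℂ, ∃ g, ∀ f : A, χ f = (f : Γ → ℂ) g

namespace RegGroup

variable {Γ : Type} [Group Γ] (𝒜 : RegGroup Γ)

/-- Point derivations at the identity. -/
def PD : Submodule ℂ (𝒜.A →ₗ[ℂ] ℂ) where
  carrier := {δ | ∀ f g : 𝒜.A, δ (f * g) = f.1 1 * δ g + g.1 1 * δ f}
  zero_mem' := by intro f g; simp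
  add_mem' := by
    intro a b ha hb f g
    simp only [LinearMap.add_apply, ha f g, hb f g]; ring
  smul_mem' := by
    intro t a ha f g
    simp only [LinearMap.smul_apply, ha f g, smul_eq_mul]; ring

variable {𝒜}

@[ext] lemma A_ext {f g : 𝒜.A} (h : ∀ x, f.1 x = g.1 x) : f = g := Subtype.ext (funext h)

lemma PD_mul (δ : 𝒜.PD) (f g : 𝒜.A) : δ.1 (f * g) = f.1 1 * δ.1 g + g.1 1 * δ.1 f := δ.2 f g

lemma PD_one (δ : 𝒜.PD) : δ.1 1 = 0 := by
  have := PD_mul δ 1 1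
  simp only [mul_one] at this
  simpa using this

lemma PD_eq_zero_of_const (δ : 𝒜.PD) (f : 𝒜.A) (h : ∀ g, f.1 g = f.1 1) : δ.1 f = 0 := by
  have : f = f.1 1 • (1 : 𝒜.A) := by
    ext x; simp [h x]
  rw [this, map_smul, PD_one, smul_zero]

/-- Evaluation at a point. -/
def ev (g : Γ) : 𝒜.A →ₐ[ℂ] ℂ := (Pi.evalAlgHom ℂ (fun _ : Γ => ℂ) g).comp 𝒜.A.val

@[simp] lemma ev_apply (g : Γ) (f : 𝒜.A) : ev g f = f.1 g := rfl

/-- Left translation of functions. -/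
def lt (g : Γ) : 𝒜.A →ₐ[ℂ] 𝒜.A where
  toFun f := ⟨fun x => f.1 (g * x), by
    obtain ⟨k, a, b, h⟩ := 𝒜.comul f.1 f.2
    have : (fun x => f.1 (g * x)) = ∑ j, (a j).1 g • (b j).1 := by
      funext x; rw [h]; simp
    rw [this]
    exact sum_mem fun j _ => 𝒜.A.smul_mem (b j).2 _⟩
  map_one' := rfl
  map_mul' _ _ := rfl
  map_zero' := rfl
  map_add' _ _ := rfl
  commutes' _ := rfl

@[simp] lemma lt_apply (g x : Γ) (f : 𝒜.A) : (lt g f).1 x = f.1 (g * x) := rfl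

lemma lt_lt (g h : Γ) (f : 𝒜.A) : lt h (lt g f) = lt (g * h) f := by
  ext x; simp [mul_assoc]

@[simp] lemma lt_one (f : 𝒜.A) : lt 1 f = f := by ext x; simp

/-- The left invariant vector field of a linear functional. -/
def lvf (δ : 𝒜.A →ₗ[ℂ] ℂ) : 𝒜.A →ₗ[ℂ] 𝒜.A where
  toFun f := ⟨fun g => δ (lt g f), by
    obtain ⟨k, a, b, h⟩ := 𝒜.comul f.1 f.2
    have : (fun g => δ (lt g f)) = ∑ j, δ (b j) • (a j).1 := by
      funext g
      have : lt g f = ∑ j, (a j).1 g • b j := by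
        ext x; simp [h]
      rw [this]; simp [mul_comm]
    rw [this]
    exact sum_mem fun j _ => 𝒜.A.smul_mem (a j).2 _⟩
  map_add' _ _ := by ext x; simp
  map_smul' _ _ := by ext x; simp

@[simp] lemma lvf_apply (δ : 𝒜.A →ₗ[ℂ] ℂ) (f : 𝒜.A) (g : Γ) : (lvf δ f).1 g = δ (lt g f) := rfl

lemma lvf_apply_one (δ : 𝒜.A →ₗ[ℂ] ℂ) (f : 𝒜.A) : (lvf δ f).1 1 = δ f := by simp

lemma lt_lvf (δ : 𝒜.A →ₗ[ℂ] ℂ) (f : 𝒜.A) (g : Γ) : lt g (lvf δ f) = lvf δ (lt g f) := by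
  ext x; simp [lt_lt]

lemma lvf_mul (δ : 𝒜.PD) (f g : 𝒜.A) : lvf δ.1 (f * g) = f * lvf δ.1 g + g * lvf δ.1 f := by
  ext x
  simp [PD_mul]

lemma lvf_one (δ : 𝒜.PD) : lvf δ.1 (1 : 𝒜.A) = 0 := by
  ext x
  have : (lt x (1 : 𝒜.A)) = 1 := map_one _
  simp [PD_one]

/-- An operator commuting with left translations is the left invariant field of its value
at the identity. -/
lemma eq_lvf (S : 𝒜.A →ₗ[ℂ] 𝒜.A) (hS : ∀ g f, lt g (S f) = S (lt g f)) :
    S = lvf ((ev 1).toLinearMap ∘ₗ S) := by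
  ext f x
  simp [← hS]

/-- The bracket of point derivations. -/
def pdBracket (δ ε : 𝒜.PD) : 𝒜.PD :=
  ⟨δ.1 ∘ₗ lvf ε.1 - ε.1 ∘ₗ lvf δ.1, by
    intro f g
    simp only [LinearMap.sub_apply, LinearMap.comp_apply, lvf_mul, map_add, PD_mul, lvf_apply_one]
    ring⟩

lemma pdBracket_apply (δ ε : 𝒜.PD) (f : 𝒜.A) :
    (pdBracket δ ε).1 f = δ.1 (lvf ε.1 f) - ε.1 (lvf δ.1 f) := rfl

/-! ### Representations in finite-dimensional algebras -/

section Rep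
variable {E : Type*} [Ring E] [Algebra ℂ E]

variable (𝒜) in
/-- A homomorphism to an algebra whose matrix coefficients are regular. -/
def IsAlgHom (ρ : Γ →* E) : Prop := ∀ l : Module.Dual ℂ E, (fun g => l (ρ g)) ∈ 𝒜.A

/-- The matrix coefficients as regular functions. -/
def coeff {ρ : Γ →* E} (hρ : 𝒜.IsAlgHom ρ) : Module.Dual ℂ E →ₗ[ℂ] 𝒜.A where
  toFun l := ⟨fun g => l (ρ g), hρ l⟩
  map_add' _ _ := rfl
  map_smul' _ _ := rfl

@[simp] lemma coeff_apply {ρ : Γ →* E} (hρ : 𝒜.IsAlgHom ρ) (l : Module.Dual ℂ E) (g : Γ) :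
    (coeff hρ l).1 g = l (ρ g) := rfl

variable [FiniteDimensional ℂ E]

/-- The differential at the identity. -/
def diff {ρ : Γ →* E} (hρ : 𝒜.IsAlgHom ρ) : 𝒜.PD →ₗ[ℂ] E :=
  (Module.evalEquiv ℂ E).symm.toLinearMap ∘ₗ
    (LinearMap.lcomp ℂ ℂ (coeff hρ)) ∘ₗ 𝒜.PD.subtype

lemma diff_spec {ρ : Γ →* E} (hρ : 𝒜.IsAlgHom ρ) (δ : 𝒜.PD) (l : Module.Dual ℂ E) :
    l (diff hρ δ) = δ.1 (coeff hρ l) := by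
  simp [diff]

lemma ext_dual {x y : E} (h : ∀ l : Module.Dual ℂ E, l x = l y) : x = y := by
  rw [← sub_eq_zero, ← Module.forall_dual_apply_eq_zero_iff ℂ]
  intro l; rw [map_sub, h, sub_self]

lemma lvf_coeff {ρ : Γ →* E} (hρ : 𝒜.IsAlgHom ρ) (δ : 𝒜.PD) (l : Module.Dual ℂ E) :
    lvf δ.1 (coeff hρ l) = coeff hρ (l ∘ₗ LinearMap.mulRight ℂ (diff hρ δ)) := by
  ext g
  have : lt g (coeff hρ l) = coeff hρ (l ∘ₗ LinearMap.mulLeft ℂ (ρ g)) := by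
    ext x; simp
  rw [lvf_apply, this, ← diff_spec]
  simp

lemma diff_pdBracket {ρ : Γ →* E} (hρ : 𝒜.IsAlgHom ρ) (δ ε : 𝒜.PD) :
    diff hρ (pdBracket δ ε) = diff hρ δ * diff hρ ε - diff hρ ε * diff hρ δ := by
  apply ext_dual
  intro l
  rw [diff_spec, pdBracket_apply, lvf_coeff, lvf_coeff, ← diff_spec, ← diff_spec]
  simp

/-- If `l ∘ ρ` is constant then `l` vanishes on the differential. -/
lemma diff_eq_zero_of_const {ρ : Γ →* E} (hρ : 𝒜.IsAlgHom ρ) (δ : 𝒜.PD) (l : Module.Dual ℂ E)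
    (h : ∀ g, l (ρ g) = l 1) : l (diff hρ δ) = 0 := by
  rw [diff_spec]
  apply PD_eq_zero_of_const
  intro g; simp [h g]

end Rep
end RegGroup

namespace RegGroup

variable {Γ : Type} [Group Γ] {𝒜 : RegGroup Γ}

variable (𝒜) in
/-- Zariski connectedness. -/
def Conn : Prop := ∀ S T : Set 𝒜.A,
  (∀ g, (∀ p ∈ S, p.1 g = 0) ∨ (∀ p ∈ T, p.1 g = 0)) →
  (∀ g, ¬ ((∀ p ∈ S, p.1 g = 0) ∧ (∀ p ∈ T, p.1 g = 0))) →
  (∀ g, ∀ p ∈ S, p.1 g = 0) ∨ (∀ g, ∀ p ∈ T, p.1 g = 0)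

variable (𝒜) in
/-- The maximal ideal of the identity. -/
def maxId : Ideal 𝒜.A := RingHom.ker (ev (𝒜 := 𝒜) 1)

lemma mem_maxId {f : 𝒜.A} : f ∈ 𝒜.maxId ↔ f.1 1 = 0 := Iff.rfl

instance PD_finite : FiniteDimensional ℂ 𝒜.PD := by
  obtain ⟨s, hs⟩ := 𝒜.A.fg_top.2 𝒜.fg
  let T : 𝒜.PD →ₗ[ℂ] (s → ℂ) :=
    { toFun := fun δ f => δ.1 f.1
      map_add' := fun _ _ => rfl
      map_smul' := fun _ _ => rfl }
  refine FiniteDimensional.of_injective T ?_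
  rw [← LinearMap.ker_eq_bot, LinearMap.ker_eq_bot']
  intro δ hδ
  ext f
  have hf : f ∈ Algebra.adjoin ℂ (s : Set 𝒜.A) := hs ▸ Algebra.mem_top
  induction hf using Algebra.adjoin_induction with
  | mem x hx => exact congrFun hδ ⟨x, hx⟩
  | algebraMap r =>
    rw [Algebra.algebraMap_eq_smul_one, map_smul, PD_one]; simp
  | add x y _ _ hx hy => simpa using by rw [hx, hy]; simp
  | mul x y _ _ hx hy =>
    rw [PD_mul]
    have hx' : δ.1 x = 0 := hx
    have hy' : δ.1 y = 0 := hy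
    simp [hx', hy']

instance A_noeth : IsNoetherianRing 𝒜.A := by
  have : Algebra.FiniteType ℂ 𝒜.A := 𝒜.A.fg_iff_finiteType.1 𝒜.fg
  exact Algebra.FiniteType.isNoetherianRing ℂ 𝒜.A

lemma mem_maxId_sq {f : 𝒜.A} (hf : f ∈ 𝒜.maxId) (h : ∀ δ : 𝒜.PD, δ.1 f = 0) :
    f ∈ 𝒜.maxId ^ 2 := by
  by_contra hn
  set P : Submodule ℂ 𝒜.A := (𝒜.maxId ^ 2).restrictScalars ℂ ⊔ Submodule.span ℂ {1} with hP
  have hfP : f ∉ P := by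
    intro hfP
    obtain ⟨a, ha, b, hb, hab⟩ := Submodule.mem_sup.1 hfP
    obtain ⟨t, rfl⟩ := Submodule.mem_span_singleton.1 hb
    have ha1 : a.1 1 = 0 := mem_maxId.1 (Ideal.pow_le_self two_ne_zero ha)
    have : f.1 1 = 0 := hf
    rw [← hab] at this
    have ht : t = 0 := by simpa [ha1] using this
    apply hn
    rw [← hab, ht, zero_smul, add_zero]
    exact ha
  obtain ⟨φ, hφ, hle⟩ := Submodule.exists_le_ker_of_notMem hfP
  have h1 : φ 1 = 0 := hle (Submodule.mem_sup_right (Submodule.mem_span_singleton_self _))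
  have h2 : ∀ a ∈ 𝒜.maxId, ∀ b ∈ 𝒜.maxId, φ (a * b) = 0 := fun a ha b hb =>
    hle (Submodule.mem_sup_left (by
      change a * b ∈ 𝒜.maxId ^ 2
      rw [pow_two]; exact Ideal.mul_mem_mul ha hb))
  have hpd : φ ∈ 𝒜.PD := by
    intro a b
    have := h2 (a - a.1 1 • 1) (by rw [mem_maxId]; simp) (b - b.1 1 • 1) (by rw [mem_maxId]; simp)
    have e : (a - a.1 1 • 1) * (b - b.1 1 • 1)
        = a * b - a.1 1 • b - b.1 1 • a + (a.1 1 * b.1 1) • (1 : 𝒜.A) := by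
      ext x; simp; ring
    rw [e] at this
    simp only [map_add, map_sub, map_smul, h1, smul_eq_mul, mul_zero, add_zero] at this
    linear_combination this
  exact hφ (h ⟨φ, hpd⟩)

lemma exists_dual_functions : ∃ (k : ℕ) (δ : Fin k → 𝒜.PD) (h : Fin k → 𝒜.A),
    (∀ i, h i ∈ 𝒜.maxId) ∧ ∀ ε : 𝒜.PD, ε = ∑ i, ε.1 (h i) • δ i := by
  let b := Module.finBasis ℂ 𝒜.PD
  let T : 𝒜.A →ₗ[ℂ] (Fin (Module.finrank ℂ 𝒜.PD) → ℂ) := LinearMap.pi fun i => (b i).1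
  have hT : Function.Surjective T := by
    rw [← LinearMap.range_eq_top]
    by_contra hne
    obtain ⟨φ, hφ, hle⟩ := Submodule.exists_le_ker_of_lt_top _ (lt_top_iff_ne_top.2 hne)
    apply hφ
    have hz : ∑ i, φ (Pi.single i 1) • b i = 0 := by
      ext f
      have h0 : φ (T f) = 0 := hle ⟨f, rfl⟩
      rw [← LinearMap.sum_single_apply (fun _ => ℂ) (T f), map_sum] at h0
      simp only [Submodule.coe_sum, Submodule.coe_smul, LinearMap.sum_apply, LinearMap.smul_apply,
        smul_eq_mul, Submodule.coe_zero, LinearMap.zero_apply]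
      rw [← h0]
      refine Finset.sum_congr rfl fun i _ => ?_
      have : (Pi.single i (T f i) : Fin _ → ℂ) = T f i • Pi.single i 1 := by
        rw [← Pi.single_smul]; simp
      rw [this, map_smul, smul_eq_mul, mul_comm]
      rfl
    have := Fintype.linearIndependent_iff.1 b.linearIndependent _ hz
    refine LinearMap.pi_ext' fun i => LinearMap.ext_ring ?_
    simpa using this i
  choose u hu using fun i => hT (Pi.single i 1)
  refine ⟨_, b, fun i => u i - (u i).1 1 • 1, fun i => by rw [mem_maxId]; simp, fun ε => ?_⟩
  have key : ∀ i, ε.1 (u i - (u i).1 1 • 1) = b.repr ε i := by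
    intro i
    rw [map_sub, map_smul, PD_one, smul_zero, sub_zero]
    conv_lhs => rw [← b.sum_repr ε]
    simp only [Submodule.coe_sum, Submodule.coe_smul, LinearMap.sum_apply, LinearMap.smul_apply,
      smul_eq_mul]
    have : ∀ j, (b j).1 (u i) = (Pi.single i 1 : Fin _ → ℂ) j := fun j => congrFun (hu i) j
    simp [this, Pi.single_apply]
  simp only [key]
  exact (b.sum_repr ε).symm

/-- The functions obtained from `f` by applying left invariant derivations. -/
inductive Word (f : 𝒜.A) : 𝒜.A → Prop
  | base : Word f f
  | step (δ : 𝒜.PD) (u : 𝒜.A) (h : Word f u) : Word f (lvf δ.1 u)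

lemma Word.trans {f u v : 𝒜.A} (h : Word f u) (h' : Word u v) : Word f v := by
  induction h' with
  | base => exact h
  | step δ w _ ih => exact .step δ w ih

lemma Word.lt {f u : 𝒜.A} (g : Γ) (h : Word f u) : Word (lt g f) (lt g u) := by
  induction h with
  | base => exact .base
  | step δ w _ ih => rw [lt_lvf]; exact .step δ _ ih

lemma mem_pow_maxId_of_words (n : ℕ) : ∀ f : 𝒜.A, (∀ u, Word f u → u.1 1 = 0) →
    f ∈ 𝒜.maxId ^ (n + 1) := by
  obtain ⟨k, δ, h, hm, hdual⟩ := exists_dual_functions (𝒜 := 𝒜)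
  let 𝓔 : 𝒜.A → 𝒜.A := fun f => ∑ i, h i * lvf (δ i).1 f
  have hadd : ∀ f g, 𝓔 (f + g) = 𝓔 f + 𝓔 g := fun f g => by
    simp only [𝓔, map_add, mul_add, Finset.sum_add_distrib]
  have hmul : ∀ f g, 𝓔 (f * g) = f * 𝓔 g + g * 𝓔 f := fun f g => by
    simp only [𝓔, lvf_mul, mul_add, Finset.sum_add_distrib, Finset.mul_sum]
    congr 1 <;> refine Finset.sum_congr rfl fun i _ => by ring
  have h1 : ∀ f ∈ 𝒜.maxId, 𝓔 f - f ∈ 𝒜.maxId ^ 2 := by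
    intro f hf
    refine mem_maxId_sq (sub_mem (sum_mem fun i _ => Ideal.mul_mem_right _ _ (hm i)) hf) ?_
    intro ε
    simp only [𝓔, map_sub, map_sum, PD_mul, lvf_apply_one, mem_maxId.1 (hm _), zero_mul, zero_add]
    rw [sub_eq_zero]
    conv_rhs => rw [hdual ε]
    simp [mul_comm]
  have hpow : ∀ (j : ℕ) (f), f ∈ 𝒜.maxId ^ (j + 1) →
      𝓔 f - ((j + 1 : ℕ) : 𝒜.A) * f ∈ 𝒜.maxId ^ (j + 2) := by
    intro j
    induction j with
    | zero => intro f hf; simpa using h1 f (by simpa using hf)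
    | succ j ih =>
      intro f hf
      rw [pow_succ] at hf
      refine Submodule.mul_induction_on hf ?_ ?_
      · intro a ha b hb
        have e : 𝓔 (a * b) - ((j + 1 + 1 : ℕ) : 𝒜.A) * (a * b)
            = a * (𝓔 b - b) + (𝓔 a - ((j + 1 : ℕ) : 𝒜.A) * a) * b := by
          rw [hmul]; push_cast; ring
        rw [e]
        refine add_mem ?_ ?_
        · have := Ideal.mul_mem_mul ha (h1 b hb)
          rwa [← pow_add] at this
        · have := Ideal.mul_mem_mul (ih a ha) hb
          rwa [← pow_succ] at this
      · intro a b ha hb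
        rw [hadd]
        convert add_mem ha hb using 1
        ring
  induction n with
  | zero => intro f hf; simpa using mem_maxId.2 (hf f .base)
  | succ n ih =>
    intro f hf
    have e1 : 𝓔 f ∈ 𝒜.maxId ^ (n + 2) := by
      refine sum_mem fun i _ => ?_
      rw [pow_succ']
      exact Ideal.mul_mem_mul (hm i) (ih _ fun u hu => hf u ((Word.step _ _ .base).trans hu))
    have e2 := sub_mem e1 (hpow n f (ih f hf))
    rw [sub_sub_cancel] at e2
    have : f = (((n + 1 : ℕ) : ℂ)⁻¹ • (1 : 𝒜.A)) * (((n + 1 : ℕ) : 𝒜.A) * f) := by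
      ext x
      have : ((n : ℂ) + 1) ≠ 0 := by exact_mod_cast Nat.succ_ne_zero n
      simp
      field_simp
    rw [this]
    exact Ideal.mul_mem_left _ _ e2

lemma exists_annihilator_of_words (f : 𝒜.A) (hf : ∀ u, Word f u → u.1 1 = 0) :
    ∃ s : 𝒜.A, s.1 1 = 1 ∧ s * f = 0 := by
  have : f ∈ (⨅ i : ℕ, 𝒜.maxId ^ i • ⊤ : Submodule 𝒜.A 𝒜.A) := by
    rw [Submodule.mem_iInf]
    intro i
    have := mem_pow_maxId_of_words i f hf
    have := Ideal.pow_le_pow_right (Nat.le_succ i) this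
    simpa using this
  rw [Ideal.mem_iInf_smul_pow_eq_bot_iff] at this
  obtain ⟨r, hr⟩ := this
  refine ⟨1 - r.1, ?_, ?_⟩
  · have := mem_maxId.1 r.2
    simp [this]
  · rw [sub_mul, one_mul, ← smul_eq_mul, hr, sub_self]

/-- On a connected group a function with vanishing Taylor series at the identity vanishes. -/
theorem eq_zero_of_words (hc : 𝒜.Conn) (f : 𝒜.A) (hf : ∀ u, Word f u → u.1 1 = 0) : f = 0 := by
  have key := hc {u | Word f u} {p | p * f = 0} ?_ ?_
  · rcases key with h | h
    · ext g; exact h g f .base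
    · exfalso
      obtain ⟨s, hs, hsf⟩ := exists_annihilator_of_words f hf
      have := h 1 s hsf
      rw [hs] at this
      exact one_ne_zero this
  · intro g
    by_contra! hcon
    obtain ⟨⟨u, hu, hug⟩, p, hp, hpg⟩ := hcon
    have : ∃ q : 𝒜.A, q.1 g ≠ 0 ∧ q * u = 0 := by
      clear hug
      induction (show Word f u from hu) with
      | base => exact ⟨p, hpg, hp⟩
      | step δ w hw ih =>
        obtain ⟨q, hq, hqw⟩ := ih hw
        refine ⟨q * q, by simpa using hq, ?_⟩
        have e := lvf_mul δ q w
        rw [hqw, map_zero] at e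
        calc q * q * lvf δ.1 w = q * (q * lvf δ.1 w + w * lvf δ.1 q) - (q * w) * lvf δ.1 q := by ring
          _ = 0 := by rw [← e, hqw]; ring
    obtain ⟨q, hq, hqu⟩ := this
    have : q.1 g * u.1 g = 0 := congrFun (congrArg Subtype.val hqu) g
    exact (mul_ne_zero hq hug) this
  · rintro g ⟨h1, h2⟩
    obtain ⟨s, hs, hsf⟩ := exists_annihilator_of_words (RegGroup.lt g f) (by
      intro u hu
      have := hu.lt g⁻¹
      rw [lt_lt, mul_inv_cancel, lt_one] at this
      have := h1 _ this
      simpa using this)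
    have := h2 (RegGroup.lt g⁻¹ s) (by
      have := congrArg (RegGroup.lt g⁻¹) hsf
      rw [map_mul, lt_lt, mul_inv_cancel, lt_one, map_zero] at this
      exact this)
    simp [hs] at this

section Rep
variable {E : Type*} [Ring E] [Algebra ℂ E] [FiniteDimensional ℂ E]

/-- Functionals on the image of a connected group are controlled by the differential. -/
theorem coeff_const (hc : 𝒜.Conn) {ρ : Γ →* E} (hρ : 𝒜.IsAlgHom ρ) (N : Set (Module.Dual ℂ E))
    (h1 : ∀ l ∈ N, l 1 = 0)
    (hN : ∀ l ∈ N, ∀ δ, l ∘ₗ LinearMap.mulRight ℂ (diff hρ δ) ∈ N)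
    (Λ : Module.Dual ℂ E) (hΛ : ∀ δ, Λ ∘ₗ LinearMap.mulRight ℂ (diff hρ δ) ∈ N) (g : Γ) :
    Λ (ρ g) = Λ 1 := by
  have key : coeff hρ Λ - Λ 1 • (1 : 𝒜.A) = 0 := by
    apply eq_zero_of_words hc
    intro u hu
    have : u = coeff hρ Λ - Λ 1 • (1 : 𝒜.A) ∨ ∃ l ∈ N, u = coeff hρ l := by
      induction hu with
      | base => exact Or.inl rfl
      | step δ w _ ih =>
        right
        rcases ih with rfl | ⟨l, hl, rfl⟩
        · exact ⟨_, hΛ δ, by rw [map_sub, map_smul, lvf_one, smul_zero, sub_zero, lvf_coeff]⟩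
        · exact ⟨_, hN l hl δ, lvf_coeff _ _ _⟩
    rcases this with rfl | ⟨l, hl, rfl⟩
    · simp
    · simpa using h1 l hl
  have := congrFun (congrArg Subtype.val key) g
  simpa [sub_eq_zero] using this

end Rep
end RegGroup

/-- Iterated Leibniz rule. -/
lemma pow_apply_mul_of_leibniz {A : Type*} [CommRing A] [Algebra ℂ A] {D D₁ D₂ : Module.End ℂ A}
    (h : ∀ f g, D (f * g) = D₁ f * g + f * D₂ g) (n : ℕ) (f g : A) :
    (D ^ n) (f * g) = ∑ m ∈ Finset.HasAntidiagonal.antidiagonal n,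
      n.choose m.1 • ((D₁ ^ m.1) f * (D₂ ^ m.2) g) := by
  let T₁ : Module.End ℂ (TensorProduct ℂ A A) := D₁.rTensor A
  let T₂ : Module.End ℂ (TensorProduct ℂ A A) := D₂.lTensor A
  have hcomm : Commute T₁ T₂ := by
    ext a b
    simp [T₁, T₂]
  have hμ : ∀ x, LinearMap.mul' ℂ A ((T₁ + T₂) x) = D (LinearMap.mul' ℂ A x) := by
    intro x
    induction x using TensorProduct.induction_on with
    | zero => simp
    | tmul a b => simp [T₁, T₂, h]
    | add a b ha hb => rw [map_add, map_add, ha, hb, map_add, map_add]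
  have hμn : ∀ n x, LinearMap.mul' ℂ A (((T₁ + T₂) ^ n) x) = (D ^ n) (LinearMap.mul' ℂ A x) := by
    intro n
    induction n with
    | zero => intro x; simp
    | succ n ih => intro x; rw [pow_succ, Module.End.mul_apply, ih, hμ, pow_succ]; rfl
  have := hμn n (f ⊗ₜ g)
  rw [hcomm.add_pow'] at this
  simp only [LinearMap.mul'_apply] at this
  rw [← this, LinearMap.sum_apply, map_sum]
  refine Finset.sum_congr rfl fun m _ => ?_
  have h1 : T₁ ^ m.1 = (D₁ ^ m.1).rTensor A := LinearMap.rTensor_pow D₁ m.1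
  have h2 : T₂ ^ m.2 = (D₂ ^ m.2).lTensor A := LinearMap.lTensor_pow D₂ m.2
  rw [LinearMap.smul_apply, map_nsmul, h1, h2]
  simp

namespace RegGroup

variable {Γ : Type} [Group Γ] {𝒜 : RegGroup Γ}

lemma isAlgHom_end_of {V : Type*} [AddCommGroup V] [Module ℂ V] [FiniteDimensional ℂ V]
    {ρ : Γ →* Module.End ℂ V}
    (h : ∀ (φ : Module.Dual ℂ V) (v : V), (fun g => φ (ρ g v)) ∈ 𝒜.A) : 𝒜.IsAlgHom ρ := by
  intro l
  let b := Module.finBasis ℂ V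
  have key : ∀ T : Module.End ℂ V, l T = ∑ i, ∑ j, b.coord i (T (b j)) *
      l (Matrix.toLin b b (Matrix.single i j 1)) := by
    intro T
    conv_lhs => rw [← Matrix.toLin_toMatrix b b T, Matrix.matrix_eq_sum_single
      (LinearMap.toMatrix b b T)]
    simp only [map_sum]
    refine Finset.sum_congr rfl fun i _ => Finset.sum_congr rfl fun j _ => ?_
    have : Matrix.single i j (LinearMap.toMatrix b b T i j)
        = LinearMap.toMatrix b b T i j • Matrix.single i j (1 : ℂ) := by simp
    rw [this, map_smul, map_smul, smul_eq_mul, LinearMap.toMatrix_apply]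
    rfl
  have : (fun g => l (ρ g)) = ∑ i, ∑ j, l (Matrix.toLin b b (Matrix.single i j 1)) •
      (fun g => b.coord i (ρ g (b j))) := by
    funext g
    rw [key]
    simp only [Finset.sum_apply, Pi.smul_apply, smul_eq_mul, mul_comm]
  rw [this]
  exact sum_mem fun i _ => sum_mem fun j _ => 𝒜.A.smul_mem (h _ _) _

/-- Right translation of functions. -/
def rt (g : Γ) : (Γ → ℂ) →ₗ[ℂ] (Γ → ℂ) where
  toFun f x := f (x * g)
  map_add' _ _ := rfl
  map_smul' _ _ := rfl

@[simp] lemma rt_apply (g x : Γ) (f : Γ → ℂ) : rt g f x = f (x * g) := rfl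

variable (𝒜) in
/-- Every finite set of functions consists of matrix coefficients of a finite-dimensional
representation. -/
theorem exists_rep (s : Finset 𝒜.A) : ∃ (m : ℕ)
    (ρ : Γ →* Matrix (Fin m) (Fin m) ℂ) (hρ : 𝒜.IsAlgHom ρ), ∀ f ∈ s, ∃ l, f = coeff hρ l := by
  let V : Submodule ℂ (Γ → ℂ) := Submodule.span ℂ {u | ∃ f ∈ s, ∃ g, u = rt g f.1}
  choose k a b h using fun f : 𝒜.A => 𝒜.comul f.1 f.2
  have h' : ∀ (f : 𝒜.A) g, rt g f.1 = ∑ j, (b f j).1 g • (a f j).1 := by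
    intro f g
    funext x
    simp [h f, mul_comm]
  have hV : FiniteDimensional ℂ V := by
    have : V ≤ ⨆ f : s, Submodule.span ℂ (Set.range fun j => (a f.1 j).1) := by
      refine Submodule.span_le.2 ?_
      rintro u ⟨f, hf, g, rfl⟩
      rw [h' f g]
      refine sum_mem fun j _ => Submodule.smul_mem _ _ ?_
      exact (le_iSup (fun f : s => Submodule.span ℂ (Set.range fun j => (a f.1 j).1)) ⟨f, hf⟩)
        (Submodule.subset_span ⟨j, rfl⟩)
    have : ∀ f : s, FiniteDimensional ℂ (Submodule.span ℂ (Set.range fun j => (a f.1 j).1)) :=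
      fun f => FiniteDimensional.span_of_finite ℂ (Set.finite_range _)
    exact Submodule.finiteDimensional_of_le ‹V ≤ _›
  have hVA : ∀ u ∈ V, u ∈ 𝒜.A := by
    intro u hu
    induction hu using Submodule.span_induction with
    | mem u hu =>
      obtain ⟨f, hf, g, rfl⟩ := hu
      rw [h' f g]
      exact sum_mem fun j _ => 𝒜.A.smul_mem (a f j).2 _
    | zero => exact zero_mem _
    | add a b _ _ ha hb => exact add_mem ha hb
    | smul t a _ ha => exact 𝒜.A.smul_mem ha _
  have hstab : ∀ g, ∀ u ∈ V, rt g u ∈ V := by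
    intro g u hu
    induction hu using Submodule.span_induction with
    | mem u hu =>
      obtain ⟨f, hf, g', rfl⟩ := hu
      refine Submodule.subset_span ⟨f, hf, g * g', ?_⟩
      ext x; simp [mul_assoc]
    | zero => rw [map_zero]; exact zero_mem _
    | add a b _ _ ha hb => rw [map_add]; exact add_mem ha hb
    | smul t a _ ha => rw [map_smul]; exact Submodule.smul_mem _ _ ha
  let ρ : Γ →* Module.End ℂ V :=
    { toFun := fun g => (rt g).restrict (hstab g)
      map_one' := by ext u x; simp
      map_mul' := fun g h => by ext u x; simp [mul_assoc] }
  have hρ : 𝒜.IsAlgHom (E := Module.End ℂ V) ρ := by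
    apply isAlgHom_end_of
    intro φ v
    obtain ⟨φ', hφ'⟩ := LinearMap.exists_extend φ
    have : (fun g => φ (ρ g v)) = ∑ j, φ' (a ⟨v.1, hVA _ v.2⟩ j).1 • (b ⟨v.1, hVA _ v.2⟩ j).1 := by
      funext g
      have e : φ (ρ g v) = φ' (rt g v.1) := by rw [← hφ']; rfl
      rw [e, h' ⟨v.1, hVA _ v.2⟩ g]
      simp [mul_comm]
    rw [this]
    exact sum_mem fun j _ => 𝒜.A.smul_mem (b _ j).2 _
  let τ : Module.End ℂ V ≃ₐ[ℂ] _ := algEquivMatrix (Module.finBasis ℂ V)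
  refine ⟨_, (τ : Module.End ℂ V →* _).comp ρ, fun l => hρ (l ∘ₗ τ.toLinearMap), fun f hf => ?_⟩
  have hfV : f.1 ∈ V := Submodule.subset_span ⟨f, hf, 1, by ext x; simp⟩
  refine ⟨LinearMap.proj 1 ∘ₗ V.subtype ∘ₗ LinearMap.applyₗ ⟨f.1, hfV⟩ ∘ₗ
    τ.symm.toLinearMap, ?_⟩
  ext g
  have e : τ.symm (τ (ρ g)) = ρ g := τ.symm_apply_apply _
  change f.1 g = (τ.symm (τ (ρ g)) ⟨f.1, hfV⟩).1 1
  rw [e]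
  simp [ρ]

lemma pow_lvf_coeff {E : Type*} [Ring E] [Algebra ℂ E] [FiniteDimensional ℂ E]
    {ρ : Γ →* E} (hρ : 𝒜.IsAlgHom ρ) (δ : 𝒜.PD) (l : Module.Dual ℂ E) (k : ℕ) :
    (lvf δ.1 ^ k) (coeff hρ l) = coeff hρ (l ∘ₗ LinearMap.mulRight ℂ (diff hρ δ ^ k)) := by
  induction k with
  | zero =>
    simp only [pow_zero, Module.End.one_apply]
    congr 1
    ext x
    simp
  | succ k ih =>
    rw [pow_succ', Module.End.mul_apply, ih, lvf_coeff]
    congr 1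
    ext x
    simp [pow_succ, mul_assoc, (Commute.refl (diff hρ δ)).pow_left k |>.eq]

/-- The value at the exponential of `t • δ`. -/
def expval (δ : 𝒜.PD) (t : ℂ) (c : 𝒜.A) : ℂ :=
  ∑' k : ℕ, (k.factorial : ℂ)⁻¹ * t ^ k * ((lvf δ.1 ^ k) c).1 1

section
lemma exists_matrix_exp (δ : 𝒜.PD) (c : 𝒜.A) : ∃ (m : ℕ) (Y : EuclideanSpace ℂ (Fin m) →L[ℂ] EuclideanSpace ℂ (Fin m))
    (Φ : (EuclideanSpace ℂ (Fin m) →L[ℂ] EuclideanSpace ℂ (Fin m)) →L[ℂ] ℂ), ∀ k, ((lvf δ.1 ^ k) c).1 1 = Φ (Y ^ k) := by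
  obtain ⟨m, ρ, hρ, h⟩ := exists_rep 𝒜 {c}
  obtain ⟨l, hl⟩ := h c (by simp)
  let τ := (Matrix.toEuclideanCLM (n := Fin m) (𝕜 := ℂ))
  refine ⟨m, τ (diff hρ δ), LinearMap.toContinuousLinearMap
    (l ∘ₗ τ.toAlgEquiv.symm.toLinearMap), fun k => ?_⟩
  rw [hl, pow_lvf_coeff]
  simp

lemma summable_expval (δ : 𝒜.PD) (t : ℂ) (c : 𝒜.A) :
    Summable fun k : ℕ => ‖(k.factorial : ℂ)⁻¹ * t ^ k * ((lvf δ.1 ^ k) c).1 1‖ := by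
  obtain ⟨m, Y, Φ, h⟩ := exists_matrix_exp δ c
  have := (NormedSpace.norm_expSeries_summable' (𝕂 := ℂ) (t • Y)).mul_left ‖Φ‖
  refine Summable.of_nonneg_of_le (fun _ => norm_nonneg _) (fun k => ?_) this
  refine le_trans (le_of_eq ?_) (Φ.le_opNorm _)
  rw [map_smul, smul_pow, map_smul, h]
  simp [mul_assoc]

lemma expval_hasDerivAt (δ : 𝒜.PD) (c : 𝒜.A) :
    HasDerivAt (fun t => expval δ t c) (δ.1 c) 0 := by
  obtain ⟨m, Y, Φ, h⟩ := exists_matrix_exp δ c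
  have e : (fun t => expval δ t c) = fun t => Φ (NormedSpace.exp (t • Y)) := by
    funext t
    have := (NormedSpace.exp_series_hasSum_exp' (𝕂 := ℂ) (t • Y)).mapL Φ
    rw [← this.tsum_eq, expval]
    refine tsum_congr fun k => ?_
    rw [map_smul, smul_pow, map_smul, h]
    simp [mul_assoc]
  have h1 : δ.1 c = Φ Y := by
    have := h 1
    simpa using this
  rw [e, h1]
  have := Φ.hasFDerivAt.comp_hasDerivAt (0 : ℂ) (hasDerivAt_exp_smul_const Y (0 : ℂ))
  have h0 : NormedSpace.exp ((0 : ℂ) • Y) * Y = Y := by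
    have : (0 : ℂ) • Y = 0 := by ext; simp
    rw [this, NormedSpace.exp_zero, one_mul]
  rw [h0] at this
  exact this

end

/-- Exponentials exist. -/
theorem exists_exp (δ : 𝒜.PD) (t : ℂ) : ∃ g : Γ, ∀ c : 𝒜.A, c.1 g = expval δ t c := by
  let χ : 𝒜.A →ₐ[ℂ] ℂ := AlgHom.ofLinearMap
    { toFun := expval δ t
      map_add' := fun f g => by
        rw [expval, expval, expval, ← (summable_expval δ t f).of_norm.tsum_add
          (summable_expval δ t g).of_norm]
        refine tsum_congr fun k => ?_
        rw [map_add]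
        exact mul_add _ _ _
      map_smul' := fun r f => by
        rw [RingHom.id_apply, smul_eq_mul, expval, expval, ← tsum_mul_left]
        refine tsum_congr fun k => ?_
        rw [map_smul]
        exact mul_left_comm _ _ _ }
    (by
      change expval δ t 1 = 1
      rw [expval, tsum_eq_single 0]
      · simp
      · intro k hk
        obtain ⟨j, rfl⟩ := Nat.exists_eq_succ_of_ne_zero hk
        rw [pow_succ (lvf δ.1), Module.End.mul_apply, lvf_one, map_zero]
        simp)
    (fun f g => by
      change expval δ t (f * g) = expval δ t f * expval δ t g
      rw [expval, expval, expval, tsum_mul_tsum_eq_tsum_sum_antidiagonal_of_summable_norm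
        (summable_expval δ t f) (summable_expval δ t g)]
      refine tsum_congr fun n => ?_
      rw [pow_apply_mul_of_leibniz (D₁ := lvf δ.1) (D₂ := lvf δ.1)
        (fun f g => by rw [lvf_mul]; ring)]
      have hev : ∀ u : 𝒜.A, u.1 1 = ev 1 u := fun _ => rfl
      simp only [hev, map_sum, map_nsmul, map_mul]
      rw [Finset.mul_sum]
      refine Finset.sum_congr rfl fun m hm => ?_
      rw [Finset.HasAntidiagonal.mem_antidiagonal] at hm
      subst hm
      have h1 : ((m.1 + m.2).factorial : ℂ) ≠ 0 := by exact_mod_cast Nat.factorial_ne_zero _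
      have h2 : (m.1.factorial : ℂ) ≠ 0 := by exact_mod_cast Nat.factorial_ne_zero _
      have h3 : (m.2.factorial : ℂ) ≠ 0 := by exact_mod_cast Nat.factorial_ne_zero _
      have h4 : ((m.1 + m.2).choose m.1 : ℂ) * m.1.factorial * m.2.factorial
          = (m.1 + m.2).factorial := by
        have := Nat.choose_mul_factorial_mul_factorial (Nat.le_add_right m.1 m.2)
        rw [Nat.add_sub_cancel_left] at this
        exact_mod_cast this
      rw [← h4] at h1 ⊢
      have h5 : ((m.1 + m.2).choose m.1 : ℂ) ≠ 0 := left_ne_zero_of_mul (left_ne_zero_of_mul h1)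
      rw [nsmul_eq_mul]
      field_simp
      ring)
  obtain ⟨g, hg⟩ := 𝒜.pts χ
  exact ⟨g, fun c => (hg c).symm⟩

/-- A point derivation whose exponentials are trivial is zero. -/
theorem eq_zero_of_exp_trivial (δ : 𝒜.PD)
    (h : ∀ t g, (∀ c : 𝒜.A, c.1 g = expval δ t c) → g = 1) : δ = 0 := by
  ext c
  have hc : (fun t => expval δ t c) = fun _ => c.1 1 := by
    funext t
    obtain ⟨g, hg⟩ := exists_exp δ t
    rw [← hg c, h t g hg]
  have h1 := expval_hasDerivAt δ c
  rw [hc] at h1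
  exact h1.unique (hasDerivAt_const _ _)

lemma expval_coeff {E : Type*} [Ring E] [Algebra ℂ E] [FiniteDimensional ℂ E]
    {ρ : Γ →* E} (hρ : 𝒜.IsAlgHom ρ) (δ : 𝒜.PD) (t : ℂ) (l : Module.Dual ℂ E)
    (hl : ∀ k, l (diff hρ δ ^ (k + 1)) = 0) : expval δ t (coeff hρ l) = l 1 := by
  rw [expval, tsum_eq_single 0]
  · simp
  · intro k hk
    obtain ⟨j, rfl⟩ := Nat.exists_eq_succ_of_ne_zero hk
    rw [pow_lvf_coeff]
    simp [hl j]

end RegGroup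

section AbstractJordan

variable {A : Type*} [CommRing A] [Algebra ℂ A]

lemma iSup_maxGenEigenspace_of_locallyFinite {A : Type*} [AddCommGroup A] [Module ℂ A]
    {D : Module.End ℂ A}
    (h : ∀ f, ∃ W : Submodule ℂ A, FiniteDimensional ℂ W ∧ f ∈ W ∧ ∀ w ∈ W, D w ∈ W) :
    ⨆ μ, D.maxGenEigenspace μ = ⊤ := by
  rw [eq_top_iff]
  intro f _
  obtain ⟨W, hW, hf, hD⟩ := h f
  have key : (⟨f, hf⟩ : W) ∈ ⨆ μ, Module.End.maxGenEigenspace (D.restrict hD) μ := by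
    rw [Module.End.iSup_maxGenEigenspace_eq_top]; trivial
  have : (⨆ μ, Module.End.maxGenEigenspace (D.restrict hD) μ) ≤
      (⨆ μ, D.maxGenEigenspace μ).comap W.subtype := by
    refine iSup_le fun μ => ?_
    intro w hw
    refine (le_iSup (fun μ => D.maxGenEigenspace μ) μ) ?_
    have := Module.End.genEigenspace_restrict D W ⊤ μ hD
    rw [Module.End.maxGenEigenspace, this] at hw
    exact hw
  exact this key

/-- The semisimple part of a locally finite endomorphism. -/
lemma exists_semisimple_part {A : Type*} [AddCommGroup A] [Module ℂ A] (D : Module.End ℂ A)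
    (h : ⨆ μ, D.maxGenEigenspace μ = ⊤) :
    ∃ S : Module.End ℂ A, ∀ μ, ∀ f ∈ D.maxGenEigenspace μ, S f = μ • f := by
  classical
  have hinternal := DirectSum.isInternal_submodule_of_iSupIndep_of_iSup_eq_top
    D.independent_maxGenEigenspace h
  let e := LinearEquiv.ofBijective (DirectSum.coeLinearMap fun μ => D.maxGenEigenspace μ) hinternal
  refine ⟨DirectSum.toModule ℂ ℂ A (fun μ => μ • (D.maxGenEigenspace μ).subtype) ∘ₗ
    e.symm.toLinearMap, fun μ f hf => ?_⟩
  have : e.symm f = DirectSum.lof ℂ ℂ (fun μ => D.maxGenEigenspace μ) μ ⟨f, hf⟩ := by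
    rw [LinearEquiv.symm_apply_eq]
    exact (DirectSum.coeLinearMap_lof (fun μ => D.maxGenEigenspace μ) μ ⟨f, hf⟩).symm
  simp [this]

lemma semisimple_part_commute {A : Type*} [AddCommGroup A] [Module ℂ A] {D S : Module.End ℂ A}
    (h : ⨆ μ, D.maxGenEigenspace μ = ⊤)
    (hS : ∀ μ, ∀ f ∈ D.maxGenEigenspace μ, S f = μ • f)
    {T : Module.End ℂ A} (hT : ∀ f, T (D f) = D (T f)) (f : A) : T (S f) = S (T f) := by
  have hf : f ∈ ⨆ μ, D.maxGenEigenspace μ := h ▸ Submodule.mem_top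
  refine Submodule.iSup_induction _ (motive := fun f => T (S f) = S (T f)) hf ?_ (by simp) ?_
  · intro μ x hx
    have : T x ∈ D.maxGenEigenspace μ :=
      Module.End.mapsTo_maxGenEigenspace_of_comm (show Commute D T from by
        ext f; exact (hT f).symm) μ hx
    rw [hS μ x hx, hS μ _ this, map_smul]
  · intro x y hx hy
    rw [map_add, map_add, hx, hy, map_add, map_add]

lemma semisimple_part_derivation {D S : Module.End ℂ A}
    (hD : ∀ f g, D (f * g) = D f * g + f * D g)
    (h : ⨆ μ, D.maxGenEigenspace μ = ⊤)
    (hS : ∀ μ, ∀ f ∈ D.maxGenEigenspace μ, S f = μ • f) (f g : A) :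
    S (f * g) = S f * g + f * S g := by
  have hf : f ∈ ⨆ μ, D.maxGenEigenspace μ := h ▸ Submodule.mem_top
  have hg : g ∈ ⨆ μ, D.maxGenEigenspace μ := h ▸ Submodule.mem_top
  refine Submodule.iSup_induction _ (motive := fun f => S (f * g) = S f * g + f * S g) hf
    ?_ (by simp) ?_
  · intro μ x hx
    refine Submodule.iSup_induction _ (motive := fun g => S (x * g) = S x * g + x * S g) hg
      ?_ (by simp) ?_
    · intro ν y hy
      have hxy : x * y ∈ D.maxGenEigenspace (μ + ν) := by
        rw [Module.End.mem_maxGenEigenspace] at hx hy ⊢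
        obtain ⟨i, hi⟩ := hx
        obtain ⟨j, hj⟩ := hy
        refine ⟨i + j, ?_⟩
        rw [pow_apply_mul_of_leibniz (D₁ := D - μ • 1) (D₂ := D - ν • 1) (by
          intro a b
          simp only [LinearMap.sub_apply, LinearMap.smul_apply, LinearMap.add_apply,
            Module.End.one_apply, hD, sub_mul, mul_sub, add_smul, smul_mul_assoc, mul_smul_comm]
          abel)]
        refine Finset.sum_eq_zero fun m hm => ?_
        rw [Finset.HasAntidiagonal.mem_antidiagonal] at hm
        rcases le_or_gt i m.1 with h1 | h1
        · obtain ⟨k, hk⟩ := Nat.exists_eq_add_of_le' h1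
          rw [hk, pow_add, Module.End.mul_apply, hi]; simp
        · obtain ⟨k, hk⟩ := Nat.exists_eq_add_of_le' (show j ≤ m.2 by omega)
          rw [hk, pow_add, Module.End.mul_apply (_ ^ k), hj]; simp
      rw [hS _ _ hxy, hS _ _ hx, hS _ _ hy, add_smul, smul_mul_assoc, mul_smul_comm]
    · intro a b ha hb
      rw [mul_add, map_add, ha, hb, map_add]; ring
  · intro a b ha hb
    rw [add_mul, map_add, ha, hb, map_add]; ring

/-- Vectors killed by a split separable polynomial of `S` and a power of `D - S`. -/
lemma exists_annihilating {A : Type*} [AddCommGroup A] [Module ℂ A] {D S : Module.End ℂ A}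
    (h : ⨆ μ, D.maxGenEigenspace μ = ⊤)
    (hS : ∀ μ, ∀ f ∈ D.maxGenEigenspace μ, S f = μ • f) (f : A) :
    ∃ (F : Finset ℂ) (k : ℕ), Polynomial.aeval S (∏ μ ∈ F, (Polynomial.X - Polynomial.C μ)) f = 0 ∧
      ((D - S) ^ k) f = 0 := by
  classical
  have mono1 : ∀ (F F' : Finset ℂ) (x : A), F ⊆ F' →
      Polynomial.aeval S (∏ μ ∈ F, (Polynomial.X - Polynomial.C μ)) x = 0 →
      Polynomial.aeval S (∏ μ ∈ F', (Polynomial.X - Polynomial.C μ)) x = 0 := by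
    intro F F' x hF hx
    rw [← Finset.prod_sdiff hF, map_mul, Module.End.mul_apply, hx, map_zero]
  have mono2 : ∀ (k k' : ℕ) (x : A), k ≤ k' → ((D - S) ^ k) x = 0 → ((D - S) ^ k') x = 0 := by
    intro k k' x hk hx
    obtain ⟨j, rfl⟩ := Nat.exists_eq_add_of_le' hk
    rw [pow_add, Module.End.mul_apply, hx, map_zero]
  have hf : f ∈ ⨆ μ, D.maxGenEigenspace μ := h ▸ Submodule.mem_top
  refine Submodule.iSup_induction _ (motive := fun f => ∃ (F : Finset ℂ) (k : ℕ),
    Polynomial.aeval S (∏ μ ∈ F, (Polynomial.X - Polynomial.C μ)) f = 0 ∧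
      ((D - S) ^ k) f = 0) hf ?_ ⟨∅, 0, by simp⟩ ?_
  · intro μ x hx
    obtain ⟨k, hk⟩ := (Module.End.mem_maxGenEigenspace D μ x).1 hx
    refine ⟨{μ}, k, ?_, ?_⟩
    · simp [hS μ x hx, Algebra.algebraMap_eq_smul_one]
    · rw [← hk]
      have : ∀ j, ((D - S) ^ j) x = ((D - μ • (1 : Module.End ℂ A)) ^ j) x ∧
          ((D - μ • (1 : Module.End ℂ A)) ^ j) x ∈ D.maxGenEigenspace μ := by
        intro j
        induction j with
        | zero => simpa using hx
        | succ j ih =>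
          constructor
          · rw [pow_succ', Module.End.mul_apply, ih.1, pow_succ', Module.End.mul_apply]
            simp [hS μ _ ih.2]
          · rw [pow_succ', Module.End.mul_apply]
            exact Module.End.mapsTo_maxGenEigenspace_of_comm (show Commute D _ from
              (Commute.refl D).sub_right ((Commute.one_right D).smul_right μ)) μ ih.2
      exact (this k).1
  · rintro x y ⟨F, k, h1, h2⟩ ⟨F', k', h1', h2'⟩
    refine ⟨F ∪ F', max k k', ?_, ?_⟩
    · rw [map_add, mono1 F _ x Finset.subset_union_left h1,
        mono1 F' _ y Finset.subset_union_right h1', add_zero]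
    · rw [map_add, mono2 k _ x (le_max_left _ _) h2, mono2 k' _ y (le_max_right _ _) h2', add_zero]

end AbstractJordan

namespace RegGroup

variable {Γ : Type} [Group Γ] {𝒜 : RegGroup Γ}

section
variable {E : Type*} [Ring E] [Algebra ℂ E] [FiniteDimensional ℂ E]

lemma aeval_lvf_coeff {ρ : Γ →* E} (hρ : 𝒜.IsAlgHom ρ) (δ : 𝒜.PD) (l : Module.Dual ℂ E)
    (p : Polynomial ℂ) : (Polynomial.aeval (lvf δ.1) p) (coeff hρ l) =
      coeff hρ (l ∘ₗ LinearMap.mulRight ℂ (Polynomial.aeval (diff hρ δ) p)) := by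
  induction p using Polynomial.induction_on' with
  | add p q hp hq =>
    rw [map_add, LinearMap.add_apply, hp, hq, ← map_add]
    congr 1
    ext x
    simp [mul_add]
  | monomial n a =>
    rw [Polynomial.aeval_monomial, Polynomial.aeval_monomial, ← Algebra.smul_def, ← Algebra.smul_def,
      LinearMap.smul_apply, pow_lvf_coeff, ← map_smul]
    congr 1
    ext x
    simp

end

lemma dual_apply_eq_zero_of_basis {E ι : Type*} [AddCommGroup E] [Module ℂ E]
    (b : Module.Basis ι ℂ (Module.Dual ℂ E)) {y : E} (h : ∀ i, b i y = 0) (l : Module.Dual ℂ E) :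
    l y = 0 := by
  have : Module.Dual.eval ℂ E y = 0 := b.ext (by simpa using h)
  simpa using LinearMap.congr_fun this l

/-- The Jordan decomposition of a point derivation. -/
theorem exists_jordan (δ : 𝒜.PD) : ∃ δs δn : 𝒜.PD, δ = δs + δn ∧
    ∀ {E : Type} [Ring E] [Algebra ℂ E] [FiniteDimensional ℂ E] {ρ : Γ →* E}
      (hρ : 𝒜.IsAlgHom ρ),
      (∃ p : Polynomial ℂ, Squarefree p ∧ Polynomial.aeval (diff hρ δs) p = 0) ∧
      IsNilpotent (diff hρ δn) := by
  have hloc : ∀ f : 𝒜.A, ∃ W : Submodule ℂ 𝒜.A, FiniteDimensional ℂ W ∧ f ∈ W ∧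
      ∀ w ∈ W, lvf δ.1 w ∈ W := by
    intro f
    obtain ⟨m, ρ, hρ, h⟩ := exists_rep 𝒜 {f}
    obtain ⟨l, hl⟩ := h f (by simp)
    refine ⟨LinearMap.range (coeff hρ), inferInstance, ⟨l, hl.symm⟩, ?_⟩
    rintro _ ⟨l', rfl⟩
    exact ⟨_, (lvf_coeff hρ δ l').symm⟩
  have htop := iSup_maxGenEigenspace_of_locallyFinite (D := lvf δ.1) hloc
  obtain ⟨S, hS⟩ := exists_semisimple_part (lvf δ.1) htop
  have hder := semisimple_part_derivation (D := lvf δ.1)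
    (fun f g => by rw [lvf_mul]; ring) htop hS
  have hlt : ∀ g f, lt g (S f) = S (lt g f) := fun g f =>
    semisimple_part_commute htop hS (T := (lt g).toLinearMap) (fun f => lt_lvf _ f g) f
  have hSl := eq_lvf S hlt
  let δs : 𝒜.PD := ⟨(ev 1).toLinearMap ∘ₗ S, by
    intro f g
    simp only [LinearMap.comp_apply, AlgHom.toLinearMap_apply, hder, map_add, map_mul, ev_apply]
    ring⟩
  have hδs : lvf δs.1 = S := hSl.symm
  refine ⟨δs, δ - δs, by simp, ?_⟩
  intro E _ _ _ ρ hρ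
  have hδn : lvf (δ - δs).1 = lvf δ.1 - S := by
    rw [← hδs]; ext f x; simp
  choose F k h1 h2 using exists_annihilating htop hS
  let b := Module.finBasis ℂ (Module.Dual ℂ E)
  classical
  constructor
  · refine ⟨∏ μ ∈ Finset.univ.biUnion fun i => F (coeff hρ (b i)),
      (Polynomial.X - Polynomial.C μ), ?_, ?_⟩
    · exact (Polynomial.separable_prod_X_sub_C_iff'.2 (by intro x _ y _ h; exact h)).squarefree
    · apply ext_dual
      intro l
      rw [map_zero]
      refine dual_apply_eq_zero_of_basis b (fun i => ?_) l
      have e := aeval_lvf_coeff hρ δs (b i) (∏ μ ∈ Finset.univ.biUnion fun i => F (coeff hρ (b i)),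
        (Polynomial.X - Polynomial.C μ))
      rw [← Finset.prod_sdiff (Finset.subset_biUnion_of_mem (fun i => F (coeff hρ (b i)))
        (Finset.mem_univ i)), map_mul (Polynomial.aeval (lvf δs.1)), Module.End.mul_apply, hδs, h1,
        map_zero, Finset.prod_sdiff (Finset.subset_biUnion_of_mem (fun i => F (coeff hρ (b i)))
        (Finset.mem_univ i))] at e
      have := congrFun (congrArg Subtype.val e) 1
      simpa using this.symm
  · refine ⟨Finset.univ.sup fun i => k (coeff hρ (b i)), ?_⟩
    apply ext_dual
    intro l
    rw [map_zero]
    refine dual_apply_eq_zero_of_basis b (fun i => ?_) l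
    have e := pow_lvf_coeff hρ (δ - δs) (b i) (Finset.univ.sup fun i => k (coeff hρ (b i)))
    obtain ⟨j, hj⟩ := Nat.exists_eq_add_of_le' (Finset.le_sup (f := fun i => k (coeff hρ (b i)))
      (Finset.mem_univ i))
    conv_lhs at e => rw [hj]
    rw [pow_add, Module.End.mul_apply, hδn, h2, map_zero] at e
    have := congrFun (congrArg Subtype.val e) 1
    simpa using this.symm

end RegGroup

section LieFinal

variable {𝔤 : Type} [LieRing 𝔤] [LieAlgebra ℂ 𝔤] [FiniteDimensional ℂ 𝔤]
  {M : Type} [AddCommGroup M] [Module ℂ M] [FiniteDimensional ℂ M] [LieRingModule 𝔤 M]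
  [LieModule ℂ 𝔤 M]

/-- Precomposition and postcomposition with semisimple endomorphisms have semisimple difference. -/
lemma isSemisimple_hom_sub {V W : Type} [AddCommGroup V] [Module ℂ V] [FiniteDimensional ℂ V]
    [AddCommGroup W] [Module ℂ W] [FiniteDimensional ℂ W] {S : Module.End ℂ V}
    {T : Module.End ℂ W} (hS : S.IsSemisimple) (hT : T.IsSemisimple)
    (U : Module.End ℂ (V →ₗ[ℂ] W)) (hU : ∀ h, U h = T ∘ₗ h - h ∘ₗ S) : U.IsSemisimple := by
  let P : Module.End ℂ (V →ₗ[ℂ] W) := LinearMap.llcomp ℂ V W W T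
  let Q : Module.End ℂ (V →ₗ[ℂ] W) := LinearMap.lcomp ℂ W S
  have hP : ∀ p : Polynomial ℂ, ∀ h, Polynomial.aeval P p h = Polynomial.aeval T p ∘ₗ h := by
    intro p h
    induction p using Polynomial.induction_on' with
    | add p q hp hq => simp [hp, hq, LinearMap.add_comp]
    | monomial n a =>
      have : ∀ n : ℕ, (P ^ n) h = (T ^ n) ∘ₗ h := by
        intro n
        induction n with
        | zero => rfl
        | succ n ih => rw [pow_succ', Module.End.mul_apply, ih, pow_succ']; rfl
      rw [Polynomial.aeval_monomial, Polynomial.aeval_monomial, ← Algebra.smul_def,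
        ← Algebra.smul_def, LinearMap.smul_apply, this, LinearMap.smul_comp]
  have hQ : ∀ p : Polynomial ℂ, ∀ h, Polynomial.aeval Q p h = h ∘ₗ Polynomial.aeval S p := by
    intro p h
    induction p using Polynomial.induction_on' with
    | add p q hp hq => simp [hp, hq, LinearMap.comp_add]
    | monomial n a =>
      have : ∀ n : ℕ, (Q ^ n) h = h ∘ₗ (S ^ n) := by
        intro n
        induction n with
        | zero => rfl
        | succ n ih => rw [pow_succ', Module.End.mul_apply, ih, pow_succ]; rfl
      rw [Polynomial.aeval_monomial, Polynomial.aeval_monomial, ← Algebra.smul_def,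
        ← Algebra.smul_def, LinearMap.smul_apply, this, LinearMap.comp_smul]
  have hPs : P.IsSemisimple := Module.End.isSemisimple_of_squarefree_aeval_eq_zero
    hT.minpoly_squarefree (by ext h : 1; rw [hP, minpoly.aeval]; simp)
  have hQs : Q.IsSemisimple := Module.End.isSemisimple_of_squarefree_aeval_eq_zero
    hS.minpoly_squarefree (by ext h : 1; rw [hQ, minpoly.aeval]; simp)
  have hcomm : Commute P Q := by
    ext h x; rfl
  have : U = P - Q := by
    ext h : 1; rw [hU]; rfl
  rw [this]
  exact hPs.sub_of_commute hcomm hQs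

lemma exists_comp_eq_of_ker_le {V W Z : Type*} [AddCommGroup V] [Module ℂ V] [AddCommGroup W]
    [Module ℂ W] [AddCommGroup Z] [Module ℂ Z] {π : V →ₗ[ℂ] W} {q : V →ₗ[ℂ] Z}
    (h : LinearMap.ker π ≤ LinearMap.ker q) : ∃ ψ : W →ₗ[ℂ] Z, ψ ∘ₗ π = q := by
  obtain ⟨σ, hσ⟩ := π.rangeRestrict.exists_rightInverse_of_surjective π.range_rangeRestrict
  obtain ⟨τ, hτ⟩ := LinearMap.exists_extend (q ∘ₗ σ)
  refine ⟨τ, ?_⟩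
  ext x
  have e1 : τ (π x) = q (σ (π.rangeRestrict x)) := LinearMap.congr_fun hτ (π.rangeRestrict x)
  have e2 : π (σ (π.rangeRestrict x)) = π x :=
    congrArg Subtype.val (LinearMap.congr_fun hσ (π.rangeRestrict x))
  rw [LinearMap.comp_apply, e1, ← sub_eq_zero, ← map_sub]
  exact h (by rw [LinearMap.mem_ker, map_sub, e2, sub_self])

/-- The explicit form of injectivity, from the Lie-theoretic properties of the pair. -/
theorem exists_relative_primitive (𝔥 : LieSubalgebra ℂ 𝔤)
    (hcen : ∀ z ∈ LieAlgebra.radical ℂ 𝔥, ∀ x : 𝔥, ⁅x, z⁆ = 0)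
    (hss : ∀ z ∈ LieAlgebra.radical ℂ 𝔥, (LieModule.toEnd ℂ 𝔤 𝔤 (z : 𝔤)).IsSemisimple)
    (hsM : ∀ z ∈ LieAlgebra.radical ℂ 𝔥, (LieModule.toEnd ℂ 𝔤 M (z : 𝔤)).IsSemisimple)
    (hab : ∀ x ∈ 𝔥, x ∈ Submodule.span ℂ {w : 𝔤 | ∃ a b : 𝔤, w = ⁅a, b⁆} →
      x ∈ Submodule.span ℂ {w : 𝔤 | ∃ a ∈ 𝔥, ∃ b ∈ 𝔥, w = ⁅a, b⁆})
    (ω : 𝔤 → 𝔤 → M) (hω : ∀ x ∈ 𝔥, ∀ y, ω x y = 0) (h : 𝔤 →ₗ[ℂ] M)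
    (hh : ∀ x y, ω x y = ⁅x, h y⁆ - ⁅y, h x⁆ - h ⁅x, y⁆) :
    ∃ f : 𝔤 →ₗ[ℂ] M, (∀ x ∈ 𝔥, f x = 0) ∧ (∀ x ∈ 𝔥, ∀ y, f ⁅x, y⁆ = ⁅x, f y⁆) ∧
      ∀ x y, ω x y = ⁅x, f y⁆ - ⁅y, f x⁆ - f ⁅x, y⁆ := by
  -- coboundaries of vectors
  let d : M →ₗ[ℂ] (𝔤 →ₗ[ℂ] M) := (LieModule.toEnd ℂ 𝔤 M : 𝔤 →ₗ[ℂ] Module.End ℂ M).flip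
  have hd : ∀ m x, d m x = ⁅x, m⁆ := fun m x => rfl
  by_cases hB : h ∈ LinearMap.range d
  · obtain ⟨m, rfl⟩ := hB
    refine ⟨0, by simp, by simp, fun x y => ?_⟩
    rw [hh, hd, hd, hd, lie_lie]; simp
  -- an invariant primitive
  obtain ⟨h', hh', hinv⟩ : ∃ h' : 𝔤 →ₗ[ℂ] M, (∃ m, h' = h + d m) ∧
      ∀ x ∈ 𝔥, ∀ y, h' ⁅x, y⁆ = ⁅x, h' y⁆ := by
    have hlie : ∀ (x : 𝔥), ⁅x, h⁆ = d (h x) := by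
      intro x
      ext y
      have e1 := hω x x.2 y
      rw [hh] at e1
      rw [LieHom.lie_apply, hd]
      rw [sub_sub, sub_eq_zero] at e1
      rw [LieSubalgebra.coe_bracket_of_module, LieSubalgebra.coe_bracket_of_module, e1]
      abel
    have hlied : ∀ (x : 𝔥) m, ⁅x, d m⁆ = d ⁅x, m⁆ := by
      intro x m
      ext y
      rw [LieHom.lie_apply, hd, hd, hd]
      simp only [LieSubalgebra.coe_bracket_of_module]
      rw [lie_lie]; abel
    let N : LieSubmodule ℂ 𝔥 (𝔤 →ₗ[ℂ] M) :=
      { (ℂ ∙ h) ⊔ LinearMap.range d with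
        lie_mem := by
          intro x n hn
          obtain ⟨a, ha, b, ⟨m, rfl⟩, rfl⟩ := Submodule.mem_sup.1 hn
          obtain ⟨t, rfl⟩ := Submodule.mem_span_singleton.1 ha
          refine Submodule.mem_sup_right ?_
          rw [lie_add, lie_smul, hlie, hlied, ← map_smul, ← map_add]
          exact ⟨_, rfl⟩ }
    obtain ⟨l, hl1, hl2⟩ := Submodule.exists_le_ker_of_notMem hB
    have hlh : l h ≠ 0 := hl1
    have hld : ∀ m, l (d m) = 0 := fun m => hl2 ⟨m, rfl⟩
    have hhN : h ∈ N := Submodule.mem_sup_left (Submodule.mem_span_singleton_self h)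
    let l' : N →ₗ[ℂ] ℂ := (l h)⁻¹ • (l ∘ₗ N.toSubmodule.subtype)
    have hl'h : l' ⟨h, hhN⟩ = 1 := by
      exact inv_mul_cancel₀ hlh
    obtain ⟨n, hn1, hn2⟩ := exists_invariant_of_central_radical hcen _ (X := N) rfl (by
      intro z hz
      have key : (LieModule.toEnd ℂ 𝔥 (𝔤 →ₗ[ℂ] M) z).IsSemisimple :=
        isSemisimple_hom_sub (hss z hz) (hsM z hz) _ (by
          intro h
          ext y
          simp [LieHom.lie_apply])
      exact key.restrict (p := N.toSubmodule) (fun n hn => N.lie_mem hn)) l' (by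
      rintro x ⟨n, hn⟩
      obtain ⟨a, ha, b, ⟨m, rfl⟩, rfl⟩ := Submodule.mem_sup.1 hn
      obtain ⟨t, rfl⟩ := Submodule.mem_span_singleton.1 ha
      change (l h)⁻¹ • l ⁅x, t • h + d m⁆ = 0
      rw [lie_add, lie_smul, hlie, hlied, map_add, map_smul, hld, hld, smul_zero, add_zero,
        smul_zero]) (by
      intro h0; rw [h0] at hl'h; simp at hl'h)
    obtain ⟨n, hn⟩ := n
    refine ⟨n, ?_, ?_⟩
    · obtain ⟨a, ha, b, ⟨m, rfl⟩, rfl⟩ := Submodule.mem_sup.1 hn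
      obtain ⟨t, rfl⟩ := Submodule.mem_span_singleton.1 ha
      refine ⟨m, ?_⟩
      have : (l h)⁻¹ • l (t • h + d m) = 1 := hn2
      rw [map_add, hld, map_smul, add_zero, smul_eq_mul, smul_eq_mul, mul_comm t,
        inv_mul_cancel_left₀ hlh] at this
      rw [this, one_smul]
    · intro x hx y
      have := congrArg Subtype.val (hn1 ⟨x, hx⟩)
      have := LinearMap.congr_fun this y
      change ⁅(⟨x, hx⟩ : 𝔥), n⁆ y = 0 at this
      rw [LieHom.lie_apply] at this
      exact (sub_eq_zero.1 this).symm
  have hω' : ∀ x y, ω x y = ⁅x, h' y⁆ - ⁅y, h' x⁆ - h' ⁅x, y⁆ := by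
    obtain ⟨m, rfl⟩ := hh'
    intro x y
    rw [hh]
    simp only [LinearMap.add_apply, hd, lie_add, lie_lie]
    abel
  have hfix : ∀ x ∈ 𝔥, ∀ y : 𝔤, ⁅y, h' x⁆ = 0 := by
    intro x hx y
    have := hω x hx y
    rw [hω', hinv x hx] at this
    simpa using this
  have hder0 : ∀ x ∈ Submodule.span ℂ {w : 𝔤 | ∃ a ∈ 𝔥, ∃ b ∈ 𝔥, w = ⁅a, b⁆}, h' x = 0 := by
    intro x hx
    have : Submodule.span ℂ {w : 𝔤 | ∃ a ∈ 𝔥, ∃ b ∈ 𝔥, w = ⁅a, b⁆} ≤ LinearMap.ker h' := by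
      rw [Submodule.span_le]
      rintro _ ⟨a, ha, b, hb, rfl⟩
      change h' _ = 0
      rw [hinv a ha, hfix b hb]
    exact this hx
  let D := Submodule.span ℂ {w : 𝔤 | ∃ a b : 𝔤, w = ⁅a, b⁆}
  let F : Submodule ℂ M := LieModule.maxTrivSubmodule ℂ 𝔤 M
  have hF : ∀ x ∈ 𝔥, h' x ∈ F := fun x hx =>
    (LieModule.mem_maxTrivSubmodule (R := ℂ) (L := 𝔤) (M := M) _).2 (hfix x hx)
  obtain ⟨φ, hφ1, hφ2⟩ : ∃ φ : 𝔤 →ₗ[ℂ] F, (∀ x, ∀ hx : x ∈ 𝔥, (φ x : M) = h' x) ∧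
      ∀ x ∈ D, φ x = 0 := by
    let q : 𝔥.toSubmodule →ₗ[ℂ] F := (h'.domRestrict 𝔥.toSubmodule).codRestrict F
      (fun x => hF x x.2)
    let π : 𝔥.toSubmodule →ₗ[ℂ] 𝔤 ⧸ D := D.mkQ ∘ₗ 𝔥.toSubmodule.subtype
    have hker : LinearMap.ker π ≤ LinearMap.ker q := by
      intro x hx
      have : (x : 𝔤) ∈ D := by simpa [π] using hx
      have := hder0 x (hab x x.2 this)
      rw [LinearMap.mem_ker]
      exact Subtype.ext this
    obtain ⟨ψ, hψ⟩ : ∃ ψ : (𝔤 ⧸ D) →ₗ[ℂ] F, ψ ∘ₗ π = q := by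
      exact exists_comp_eq_of_ker_le hker
    refine ⟨ψ ∘ₗ D.mkQ, ?_, ?_⟩
    · intro x hx
      have := congrArg Subtype.val (LinearMap.congr_fun hψ ⟨x, hx⟩)
      exact this
    · intro x hx
      have : D.mkQ x = 0 := by simpa using hx
      simp only [LinearMap.comp_apply, this, map_zero]
  have hφ3 : ∀ x y : 𝔤, ⁅y, (φ x : M)⁆ = 0 := fun x y =>
    (LieModule.mem_maxTrivSubmodule (R := ℂ) (L := 𝔤) (M := M) _).1 (φ x).2 y
  have hφ4 : ∀ x y : 𝔤, φ ⁅x, y⁆ = 0 := fun x y => hφ2 _ (Submodule.subset_span ⟨x, y, rfl⟩)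
  refine ⟨h' - F.subtype ∘ₗ φ, ?_, ?_, ?_⟩
  · intro x hx
    simp [hφ1 x hx]
  · intro x hx y
    simp [hφ3, hφ4, hinv x hx]
  · intro x y
    rw [hω']
    simp [hφ3, hφ4]

end LieFinal

section RelCochains

variable {𝔤 : Type} [LieRing 𝔤] [LieAlgebra ℂ 𝔤]
  {M : Type} [AddCommGroup M] [Module ℂ M] [LieRingModule 𝔤 M]

omit [LieAlgebra ℂ 𝔤] [Module ℂ M] in
lemma ceD_one_apply (F : (Fin 1 → 𝔤) → M) (v : Fin 2 → 𝔤) :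
    ceD 1 F v = ⁅v 0, F (fun _ => v 1)⁆ - ⁅v 1, F (fun _ => v 0)⁆ - F (fun _ => ⁅v 0, v 1⁆) := by
  have e0 : (fun k : Fin 1 => v ((0 : Fin 2).succAbove k)) = fun _ => v 1 := by
    funext k; fin_cases k; rfl
  have e1 : (fun k : Fin 1 => v ((1 : Fin 2).succAbove k)) = fun _ => v 0 := by
    funext k; fin_cases k; rfl
  have e2 : ∀ (w : Fin 1 → 𝔤) (i : Fin 1) (x : 𝔤), Function.update w i x = fun _ => x := by
    intro w i x; funext k; rw [Subsingleton.elim k i, Function.update_self]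
  simp only [ceD, e2]
  simp only [Nat.reduceAdd, Fin.sum_univ_two]
  rw [e0, e1]
  simp [sub_eq_add_neg]

/-- Injectivity on classes from its explicit form. -/
lemma mem_relB_of_explicit (𝔥 : LieSubalgebra ℂ 𝔤)
    (H : ∀ ω : 𝔤 → 𝔤 → M, (∀ x ∈ 𝔥, ∀ y, ω x y = 0) → ∀ h : 𝔤 →ₗ[ℂ] M,
      (∀ x y, ω x y = ⁅x, h y⁆ - ⁅y, h x⁆ - h ⁅x, y⁆) →
      ∃ f : 𝔤 →ₗ[ℂ] M, (∀ x ∈ 𝔥, f x = 0) ∧ (∀ x ∈ 𝔥, ∀ y, f ⁅x, y⁆ = ⁅x, f y⁆) ∧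
        ∀ x y, ω x y = ⁅x, f y⁆ - ⁅y, f x⁆ - f ⁅x, y⁆)
    (c : (Fin 2 → 𝔤) → M) (hc : c ∈ relZ 𝔥 M 2)
    (hb : c ∈ relB (⊥ : LieSubalgebra ℂ 𝔤) M 1) : c ∈ relB 𝔥 M 1 := by
  obtain ⟨F, ⟨⟨hF1, hF2, -⟩, -, -⟩, rfl⟩ := hb
  have e2 : ∀ (w : Fin 1 → 𝔤) (i : Fin 1) (x : 𝔤), Function.update w i x = fun _ => x := by
    intro w i x; funext k; rw [Subsingleton.elim k i, Function.update_self]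
  let h : 𝔤 →ₗ[ℂ] M :=
    { toFun := fun x => F fun _ => x
      map_add' := fun x y => by simpa [e2] using hF1 (fun _ => x) 0 x y
      map_smul' := fun t x => by simpa [e2] using hF2 (fun _ => x) 0 t x }
  obtain ⟨f, hf1, hf2, hf3⟩ := H (fun x y => ceD 1 F ![x, y])
    (fun x hx y => hc.1.2.1 _ ⟨0, hx⟩) h (fun x y => by rw [ceD_one_apply]; rfl)
  refine ⟨fun v => f (v 0), ⟨⟨?_, ?_, ?_⟩, ?_, ?_⟩, ?_⟩
  · intro v i x y; simp [e2]
  · intro v i t x; simp [e2]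
  · intro v i j hij; exact absurd (Subsingleton.elim i j) hij
  · rintro v ⟨i, hi⟩
    rw [Subsingleton.elim i 0] at hi
    exact hf1 _ hi
  · intro x hx v
    simp [e2, hf2 x hx]
  · funext v
    rw [ceD_one_apply (fun v => f (v 0)), ← hf3 (v 0) (v 1)]
    congr 1
    funext i; fin_cases i <;> rfl

end RelCochains

namespace RegGroup

variable {Γ : Type} [Group Γ] {𝒜 : RegGroup Γ}

lemma lvf_pdBracket (δ ε : 𝒜.PD) : lvf (pdBracket δ ε).1 =
    lvf δ.1 ∘ₗ lvf ε.1 - lvf ε.1 ∘ₗ lvf δ.1 := by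
  rw [eq_lvf (lvf δ.1 ∘ₗ lvf ε.1 - lvf ε.1 ∘ₗ lvf δ.1) (by
    intro g f
    simp only [LinearMap.sub_apply, LinearMap.comp_apply, map_sub, lt_lvf])]
  congr 1
  ext f
  simp [pdBracket_apply]

instance : LieRing 𝒜.PD where
  bracket := pdBracket
  add_lie a b c := by
    apply Subtype.ext; ext f
    simp only [pdBracket_apply, Submodule.coe_add, LinearMap.add_apply]
    have : lvf (a.1 + b.1) f = lvf a.1 f + lvf b.1 f := by ext; simp
    rw [this, map_add]; ring
  lie_add a b c := by
    apply Subtype.ext; ext f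
    simp only [pdBracket_apply, Submodule.coe_add, LinearMap.add_apply]
    have : lvf (b.1 + c.1) f = lvf b.1 f + lvf c.1 f := by ext; simp
    rw [this, map_add]; ring
  lie_self a := by
    apply Subtype.ext; ext f
    simp [pdBracket_apply]
  leibniz_lie a b c := by
    apply Subtype.ext; ext f
    simp only [pdBracket_apply, Submodule.coe_add, LinearMap.add_apply,
      lvf_pdBracket, LinearMap.sub_apply, LinearMap.comp_apply, map_sub]
    ring

lemma lie_def (δ ε : 𝒜.PD) : ⁅δ, ε⁆ = pdBracket δ ε := rfl

instance : LieAlgebra ℂ 𝒜.PD where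
  lie_smul t a b := by
    apply Subtype.ext; ext f
    simp only [lie_def, pdBracket_apply, Submodule.coe_smul, LinearMap.smul_apply]
    have : lvf (t • b.1) f = t • lvf b.1 f := by ext; simp
    rw [this, map_smul, smul_sub]

section Hom

variable {Γ' : Type} [Group Γ'] {𝒜' : RegGroup Γ'}

variable (𝒜' 𝒜) in
/-- A homomorphism pulling regular functions back to regular functions. -/
def IsRegHom (ι : Γ' →* Γ) : Prop := ∀ f ∈ 𝒜.A, (fun g => f (ι g)) ∈ 𝒜'.A

variable {ι : Γ' →* Γ} (hι : IsRegHom 𝒜 𝒜' ι)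

/-- The pullback of regular functions. -/
def pull : 𝒜.A →ₐ[ℂ] 𝒜'.A where
  toFun f := ⟨fun g => f.1 (ι g), hι f.1 f.2⟩
  map_one' := rfl
  map_mul' _ _ := rfl
  map_zero' := rfl
  map_add' _ _ := rfl
  commutes' _ := rfl

@[simp] lemma pull_apply (f : 𝒜.A) (g : Γ') : (pull hι f).1 g = f.1 (ι g) := rfl

/-- The pushforward of point derivations. -/
def push : 𝒜'.PD →ₗ[ℂ] 𝒜.PD where
  toFun δ := ⟨δ.1 ∘ₗ (pull hι).toLinearMap, by
    intro f g
    simp [PD_mul]⟩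
  map_add' _ _ := rfl
  map_smul' _ _ := rfl

@[simp] lemma push_apply (δ : 𝒜'.PD) (f : 𝒜.A) : (push hι δ).1 f = δ.1 (pull hι f) := rfl

lemma lvf_pull (δ : 𝒜'.PD) (f : 𝒜.A) : lvf δ.1 (pull hι f) = pull hι (lvf (push hι δ).1 f) := by
  ext g
  simp only [lvf_apply, pull_apply, push_apply]
  congr 1
  ext x
  simp

lemma push_lie (δ ε : 𝒜'.PD) : push hι ⁅δ, ε⁆ = ⁅push hι δ, push hι ε⁆ := by
  apply Subtype.ext; ext f
  simp only [lie_def, push_apply, pdBracket_apply, lvf_pull]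

variable {E : Type*} [Ring E] [Algebra ℂ E]

lemma IsAlgHom.comp {ρ : Γ →* E} (hρ : 𝒜.IsAlgHom ρ) (hι : IsRegHom 𝒜 𝒜' ι) :
    𝒜'.IsAlgHom (ρ.comp ι) := fun l => hι _ (hρ l)

lemma diff_comp [FiniteDimensional ℂ E] {ρ : Γ →* E} (hρ : 𝒜.IsAlgHom ρ)
    (hι : IsRegHom 𝒜 𝒜' ι) (δ : 𝒜'.PD) : diff (hρ.comp hι) δ = diff hρ (push hι δ) := by
  apply ext_dual
  intro l
  rw [diff_spec, diff_spec]
  rfl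

end Hom

section Rep

variable {E : Type*} [Ring E] [Algebra ℂ E] [FiniteDimensional ℂ E]

lemma diff_lie {ρ : Γ →* E} (hρ : 𝒜.IsAlgHom ρ) (δ ε : 𝒜.PD) :
    diff hρ ⁅δ, ε⁆ = diff hρ δ * diff hρ ε - diff hρ ε * diff hρ δ := diff_pdBracket hρ δ ε

lemma diff_eq_zero_imp {ρ : Γ →* E} (hρ : 𝒜.IsAlgHom ρ)
    (hgen : Algebra.adjoin ℂ (Set.range (coeff hρ)) = ⊤) {δ : 𝒜.PD} (h : diff hρ δ = 0) :
    δ = 0 := by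
  apply Subtype.ext
  ext f
  have hf : f ∈ Algebra.adjoin ℂ (Set.range (coeff hρ)) := hgen ▸ Algebra.mem_top
  change δ.1 f = 0
  induction hf using Algebra.adjoin_induction with
  | mem x hx =>
    obtain ⟨l, rfl⟩ := hx
    rw [← diff_spec, h, map_zero]
  | algebraMap r => rw [Algebra.algebraMap_eq_smul_one, map_smul, PD_one, smul_zero]
  | add x y _ _ hx hy => rw [map_add, hx, hy, add_zero]
  | mul x y _ _ hx hy => rw [PD_mul, hx, hy]; simp

end Rep

variable (𝒜) in
/-- A representation in an algebra spanned by the group, whose coefficients generate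
the regular functions. -/
lemma exists_generating_rep : ∃ (B : Type) (_ : Ring B) (_ : Algebra ℂ B)
    (_ : FiniteDimensional ℂ B) (R : Γ →* B) (hR : 𝒜.IsAlgHom R),
    Submodule.span ℂ (Set.range R) = ⊤ ∧ Algebra.adjoin ℂ (Set.range (coeff hR)) = ⊤ := by
  obtain ⟨s, hs⟩ := (Subalgebra.fg_top 𝒜.A).2 𝒜.fg
  obtain ⟨m, ρ, hρ, hgen⟩ := exists_rep 𝒜 s
  let S : Subalgebra ℂ (Matrix (Fin m) (Fin m) ℂ) := Algebra.adjoin ℂ (Set.range ρ)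
  let R : Γ →* S := ρ.codRestrict S (fun g => Algebra.subset_adjoin ⟨g, rfl⟩)
  have hR : 𝒜.IsAlgHom R := by
    intro l
    obtain ⟨l', hl'⟩ := LinearMap.exists_extend (p := S.toSubmodule) l
    have := hρ l'
    convert this using 2 with g
    exact (LinearMap.congr_fun hl' (R g)).symm
  refine ⟨S, inferInstance, inferInstance, inferInstance, R, hR, ?_, ?_⟩
  · rw [eq_top_iff]
    rintro ⟨x, hx⟩ -
    have hx' : x ∈ Submodule.span ℂ (Set.range ρ) := by
      have : Submodule.span ℂ (Set.range ρ) = S.toSubmodule := by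
        rw [Algebra.adjoin_eq_span]
        congr 1
        rw [← MonoidHom.coe_mrange, Submonoid.closure_eq]
      rw [this]; exact hx
    have key : Submodule.span ℂ (Set.range ρ) ≤
        (Submodule.span ℂ (Set.range R)).map S.val.toLinearMap := by
      rw [Submodule.span_le]
      rintro _ ⟨g, rfl⟩
      exact ⟨R g, Submodule.subset_span ⟨g, rfl⟩, rfl⟩
    obtain ⟨y, hy, hyx⟩ := key hx'
    have : y = ⟨x, hx⟩ := Subtype.ext hyx
    rwa [← this]
  · rw [eq_top_iff, ← hs]
    apply Algebra.adjoin_mono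
    intro f hf
    obtain ⟨l, rfl⟩ := hgen f hf
    exact ⟨l ∘ₗ S.val.toLinearMap, by ext g; rfl⟩

/-- The conjugation representation on an algebra. -/
def conjRep {E : Type*} [Ring E] [Algebra ℂ E] (ρ : Γ →* E) : Γ →* Module.End ℂ E where
  toFun g := LinearMap.mulLeft ℂ (ρ g) ∘ₗ LinearMap.mulRight ℂ (ρ g⁻¹)
  map_one' := by ext x; simp
  map_mul' g h := by ext x; simp [mul_assoc]

lemma conjRep_apply {E : Type*} [Ring E] [Algebra ℂ E] (ρ : Γ →* E) (g : Γ) (x : E) :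
    conjRep ρ g x = ρ g * (x * ρ g⁻¹) := rfl

/-- Pullback along the inversion. -/
def invA (f : 𝒜.A) : 𝒜.A := ⟨fun g => f.1 g⁻¹, 𝒜.inv f.1 f.2⟩

@[simp] lemma invA_apply (f : 𝒜.A) (g : Γ) : (invA f).1 g = f.1 g⁻¹ := rfl

lemma PD_invA (δ : 𝒜.PD) (f : 𝒜.A) : δ.1 (invA f) = -δ.1 f := by
  obtain ⟨k, a, b, h⟩ := 𝒜.comul f.1 f.2
  have e1 : invA f = ∑ j, (a j).1 1 • invA (b j) := by
    ext x
    simpa using h 1 x⁻¹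
  have e2 : f = ∑ j, (b j).1 1 • a j := by
    ext x
    simpa [mul_comm] using h x 1
  have e3 : δ.1 (∑ j, a j * invA (b j)) = 0 := by
    apply PD_eq_zero_of_const
    intro g
    have h1 := h g g⁻¹
    have h2 := h 1 1
    rw [mul_inv_cancel] at h1
    rw [mul_one] at h2
    simp only [AddSubmonoidClass.coe_finsetSum, Finset.sum_apply, Subalgebra.coe_mul, Pi.mul_apply,
      invA_apply, inv_one]
    rw [← h1, ← h2]
  rw [map_sum] at e3
  simp only [PD_mul, invA_apply, inv_one, Finset.sum_add_distrib] at e3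
  rw [eq_neg_iff_add_eq_zero, ← e3]
  conv_lhs => rw [e1, e2]
  simp

section Conj
variable {E : Type} [Ring E] [Algebra ℂ E] [FiniteDimensional ℂ E] {ρ : Γ →* E}
  (hρ : 𝒜.IsAlgHom ρ)

lemma conjRep_coeff (φ : Module.Dual ℂ E) (x : E) : (fun g => φ (conjRep ρ g x)) =
    (∑ i, ∑ j, φ (Module.finBasis ℂ E i * (x * Module.finBasis ℂ E j)) •
      (coeff hρ ((Module.finBasis ℂ E).coord i) *
        invA (coeff hρ ((Module.finBasis ℂ E).coord j))) : 𝒜.A).1 := by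
  funext g
  have e : ∀ y : E, y = ∑ i, (Module.finBasis ℂ E).coord i y • Module.finBasis ℂ E i :=
    fun y => ((Module.finBasis ℂ E).sum_repr y).symm
  rw [conjRep_apply]
  conv_lhs => rw [e (ρ g), e (ρ g⁻¹)]
  simp only [Finset.mul_sum, Finset.sum_mul, map_sum, smul_mul_assoc, mul_smul_comm, map_smul]
  simp only [AddSubmonoidClass.coe_finsetSum, Finset.sum_apply, Subalgebra.coe_smul, Pi.smul_apply,
    Subalgebra.coe_mul, Pi.mul_apply, invA_apply, coeff_apply, smul_eq_mul]
  rw [Finset.sum_comm]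
  refine Finset.sum_congr rfl fun i _ => ?_
  rw [Finset.mul_sum]
  refine Finset.sum_congr rfl fun j _ => ?_
  ring

include hρ in
lemma isAlgHom_conjRep : 𝒜.IsAlgHom (E := Module.End ℂ E) (conjRep ρ) := by
  apply isAlgHom_end_of
  intro φ x
  rw [conjRep_coeff hρ]
  exact SetLike.coe_mem _

lemma diff_conjRep (h : 𝒜.IsAlgHom (E := Module.End ℂ E) (conjRep ρ)) (δ : 𝒜.PD) (x : E) :
    diff h δ x = diff hρ δ * x - x * diff hρ δ := by
  apply ext_dual
  intro φ
  have h1 := diff_spec h δ (φ ∘ₗ (LinearMap.applyₗ x : Module.End ℂ E →ₗ[ℂ] E))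
  have h2 : coeff h (φ ∘ₗ (LinearMap.applyₗ x : Module.End ℂ E →ₗ[ℂ] E)) =
    ∑ i, ∑ j, φ (Module.finBasis ℂ E i * (x * Module.finBasis ℂ E j)) •
      (coeff hρ ((Module.finBasis ℂ E).coord i) *
        invA (coeff hρ ((Module.finBasis ℂ E).coord j))) :=
    Subtype.ext (conjRep_coeff hρ φ x)
  rw [h2] at h1
  change φ (diff h δ x) = _ at h1
  rw [h1]
  have e : ∀ y : E, ∑ i, (Module.finBasis ℂ E).coord i y • Module.finBasis ℂ E i = y :=
    fun y => (Module.finBasis ℂ E).sum_repr y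
  simp only [map_sum, map_smul, PD_mul, PD_invA, ← diff_spec, coeff_apply, map_one, invA_apply,
    inv_one, smul_eq_mul, mul_add, Finset.sum_add_distrib]
  rw [map_sub, add_comm, sub_eq_add_neg]
  congr 1
  · conv_rhs => rw [← e (diff hρ δ), ← mul_one x, ← e (1 : E)]
    simp only [Finset.mul_sum, Finset.sum_mul, map_sum, smul_mul_assoc, mul_smul_comm, map_smul]
    rw [Finset.sum_comm]
    refine Finset.sum_congr rfl fun i _ => ?_
    simp only [smul_eq_mul, Finset.mul_sum]
    refine Finset.sum_congr rfl fun j _ => ?_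
    ring
  · conv_rhs => rw [← e (diff hρ δ), ← one_mul (x * _), ← e (1 : E)]
    simp only [Finset.mul_sum, Finset.sum_mul, map_sum, smul_mul_assoc, mul_smul_comm, map_smul,
      ← Finset.sum_neg_distrib]
    rw [Finset.sum_comm]
    refine Finset.sum_congr rfl fun i _ => ?_
    simp only [smul_eq_mul, Finset.mul_sum, ← Finset.sum_neg_distrib]
    refine Finset.sum_congr rfl fun j _ => ?_
    ring

end Conj
end RegGroup

/-! ### Levi decompositions of abstract affine groups -/

lemma eq_zero_of_squarefree_of_isNilpotent {E : Type*} [Ring E] [Algebra ℂ E]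
    {s : E} (hs : ∃ p : Polynomial ℂ, Squarefree p ∧ Polynomial.aeval s p = 0)
    (hn : IsNilpotent s) : s = 0 := by
  obtain ⟨p, hp, h0⟩ := hs
  have h1 : (Algebra.lmul ℂ E s).IsSemisimple :=
    Module.End.isSemisimple_of_squarefree_aeval_eq_zero hp
      (by rw [Polynomial.aeval_algHom_apply, h0, map_zero])
  have h2 := Module.End.eq_zero_of_isNilpotent_isSemisimple (hn.map (Algebra.lmul ℂ E)) h1
  simpa using LinearMap.congr_fun h2 1

lemma isSemisimple_lsmul_of_squarefree {E : Type*} [Ring E] [Algebra ℂ E]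
    {s : E} (hs : ∃ p : Polynomial ℂ, Squarefree p ∧ Polynomial.aeval s p = 0)
    (W : Type*) [AddCommGroup W] [Module ℂ W] [Module E W] [IsScalarTower ℂ E W] :
    (Algebra.lsmul ℂ ℂ W s).IsSemisimple := by
  obtain ⟨p, hp, h0⟩ := hs
  exact Module.End.isSemisimple_of_squarefree_aeval_eq_zero hp
      (by rw [Polynomial.aeval_algHom_apply, h0, map_zero])

lemma mem_jacobson_of_smul_eq_zero {B : Type*} [Ring B] {b : B}
    (h : ∀ m : Ideal B, m.IsMaximal → ∀ w : B ⧸ m, b • w = 0) : b ∈ Ring.jacobson B := by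
  rw [Ring.jacobson_eq_sInf_isMaximal, Submodule.mem_sInf]
  intro m hm
  have := h m hm (Submodule.Quotient.mk 1)
  rw [← Submodule.Quotient.mk_smul, Submodule.Quotient.mk_eq_zero] at this
  simpa using this

lemma LieAlgebra.exists_smul_of_mem_radical {L : Type*} (M : Type*) [LieRing L] [LieAlgebra ℂ L]
    [Module.Finite ℂ L] [AddCommGroup M] [Module ℂ M] [LieRingModule L M] [LieModule ℂ L M]
    [Module.Finite ℂ M] [LieModule.IsIrreducible ℂ L M] {z : L} (hz : z ∈ LieAlgebra.radical ℂ L) :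
    ∃ c : ℂ, ∀ m : M, ⁅z, m⁆ = c • m := by
  have _i := LieModule.nontrivial_of_isIrreducible ℂ L M
  obtain ⟨χ, hχ⟩ : ∃ χ : Module.Dual ℂ (LieAlgebra.radical ℂ L),
      Nontrivial (LieModule.weightSpace M χ) :=
    LieModule.exists_nontrivial_weightSpace_of_isSolvable ℂ (LieAlgebra.radical ℂ L) M
  let N : LieSubmodule ℂ L M := LieModule.weightSpaceOfIsLieTower ℂ M χ
  replace hχ : Nontrivial N := hχ
  replace hχ : N = ⊤ := N.eq_top_of_isIrreducible ℂ L M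
  refine ⟨χ ⟨z, hz⟩, fun m => ?_⟩
  have hm : ∀ (y : L) (hy : y ∈ LieAlgebra.radical ℂ L), ⁅y, m⁆ = χ ⟨y, hy⟩ • m := by
    simpa [N, LieModule.weightSpaceOfIsLieTower, LieModule.mem_weightSpace] using
      (hχ ▸ LieSubmodule.mem_top _ : m ∈ N)
  exact hm z hz

namespace RegGroup

section Module

variable {Γ : Type} [Group Γ] {𝒜 : RegGroup Γ}
variable {B : Type*} [Ring B] [Algebra ℂ B] [FiniteDimensional ℂ B]
variable (W : Type*) [AddCommGroup W] [Module ℂ W] [Module B W] [IsScalarTower ℂ B W]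

/-- A module over the target of a representation is a module over the point derivations. -/
@[reducible] def lieRingModule {ρ : Γ →* B} (hρ : 𝒜.IsAlgHom ρ) : LieRingModule 𝒜.PD W where
  bracket δ w := diff hρ δ • w
  add_lie _ _ _ := by simp only [map_add, add_smul]
  lie_add _ _ _ := smul_add _ _ _
  leibniz_lie _ _ _ := by
    simp only [diff_lie, sub_smul, mul_smul]; abel

lemma lieModule {ρ : Γ →* B} (hρ : 𝒜.IsAlgHom ρ) :
    letI := lieRingModule W hρ
    LieModule ℂ 𝒜.PD W :=
  letI := lieRingModule W hρ
  { smul_lie := fun _ _ _ => by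
      change diff hρ _ • _ = _ • (diff hρ _ • _)
      rw [map_smul, smul_assoc]
    lie_smul := fun t δ w => by
      change diff hρ _ • _ = _ • (diff hρ _ • _)
      exact (Algebra.lsmul ℂ ℂ W (diff hρ δ)).map_smul t w }

variable {W}

/-- The coefficient functional of a vector. -/
def vecCoeff (φ : Module.Dual ℂ W) (w : W) : Module.Dual ℂ B :=
  φ ∘ₗ (LinearMap.toSpanSingleton B W w).restrictScalars ℂ

omit [FiniteDimensional ℂ B] in
@[simp] lemma vecCoeff_apply (φ : Module.Dual ℂ W) (w : W) (b : B) :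
    vecCoeff φ w b = φ (b • w) := rfl

lemma smul_mem_of_diff_smul_mem (hc : 𝒜.Conn) {ρ : Γ →* B} (hρ : 𝒜.IsAlgHom ρ)
    (P : Submodule ℂ W) (hP : ∀ δ, ∀ w ∈ P, diff hρ δ • w ∈ P) (g : Γ) {w : W} (hw : w ∈ P) :
    ρ g • w ∈ P := by
  by_contra h
  obtain ⟨φ, h1, h2⟩ := Submodule.exists_le_ker_of_notMem h
  have hmul : ∀ δ v, (vecCoeff φ v) ∘ₗ LinearMap.mulRight ℂ (diff hρ δ) =
      vecCoeff (B := B) φ (diff hρ δ • v) := by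
    intro δ v; ext b; simp [mul_smul]
  have := coeff_const hc hρ {l | ∃ v ∈ P, l = vecCoeff φ v}
    (by rintro l ⟨v, hv, rfl⟩; simpa using h2 hv)
    (by rintro l ⟨v, hv, rfl⟩ δ; exact ⟨_, hP δ v hv, hmul δ v⟩)
    (vecCoeff φ w) (fun δ => ⟨_, hP δ w hw, hmul δ w⟩) g
  apply h1
  have h3 : φ w = 0 := h2 hw
  simpa [h3] using this

lemma smul_eq_of_diff_smul_eq_zero (hc : 𝒜.Conn) {ρ : Γ →* B} (hρ : 𝒜.IsAlgHom ρ)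
    {w : W} (hw : ∀ δ, diff hρ δ • w = 0) (g : Γ) : ρ g • w = w := by
  rw [← sub_eq_zero, ← Module.forall_dual_apply_eq_zero_iff ℂ]
  intro φ
  have hmul : ∀ δ, (vecCoeff φ w) ∘ₗ LinearMap.mulRight ℂ (diff hρ δ) = (0 : Module.Dual ℂ B) := by
    intro δ; ext b; simp [mul_smul, hw]
  have := coeff_const hc hρ {0} (by simp) (by rintro l hl δ; simp_all)
    (vecCoeff φ w) (fun δ => hmul δ) g
  simpa [sub_eq_zero] using this

lemma exists_fixed_of_isNilpotent [FiniteDimensional ℂ W] [Nontrivial W] (hc : 𝒜.Conn)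
    {ρ : Γ →* B} (hρ : 𝒜.IsAlgHom ρ) (hn : ∀ δ, IsNilpotent (diff hρ δ)) :
    ∃ w : W, w ≠ 0 ∧ ∀ g, ρ g • w = w := by
  let _ := lieRingModule W hρ
  have := lieModule W hρ
  have hend : ∀ δ, LieModule.toEnd ℂ 𝒜.PD W δ = Algebra.lsmul ℂ ℂ W (diff hρ δ) := fun δ => rfl
  have : LieModule.IsNilpotent 𝒜.PD W := LieModule.isNilpotent_iff_forall' (R := ℂ).2 (by
    intro δ
    rw [hend]
    exact (hn δ).map _)
  obtain ⟨⟨w, hw⟩, hne⟩ := @exists_ne _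
    (LieModule.nontrivial_max_triv_of_isNilpotent ℂ 𝒜.PD W) 0
  refine ⟨w, fun h => hne (Subtype.ext h), ?_⟩
  apply smul_eq_of_diff_smul_eq_zero hc hρ
  intro δ
  exact (LieModule.mem_maxTrivSubmodule ℂ 𝒜.PD W w).1 hw δ

lemma radical_acts_by_scalars [FiniteDimensional ℂ W] [Nontrivial W]
    {ρ : Γ →* B} (hρ : 𝒜.IsAlgHom ρ)
    (hirr : ∀ P : Submodule ℂ W, (∀ δ, ∀ w ∈ P, diff hρ δ • w ∈ P) → P = ⊥ ∨ P = ⊤)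
    {z : 𝒜.PD} (hz : z ∈ LieAlgebra.radical ℂ 𝒜.PD) : ∃ c : ℂ, ∀ w : W, diff hρ z • w = c • w := by
  let _ := lieRingModule W hρ
  have := lieModule W hρ
  have : LieModule.IsIrreducible ℂ 𝒜.PD W := by
    apply LieModule.IsIrreducible.mk
    intro N hN
    rcases hirr N.toSubmodule (fun δ w hw => N.lie_mem hw) with h | h
    · exact absurd ((LieSubmodule.toSubmodule_eq_bot N).1 h) hN
    · exact (LieSubmodule.toSubmodule_eq_top N).1 h
  exact LieAlgebra.exists_smul_of_mem_radical W hz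

end Module

end RegGroup

lemma aeval_intertwine {V V' : Type*} [AddCommGroup V] [Module ℂ V] [AddCommGroup V'] [Module ℂ V']
    {f : Module.End ℂ V} {f' : Module.End ℂ V'} (T : V →ₗ[ℂ] V') (h : ∀ v, T (f v) = f' (T v))
    (p : Polynomial ℂ) (v : V) :
    T (Polynomial.aeval f p v) = Polynomial.aeval f' p (T v) := by
  induction p using Polynomial.induction_on' with
  | add p q hp hq => simp [hp, hq]
  | monomial n a =>
    simp only [Polynomial.aeval_monomial, Module.End.mul_apply, Module.algebraMap_end_apply,
      map_smul]
    congr 1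
    induction n generalizing v with
    | zero => simp
    | succ n ih => rw [pow_succ, pow_succ, Module.End.mul_apply, Module.End.mul_apply, ih, h]

namespace RegGroup

variable {Γ ΓU ΓL : Type} [Group Γ] [Group ΓU] [Group ΓL]

/-- The properties of a Levi decomposition used below. -/
structure IsLevi (𝒜 : RegGroup Γ) (𝒰 : RegGroup ΓU) (ℒ : RegGroup ΓL)
    (ιU : ΓU →* Γ) (ιL : ΓL →* Γ) : Prop where
  regU : IsRegHom 𝒜 𝒰 ιU
  regL : IsRegHom 𝒜 ℒ ιL
  connU : 𝒰.Conn
  connL : ℒ.Conn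
  normal : ∀ g u, ∃ u', g * ιU u * g⁻¹ = ιU u'
  decomp : ∀ g, ∃ u l, g = ιU u * ιL l
  surjL : ∀ f ∈ ℒ.A, ∃ f' ∈ 𝒜.A, ∀ l, f l = f' (ιL l)
  unip : ∃ (m : ℕ) (φ : ΓU →* Matrix (Fin m) (Fin m) ℂ) (hφ : 𝒰.IsAlgHom φ),
    Function.Injective φ ∧ ∀ δ, IsNilpotent (diff hφ δ)
  red : ∀ {E : Type} [Ring E] [Algebra ℂ E] [FiniteDimensional ℂ E] (ρ : ΓL →* E)
    (hρ : ℒ.IsAlgHom ρ), Algebra.adjoin ℂ (Set.range (coeff hρ)) = ⊤ →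
    ∀ J : Ideal E, J.IsTwoSided → IsNilpotent J → ∀ g, ρ g - 1 ∈ J → g = 1

namespace IsLevi

variable {𝒜 : RegGroup Γ} {𝒰 : RegGroup ΓU} {ℒ : RegGroup ΓL} {ιU : ΓU →* Γ} {ιL : ΓL →* Γ}

lemma isNilpotent_diff (D : IsLevi 𝒜 𝒰 ℒ ιU ιL) {E : Type} [Ring E] [Algebra ℂ E]
    [FiniteDimensional ℂ E] {ρ : ΓU →* E} (hρ : 𝒰.IsAlgHom ρ) (δ : 𝒰.PD) :
    IsNilpotent (diff hρ δ) := by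
  obtain ⟨δs, δn, rfl, h⟩ := exists_jordan δ
  obtain ⟨m, φ, hφ, hinj, hn⟩ := D.unip
  have h0 : diff hφ δs = 0 := eq_zero_of_squarefree_of_isNilpotent (h hφ).1 (hn δs)
  have : δs = 0 := by
    apply eq_zero_of_exp_trivial
    intro t g hg
    apply hinj
    apply ext_dual
    intro l
    have := hg (coeff hφ l)
    rwa [expval_coeff hφ δs t l (by simp [h0]), coeff_apply, ← map_one φ] at this
  rw [this, zero_add]
  exact (h hρ).2

variable {B : Type} [Ring B] [Algebra ℂ B] [FiniteDimensional ℂ B] {R : Γ →* B}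

omit [FiniteDimensional ℂ B] in
lemma smul_mem_of_span {W : Type*} [AddCommGroup W] [Module ℂ W] [Module B W]
    [IsScalarTower ℂ B W] (hspan : Submodule.span ℂ (Set.range R) = ⊤) (P : Submodule ℂ W)
    (hP : ∀ g, ∀ w ∈ P, R g • w ∈ P) (b : B) {w : W} (hw : w ∈ P) : b • w ∈ P := by
  have hb : b ∈ Submodule.span ℂ (Set.range R) := hspan ▸ Submodule.mem_top
  induction hb using Submodule.span_induction with
  | mem x hx => obtain ⟨g, rfl⟩ := hx; exact hP g w hw
  | zero => simp
  | add x y _ _ hx hy => rw [add_smul]; exact P.add_mem hx hy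
  | smul t x _ hx => rw [smul_assoc]; exact P.smul_mem t hx

omit [FiniteDimensional ℂ B] in
lemma eq_bot_or_eq_top {W : Type*} [AddCommGroup W] [Module ℂ W] [Module B W]
    [IsScalarTower ℂ B W] [IsSimpleModule B W] (hspan : Submodule.span ℂ (Set.range R) = ⊤)
    (P : Submodule ℂ W) (hP : ∀ g, ∀ w ∈ P, R g • w ∈ P) : P = ⊥ ∨ P = ⊤ := by
  let Q : Submodule B W :=
    { P with smul_mem' := fun b w hw => smul_mem_of_span hspan P hP b hw }
  rcases IsSimpleOrder.eq_bot_or_eq_top Q with h | h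
  · left
    rw [eq_bot_iff]
    intro w hw
    exact (h ▸ hw : w ∈ (⊥ : Submodule B W))
  · right
    rw [eq_top_iff]
    intro w _
    exact (h ▸ Submodule.mem_top : w ∈ Q)

/-- The unipotent radical acts trivially on simple modules. -/
lemma smul_radical (D : IsLevi 𝒜 𝒰 ℒ ιU ιL) (hR : 𝒜.IsAlgHom R)
    (hspan : Submodule.span ℂ (Set.range R) = ⊤) {W : Type*} [AddCommGroup W] [Module ℂ W]
    [Module B W] [IsScalarTower ℂ B W] [FiniteDimensional ℂ W] [IsSimpleModule B W] (u : ΓU)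
    (w : W) : R (ιU u) • w = w := by
  have := IsSimpleModule.nontrivial B W
  let P : Submodule ℂ W :=
    { carrier := {w | ∀ u, R (ιU u) • w = w}
      add_mem' := fun ha hb u => by rw [smul_add, ha u, hb u]
      zero_mem' := fun u => smul_zero _
      smul_mem' := fun t w hw u => by
        have := (Algebra.lsmul ℂ ℂ W (R (ιU u))).map_smul t w
        simp only [Algebra.lsmul_coe] at this
        rw [this, hw u] }
  have hP : ∀ g, ∀ w ∈ P, R g • w ∈ P := by
    intro g w hw u
    obtain ⟨u', hu'⟩ := D.normal g⁻¹ u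
    rw [← mul_smul, ← map_mul, show ιU u * g = g * ιU u' by rw [← hu']; group, map_mul, mul_smul,
      hw u']
  obtain ⟨w₀, hw₀, hfix⟩ := exists_fixed_of_isNilpotent (W := W) D.connU (hR.comp D.regU)
    (fun δ => D.isNilpotent_diff _ δ)
  rcases eq_bot_or_eq_top hspan P hP with h | h
  · exact absurd (h ▸ (show w₀ ∈ P from hfix) : w₀ ∈ (⊥ : Submodule ℂ W)) hw₀
  · exact (h ▸ Submodule.mem_top : w ∈ P) u

lemma sub_one_mem_jacobson (D : IsLevi 𝒜 𝒰 ℒ ιU ιL) (hR : 𝒜.IsAlgHom R)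
    (hspan : Submodule.span ℂ (Set.range R) = ⊤) (u : ΓU) :
    R (ιU u) - 1 ∈ Ring.jacobson B := by
  apply mem_jacobson_of_smul_eq_zero
  intro m hm w
  have : IsSimpleModule B (B ⧸ m) := isSimpleModule_iff_isCoatom.2 hm.out
  rw [sub_smul, one_smul, D.smul_radical hR hspan, sub_self]

omit [FiniteDimensional ℂ B] in
lemma adjoin_coeff_comp (D : IsLevi 𝒜 𝒰 ℒ ιU ιL) (hR : 𝒜.IsAlgHom R)
    (hgen : Algebra.adjoin ℂ (Set.range (coeff hR)) = ⊤) :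
    Algebra.adjoin ℂ (Set.range (coeff (hR.comp D.regL))) = ⊤ := by
  have hs : Function.Surjective (pull D.regL) := by
    rintro ⟨f, hf⟩
    obtain ⟨f', hf', h⟩ := D.surjL f hf
    exact ⟨⟨f', hf'⟩, A_ext fun x => (h x).symm⟩
  have h1 : Set.range (coeff (hR.comp D.regL)) = pull D.regL '' Set.range (coeff hR) := by
    rw [← Set.range_comp]; rfl
  rw [h1, Algebra.adjoin_image, hgen, Algebra.map_top, AlgHom.range_eq_top]
  exact hs

lemma isNilpotent_jacobson (B : Type) [Ring B] [Algebra ℂ B] [FiniteDimensional ℂ B] :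
    IsNilpotent (Ring.jacobson B) := by
  have := IsArtinianRing.of_finite ℂ B
  exact IsSemiprimaryRing.isNilpotent

lemma eq_zero_of_diff_mem_jacobson (D : IsLevi 𝒜 𝒰 ℒ ιU ιL) (hR : 𝒜.IsAlgHom R)
    (hgen : Algebra.adjoin ℂ (Set.range (coeff hR)) = ⊤) {δ : ℒ.PD}
    (h : diff (hR.comp D.regL) δ ∈ Ring.jacobson B) : δ = 0 := by
  apply eq_zero_of_exp_trivial
  intro t g hg
  refine D.red _ (hR.comp D.regL) (D.adjoin_coeff_comp hR hgen) (Ring.jacobson B) inferInstance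
    (isNilpotent_jacobson B) g ?_
  by_contra hne
  obtain ⟨l, h1, h2⟩ := Submodule.exists_le_ker_of_notMem
    (p := (Ring.jacobson B).restrictScalars ℂ) hne
  apply h1
  have := hg (coeff (hR.comp D.regL) l)
  rw [expval_coeff _ δ t l, coeff_apply] at this
  · rw [map_sub, this, sub_self]
  · intro k
    apply h2
    change _ ∈ Ring.jacobson B
    rw [pow_succ]
    exact Ideal.mul_mem_left _ _ h

lemma exists_smul_of_mem_radical (D : IsLevi 𝒜 𝒰 ℒ ιU ιL) (hR : 𝒜.IsAlgHom R)
    (hspan : Submodule.span ℂ (Set.range R) = ⊤) {m : Ideal B} (hm : m.IsMaximal) {z : ℒ.PD}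
    (hz : z ∈ LieAlgebra.radical ℂ ℒ.PD) :
    ∃ c : ℂ, ∀ w : B ⧸ m, diff (hR.comp D.regL) z • w = c • w := by
  have : IsSimpleModule B (B ⧸ m) := isSimpleModule_iff_isCoatom.2 hm.out
  have := IsSimpleModule.nontrivial B (B ⧸ m)
  refine radical_acts_by_scalars (hR.comp D.regL) ?_ hz
  intro P hP
  apply eq_bot_or_eq_top hspan P
  intro g w hw
  obtain ⟨u, l, rfl⟩ := D.decomp g
  rw [map_mul, mul_smul, D.smul_radical hR hspan]
  exact smul_mem_of_diff_smul_mem D.connL (hR.comp D.regL) P hP l hw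

/-- The radical of the Lie algebra of the Levi subgroup is central. -/
theorem lie_radical_eq_zero (D : IsLevi 𝒜 𝒰 ℒ ιU ιL) {z : ℒ.PD}
    (hz : z ∈ LieAlgebra.radical ℂ ℒ.PD) (x : ℒ.PD) : ⁅x, z⁆ = 0 := by
  obtain ⟨B, _, _, _, R, hR, hspan, hgen⟩ := exists_generating_rep 𝒜
  apply D.eq_zero_of_diff_mem_jacobson hR hgen
  apply mem_jacobson_of_smul_eq_zero
  intro m hm w
  obtain ⟨c, hc⟩ := D.exists_smul_of_mem_radical hR hspan hm hz
  rw [diff_lie, sub_smul, mul_smul, mul_smul, hc, hc, sub_eq_zero]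
  exact (Algebra.lsmul ℂ ℂ (B ⧸ m) _).map_smul c w

/-- The radical of the Lie algebra of the Levi subgroup acts semisimply. -/
theorem squarefree_of_mem_radical (D : IsLevi 𝒜 𝒰 ℒ ιU ιL) {z : ℒ.PD}
    (hz : z ∈ LieAlgebra.radical ℂ ℒ.PD) {E : Type} [Ring E] [Algebra ℂ E] [FiniteDimensional ℂ E]
    {ρ : ΓL →* E} (hρ : ℒ.IsAlgHom ρ) :
    ∃ p : Polynomial ℂ, Squarefree p ∧ Polynomial.aeval (diff hρ z) p = 0 := by
  obtain ⟨B, _, _, _, R, hR, hspan, hgen⟩ := exists_generating_rep 𝒜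
  obtain ⟨s, n, rfl, h⟩ := exists_jordan z
  have hn : n = 0 := by
    apply D.eq_zero_of_diff_mem_jacobson hR hgen
    apply mem_jacobson_of_smul_eq_zero
    intro m hm w
    obtain ⟨c, hc⟩ := D.exists_smul_of_mem_radical hR hspan hm hz
    let T := Algebra.lsmul (A := B) ℂ ℂ (B ⧸ m)
    have h1 : (T (diff (hR.comp D.regL) s)).IsSemisimple :=
      isSemisimple_lsmul_of_squarefree (h _).1 _
    have h2 : IsNilpotent (T (diff (hR.comp D.regL) n)) := (h _).2.map T
    have h3 : T (diff (hR.comp D.regL) n) =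
        -(T (diff (hR.comp D.regL) s) - algebraMap ℂ _ c) := by
      ext w
      have := hc w
      rw [map_add, add_smul] at this
      simp only [LinearMap.sub_apply, Module.algebraMap_end_apply, neg_sub]
      rw [← this]
      simp [T]
    have h4 : (T (diff (hR.comp D.regL) n)).IsSemisimple := by
      rw [h3, Module.End.isSemisimple_neg, Module.End.isSemisimple_sub_algebraMap_iff]
      exact h1
    exact LinearMap.congr_fun (Module.End.eq_zero_of_isNilpotent_isSemisimple h2 h4) w
  rw [hn, add_zero]
  exact (h hρ).1

/-- The radical of the Lie algebra of the Levi subgroup acts semisimply in the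
adjoint representation. -/
theorem squarefree_ad_of_mem_radical (D : IsLevi 𝒜 𝒰 ℒ ιU ιL) {z : ℒ.PD}
    (hz : z ∈ LieAlgebra.radical ℂ ℒ.PD) : ∃ p : Polynomial ℂ, Squarefree p ∧
      Polynomial.aeval (LieModule.toEnd ℂ 𝒜.PD 𝒜.PD (push D.regL z)) p = 0 := by
  obtain ⟨B, _, _, _, R, hR, hspan, hgen⟩ := exists_generating_rep 𝒜
  obtain ⟨p, hp, h0⟩ := D.squarefree_of_mem_radical hz (isAlgHom_conjRep (hR.comp D.regL))
  refine ⟨p, hp, ?_⟩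
  ext1 x
  apply diff_eq_zero_imp hR hgen
  rw [aeval_intertwine (f' := diff (isAlgHom_conjRep (hR.comp D.regL)) z), h0]
  · rfl
  · intro v
    rw [diff_conjRep (hR.comp D.regL), diff_comp, LieModule.toEnd_apply_apply, diff_lie]

lemma commutator_mem (D : IsLevi 𝒜 𝒰 ℒ ιU ιL) (hR : 𝒜.IsAlgHom R)
    (hspan : Submodule.span ℂ (Set.range R) = ⊤) (S : Submodule ℂ B)
    (hS : ∀ δ : ℒ.PD, ∀ s ∈ S, diff hR (push D.regL δ) * s - s * diff hR (push D.regL δ) ∈ S)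
    (d : 𝒜.PD) {s : B} (hs : s ∈ S) :
    diff hR d * s - s * diff hR d ∈ Submodule.span ℂ {w : B | ∃ δ : ℒ.PD, ∃ s ∈ S,
      w = diff hR (push D.regL δ) * s - s * diff hR (push D.regL δ)} ⊔
        (Ring.jacobson B).restrictScalars ℂ := by
  by_contra hne
  obtain ⟨ℓ, h1, h2⟩ := Submodule.exists_le_ker_of_notMem hne
  set Q := Submodule.span ℂ {w : B | ∃ δ : ℒ.PD, ∃ s ∈ S,
      w = diff hR (push D.regL δ) * s - s * diff hR (push D.regL δ)} with hQdef
  have hQ : ∀ q ∈ Q, ℓ q = 0 := fun q hq => h2 (Submodule.mem_sup_left hq)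
  have hJ : ∀ q ∈ Ring.jacobson B, ℓ q = 0 := fun q hq => h2 (Submodule.mem_sup_right hq)
  have hQS : Q ≤ S := by
    rw [hQdef, Submodule.span_le]
    rintro w ⟨δ, s, hs, rfl⟩
    exact hS δ s hs
  have hcL := isAlgHom_conjRep (hR.comp D.regL)
  have hcG := isAlgHom_conjRep hR
  have hmul : ∀ (δ : ℒ.PD) (v : B), (ℓ ∘ₗ LinearMap.applyₗ v) ∘ₗ
      LinearMap.mulRight ℂ (diff (E := Module.End ℂ B) hcL δ) = ℓ ∘ₗ LinearMap.applyₗ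
        (diff hR (push D.regL δ) * v - v * diff hR (push D.regL δ)) := by
    intro δ v
    ext T
    simp only [LinearMap.comp_apply, LinearMap.applyₗ_apply_apply, LinearMap.mulRight_apply,
      Module.End.mul_apply, diff_conjRep (hR.comp D.regL)]
    rw [diff_comp hR D.regL]
  have hL : ∀ l : ΓL, ℓ (R (ιL l) * (s * R (ιL l)⁻¹)) = ℓ s := by
    intro l
    have := coeff_const D.connL hcL {l | ∃ v ∈ Q, l = ℓ ∘ₗ LinearMap.applyₗ v}
      (by rintro _ ⟨v, hv, rfl⟩; exact hQ v hv)
      (by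
        rintro _ ⟨v, hv, rfl⟩ δ
        exact ⟨_, Submodule.subset_span ⟨δ, v, hQS hv, rfl⟩, hmul δ v⟩)
      (ℓ ∘ₗ LinearMap.applyₗ s)
      (fun δ => ⟨_, Submodule.subset_span ⟨δ, s, hs, rfl⟩, hmul δ s⟩) l
    simpa [conjRep_apply] using this
  have hG : ∀ g : Γ, ℓ (R g * (s * R g⁻¹)) = ℓ s := by
    intro g
    obtain ⟨u, l, rfl⟩ := D.decomp g
    rw [← hL l, ← sub_eq_zero, ← map_sub]
    apply hJ
    have e1 : R (ιU u) - 1 ∈ Ring.jacobson B := D.sub_one_mem_jacobson hR hspan u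
    have e2 : R (ιU u)⁻¹ - 1 ∈ Ring.jacobson B := by
      rw [← map_inv]; exact D.sub_one_mem_jacobson hR hspan u⁻¹
    set X := R (ιL l) * (s * R (ιL l)⁻¹) with hX
    have : R (ιU u * ιL l) * (s * R (ιU u * ιL l)⁻¹) - X =
        (R (ιU u) - 1) * (X * R (ιU u)⁻¹) + X * (R (ιU u)⁻¹ - 1) := by
      rw [mul_inv_rev, map_mul, map_mul, hX]
      noncomm_ring
    rw [this]
    exact Ideal.add_mem _ (Ideal.mul_mem_right _ _ e1) (Ideal.mul_mem_left _ _ e2)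
  apply h1
  have := diff_eq_zero_of_const hcG d (ℓ ∘ₗ LinearMap.applyₗ s) (by
    intro g
    simpa [conjRep_apply] using hG g)
  simpa [diff_conjRep hR] using this

/-- The derived algebra of the whole Lie algebra meets that of the Levi subgroup in its own
derived algebra. -/
theorem mem_derived (D : IsLevi 𝒜 𝒰 ℒ ιU ιL) {x : ℒ.PD}
    (hx : push D.regL x ∈ Submodule.span ℂ {w : 𝒜.PD | ∃ a b : 𝒜.PD, w = ⁅a, b⁆}) :
    x ∈ Submodule.span ℂ {w : ℒ.PD | ∃ a b : ℒ.PD, w = ⁅a, b⁆} := by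
  obtain ⟨B, _, _, _, R, hR, hspan, hgen⟩ := exists_generating_rep 𝒜
  set J : Submodule ℂ B := (Ring.jacobson B).restrictScalars ℂ with hJ
  set K : Submodule ℂ B := (Submodule.span ℂ {w : ℒ.PD | ∃ a b : ℒ.PD, w = ⁅a, b⁆}).map
    (diff hR ∘ₗ push D.regL) with hK
  have hLL : ∀ (δ : ℒ.PD) (d : 𝒜.PD),
      diff hR ⁅d, push D.regL δ⁆ ∈ K ⊔ J := by
    intro δ d
    rw [diff_lie]
    refine (sup_le_sup_right ?_ J) (D.commutator_mem hR hspan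
      (LinearMap.range (diff hR ∘ₗ push D.regL)) ?_ d ⟨δ, rfl⟩)
    · rw [Submodule.span_le]
      rintro _ ⟨a, _, ⟨b, rfl⟩, rfl⟩
      refine ⟨⁅a, b⁆, Submodule.subset_span ⟨a, b, rfl⟩, ?_⟩
      rw [LinearMap.comp_apply, push_lie, diff_lie]; rfl
    · rintro a _ ⟨b, rfl⟩
      refine ⟨⁅a, b⁆, ?_⟩
      rw [LinearMap.comp_apply, push_lie, diff_lie]; rfl
  have hGG : ∀ a b : 𝒜.PD, diff hR ⁅a, b⁆ ∈ K ⊔ J := by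
    intro a b
    rw [diff_lie]
    refine (show _ ≤ K ⊔ J from sup_le ?_ le_sup_right) (D.commutator_mem hR hspan
      (LinearMap.range (diff hR)) ?_ a ⟨b, rfl⟩)
    · rw [Submodule.span_le]
      rintro _ ⟨a, _, ⟨b, rfl⟩, rfl⟩
      rw [← diff_lie, ← lie_skew, map_neg]
      exact neg_mem (hLL a b)
    · rintro a _ ⟨b, rfl⟩
      exact ⟨⁅push D.regL a, b⁆, by rw [diff_lie]⟩
  have h1 : diff hR (push D.regL x) ∈ K ⊔ J := by
    have : Submodule.span ℂ {w : 𝒜.PD | ∃ a b : 𝒜.PD, w = ⁅a, b⁆} ≤ (K ⊔ J).comap (diff hR) := by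
      rw [Submodule.span_le]
      rintro _ ⟨a, b, rfl⟩
      exact hGG a b
    exact this hx
  obtain ⟨_, ⟨y, hy, rfl⟩, j, hj, hyj⟩ := Submodule.mem_sup.1 h1
  have : x - y = 0 := by
    apply D.eq_zero_of_diff_mem_jacobson hR hgen
    rw [map_sub, diff_comp hR D.regL, diff_comp hR D.regL, ← hyj]
    simpa [hJ] using hj
  rw [sub_eq_zero.1 this]
  exact hy

end IsLevi
end RegGroup

/-! ### Affine algebraic groups and their regular functions -/

lemma exists_split_eval {n m : ℕ} (q : MvPolynomial (Fin (n + m)) ℂ) :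
    ∃ (k : ℕ) (a : Fin k → MvPolynomial (Fin n) ℂ) (b : Fin k → MvPolynomial (Fin m) ℂ),
      ∀ x y, eval (Fin.append x y) q = ∑ j, eval x (a j) * eval y (b j) := by
  let s := q.support.equivFin.symm
  refine ⟨q.support.card, fun j => C (q.coeff (s j)) * ∏ i, X i ^ ((s j).1 (Fin.castAdd m i)),
    fun j => ∏ i, X i ^ ((s j).1 (Fin.natAdd n i)), fun x y => ?_⟩
  rw [eval_eq', ← Finset.sum_coe_sort, ← Equiv.sum_comp s]
  refine Finset.sum_congr rfl fun j _ => ?_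
  simp [Fin.prod_univ_add, mul_assoc]

lemma aeval_apply_eq_eval {σ : Type*} (x : σ → ℂ) (p : MvPolynomial σ ℂ) :
    aeval x p = eval x p := RingHom.congr_fun (coe_aeval_eq_eval x) p

lemma eval_bind₁_apply {σ τ : Type*} (x : τ → ℂ) (P : σ → MvPolynomial τ ℂ)
    (p : MvPolynomial σ ℂ) : eval x (bind₁ P p) = eval (fun i => eval x (P i)) p := by
  simp only [← aeval_apply_eq_eval, aeval_bind₁]

namespace AffAlgGroup

variable (H : AffAlgGroup)

variable {H} in
/-- The underlying point. -/
def pt (x : H.Gp) : Pt H.n := x.1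

variable {H} in
lemma pt_mem (x : H.Gp) : pt x ∈ H.carrier := x.2

/-- Restriction of polynomials to the group. -/
def res : MvPolynomial (Fin H.n) ℂ →ₐ[ℂ] (H.Gp → ℂ) := aeval fun i (x : H.Gp) => pt x i

@[simp] lemma res_apply (p : MvPolynomial (Fin H.n) ℂ) (x : H.Gp) :
    H.res p x = eval (pt x) p := by
  have : (Pi.evalAlgHom ℂ (fun _ : H.Gp => ℂ) x).comp H.res = aeval (pt x) := by
    ext i; simp [res]
  exact (AlgHom.congr_fun this p).trans (aeval_apply_eq_eval _ _)

lemma pt_mul (x y : H.Gp) : pt (x * y) = H.mul (pt x) (pt y) := rfl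
lemma pt_inv (x : H.Gp) : pt (x⁻¹) = H.inv (pt x) := rfl
lemma pt_one : pt (1 : H.Gp) = H.one := rfl

lemma exists_mul_poly : ∃ P : Fin H.n → MvPolynomial (Fin (H.n + H.n)) ℂ, ∀ x ∈ H.carrier,
    ∀ y ∈ H.carrier, ∀ i, H.mul x y i = eval (Fin.append x y) (P i) := by
  obtain ⟨P, hP⟩ := H.mul_regular
  refine ⟨P, fun x hx y hy i => ?_⟩
  have hl : Pt.left (Fin.append x y) = x := funext fun i => Fin.append_left x y i
  have hr : Pt.right (Fin.append x y) = y := funext fun i => Fin.append_right x y i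
  simpa only [hl, hr] using hP (Fin.append x y) (by simp [hl, hr, hx, hy]) i

/-- The algebra of regular functions. -/
def reg : RegGroup H.Gp where
  A := H.res.range
  fg := by
    rw [← Algebra.map_top]
    exact Subalgebra.FG.map _ Algebra.FiniteType.out
  comul := by
    rintro _ ⟨p, rfl⟩
    obtain ⟨P, hP⟩ := H.exists_mul_poly
    obtain ⟨k, a, b, h⟩ := exists_split_eval (bind₁ P p)
    refine ⟨k, fun j => ⟨H.res (a j), a j, rfl⟩, fun j => ⟨H.res (b j), b j, rfl⟩, fun g h' => ?_⟩
    change H.res p (g * h') = ∑ j, H.res (a j) g * H.res (b j) h'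
    simp only [res_apply, ← h, eval_bind₁_apply]
    congr 2
    funext i
    rw [pt_mul, hP _ (pt_mem g) _ (pt_mem h')]
  inv := by
    rintro _ ⟨p, rfl⟩
    obtain ⟨P, hP⟩ := H.inv_regular
    refine ⟨bind₁ P p, ?_⟩
    funext g
    change H.res (bind₁ P p) g = H.res p g⁻¹
    simp only [res_apply, eval_bind₁_apply]
    congr 2
    funext i
    rw [pt_inv, hP _ (pt_mem g)]
  pts := by
    intro χ
    let x : Pt H.n := fun i => χ ⟨H.res (X i), X i, rfl⟩
    have hχ : ∀ p, χ ⟨H.res p, p, rfl⟩ = eval x p := by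
      intro p
      have : χ.comp H.res.rangeRestrict = aeval x := by
        ext i; simp [x]; rfl
      exact (AlgHom.congr_fun this p).trans (aeval_apply_eq_eval _ _)
    have hx : x ∈ H.carrier := by
      obtain ⟨S, hS⟩ := H.isAlgebraic
      rw [hS]
      intro p hp
      rw [← hχ p]
      have : (⟨H.res p, p, rfl⟩ : H.res.range) = 0 := by
        apply Subtype.ext
        funext g
        exact (H.res_apply p g).trans ((Set.ext_iff.1 hS (pt g)).1 (pt_mem g) p hp)
      rw [this, map_zero]
    refine ⟨⟨x, hx⟩, ?_⟩
    rintro ⟨_, p, rfl⟩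
    exact (hχ p).trans (H.res_apply p ⟨x, hx⟩).symm

/-- The regular function of a polynomial. -/
def toReg : MvPolynomial (Fin H.n) ℂ →ₐ[ℂ] H.reg.A := H.res.rangeRestrict

@[simp] lemma toReg_apply (p : MvPolynomial (Fin H.n) ℂ) (x : H.Gp) :
    (H.toReg p).1 x = eval (pt x) p := H.res_apply p x

lemma toReg_surjective : Function.Surjective H.toReg := H.res.rangeRestrict_surjective

variable {H}

lemma mem_reg_of_eval {f : H.Gp → ℂ} (p : MvPolynomial (Fin H.n) ℂ)
    (h : ∀ x, f x = eval (pt x) p) : f ∈ H.reg.A := ⟨p, funext fun x => by simp [h]⟩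

lemma IsConnected.conn (h : H.IsConnected) : H.reg.Conn := by
  intro S T h1 h2
  let V : Set H.reg.A → Set (Pt H.n) := fun S => {x | ∀ p ∈ {p | H.toReg p ∈ S}, eval x p = 0}
  have hV : ∀ (S : Set H.reg.A) (x : H.Gp), pt x ∈ V S ↔ ∀ p ∈ S, p.1 x = 0 := by
    intro S x
    constructor
    · intro hx p hp
      obtain ⟨p, rfl⟩ := H.toReg_surjective p
      simpa using hx p hp
    · intro hx p hp
      simpa using hx _ hp
  rcases h (V S) (V T) ⟨_, rfl⟩ ⟨_, rfl⟩ (fun x hx => by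
      exact (h1 ⟨x, hx⟩).imp (hV S ⟨x, hx⟩).2 (hV T ⟨x, hx⟩).2) (by
      rw [Set.eq_empty_iff_forall_notMem]
      rintro x ⟨hx, hs, ht⟩
      exact h2 ⟨x, hx⟩ ⟨(hV S ⟨x, hx⟩).1 hs, (hV T ⟨x, hx⟩).1 ht⟩) with h3 | h3
  · exact Or.inl fun g => (hV S g).1 (h3 (pt_mem g))
  · exact Or.inr fun g => (hV T g).1 (h3 (pt_mem g))

/-! ### Tangent vectors -/

variable (H) in
/-- The tangent vector of a point derivation. -/
def tvec : H.reg.PD →ₗ[ℂ] Pt H.n where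
  toFun δ i := δ.1 (H.toReg (X i))
  map_add' _ _ := rfl
  map_smul' _ _ := rfl

lemma tvec_apply (δ : H.reg.PD) (i : Fin H.n) : H.tvec δ i = δ.1 (H.toReg (X i)) := rfl

lemma PD_toReg (δ : H.reg.PD) (p : MvPolynomial (Fin H.n) ℂ) :
    δ.1 (H.toReg p) = ∑ j, H.tvec δ j * eval H.one (pderiv j p) := by
  induction p using MvPolynomial.induction_on with
  | C a =>
    rw [RegGroup.PD_eq_zero_of_const]
    · simp
    · simp
  | add p q hp hq => simp [hp, hq, mul_add, Finset.sum_add_distrib]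
  | mul_X p i hp =>
    rw [map_mul, RegGroup.PD_mul, hp, ← tvec_apply]
    simp only [toReg_apply, Derivation.leibniz, pderiv_X, smul_eq_mul, map_add, map_mul, eval_X,
      pt_one, mul_add, Finset.sum_add_distrib]
    congr 1
    · simp [Pi.single_apply, Finset.sum_ite_eq, mul_comm]
    · rw [Finset.mul_sum]
      exact Finset.sum_congr rfl fun j _ => by ring

lemma tvec_injective : Function.Injective H.tvec := by
  rw [← LinearMap.ker_eq_bot, LinearMap.ker_eq_bot']
  intro δ h
  apply Subtype.ext
  ext f
  obtain ⟨p, rfl⟩ := H.toReg_surjective f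
  rw [PD_toReg, h]
  simp

lemma mem_range_tvec {v : Pt H.n} : (∃ δ, H.tvec δ = v) ↔ v ∈ tangentAt H.carrier H.one := by
  constructor
  · rintro ⟨δ, rfl⟩ p hp
    rw [← PD_toReg]
    apply RegGroup.PD_eq_zero_of_const
    intro g
    rw [toReg_apply, toReg_apply, hp _ (pt_mem g), hp _ (pt_mem 1)]
  · intro hv
    let d : MvPolynomial (Fin H.n) ℂ →ₗ[ℂ] ℂ :=
      ∑ j, v j • ((aeval H.one).toLinearMap ∘ₗ (pderiv j).toLinearMap)
    have hd : ∀ p, d p = ∑ j, v j * eval H.one (pderiv j p) := by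
      intro p
      simp [d]
    have hker : LinearMap.ker H.toReg.toLinearMap ≤ LinearMap.ker d := by
      intro p hp
      rw [LinearMap.mem_ker, hd]
      refine hv p fun x hx => ?_
      have := congrFun (congrArg Subtype.val (show H.toReg p = 0 from hp)) ⟨x, hx⟩
      exact (H.toReg_apply p ⟨x, hx⟩).symm.trans this
    obtain ⟨δ, hδ⟩ : ∃ δ : H.reg.A →ₗ[ℂ] ℂ, δ ∘ₗ H.toReg.toLinearMap = d :=
      exists_comp_eq_of_ker_le hker
    have hδ' : ∀ p, δ (H.toReg p) = ∑ j, v j * eval H.one (pderiv j p) := fun p => by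
      rw [← hd, ← hδ]; rfl
    refine ⟨⟨δ, ?_⟩, ?_⟩
    · intro f g
      obtain ⟨p, rfl⟩ := H.toReg_surjective f
      obtain ⟨q, rfl⟩ := H.toReg_surjective g
      rw [← map_mul, hδ', hδ', hδ', toReg_apply, toReg_apply, Finset.mul_sum, Finset.mul_sum,
        ← Finset.sum_add_distrib]
      refine Finset.sum_congr rfl fun j _ => ?_
      simp only [Derivation.leibniz, smul_eq_mul, map_add, map_mul, pt_one]
      ring
    · funext i
      rw [tvec_apply]
      simp [hδ', pderiv_X, Pi.single_apply]

end AffAlgGroup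

/-! ### The bracket of tangent vectors -/

section Specialize
variable {n m : ℕ}

/-- Specialization of the first block of variables. -/
def specL (x : Pt n) : MvPolynomial (Fin (n + m)) ℂ →ₐ[ℂ] MvPolynomial (Fin m) ℂ :=
  bind₁ (Fin.append (fun j => C (x j)) X)

/-- Specialization of the second block of variables. -/
def specR (y : Pt m) : MvPolynomial (Fin (n + m)) ℂ →ₐ[ℂ] MvPolynomial (Fin n) ℂ :=
  bind₁ (Fin.append X (fun j => C (y j)))

lemma eval_specL (x : Pt n) (y : Pt m) (q : MvPolynomial (Fin (n + m)) ℂ) :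
    eval y (specL x q) = eval (Fin.append x y) q := by
  rw [specL, eval_bind₁_apply]
  congr 2
  funext i
  refine Fin.addCases (fun i => ?_) (fun i => ?_) i <;> simp

lemma eval_specR (x : Pt n) (y : Pt m) (q : MvPolynomial (Fin (n + m)) ℂ) :
    eval x (specR y q) = eval (Fin.append x y) q := by
  rw [specR, eval_bind₁_apply]
  congr 2
  funext i
  refine Fin.addCases (fun i => ?_) (fun i => ?_) i <;> simp

lemma pderiv_specL (x : Pt n) (k : Fin m) (q : MvPolynomial (Fin (n + m)) ℂ) :
    pderiv k (specL x q) = specL x (pderiv (Fin.natAdd n k) q) := by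
  induction q using MvPolynomial.induction_on with
  | C a => simp [specL]
  | add p q hp hq => simp [hp, hq]
  | mul_X p i hp =>
    have h : pderiv k (specL x (X i)) = specL x (pderiv (Fin.natAdd n k) (X i)) := by
      refine Fin.addCases (fun i => ?_) (fun i => ?_) i
      · have : Fin.castAdd m i ≠ Fin.natAdd n k := by
          simp [Fin.ext_iff]; omega
        simp [specL, pderiv_X, this]
      · by_cases h : i = k
        · subst h; simp [specL]
        · simp [specL, pderiv_X, h]
    simp only [map_mul, Derivation.leibniz, smul_eq_mul, hp, h, map_add]

lemma pderiv_specR (y : Pt m) (k : Fin n) (q : MvPolynomial (Fin (n + m)) ℂ) :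
    pderiv k (specR y q) = specR y (pderiv (Fin.castAdd m k) q) := by
  induction q using MvPolynomial.induction_on with
  | C a => simp [specR]
  | add p q hp hq => simp [hp, hq]
  | mul_X p i hp =>
    have h : pderiv k (specR y (X i)) = specR y (pderiv (Fin.castAdd m k) (X i)) := by
      refine Fin.addCases (fun i => ?_) (fun i => ?_) i
      · by_cases h : i = k
        · subst h; simp [specR]
        · simp [specR, pderiv_X, h]
      · have : Fin.natAdd n i ≠ Fin.castAdd m k := by
          simp [Fin.ext_iff]; omega
        simp [specR, pderiv_X, this]
    simp only [map_mul, Derivation.leibniz, smul_eq_mul, hp, h, map_add]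

end Specialize

namespace AffAlgGroup
open RegGroup

variable (H : AffAlgGroup)

lemma exists_commutatorRep : ∃ F, IsCommutatorRep H F := by
  obtain ⟨P, hP⟩ := H.exists_mul_poly
  obtain ⟨I, hI⟩ := H.inv_regular
  let B : Fin (H.n + H.n) → MvPolynomial (Fin (H.n + H.n)) ℂ :=
    Fin.append (fun k => rename (Fin.castAdd H.n) (I k)) (fun k => rename (Fin.natAdd H.n) (I k))
  let A : Fin (H.n + H.n) → MvPolynomial (Fin (H.n + H.n)) ℂ :=
    Fin.append P (fun k => bind₁ B (P k))
  refine ⟨fun i => bind₁ A (P i), fun x hx y hy i => ?_⟩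
  have hB : (fun i => eval (Fin.append x y) (B i)) = Fin.append (H.inv x) (H.inv y) := by
    funext i
    refine Fin.addCases (fun i => ?_) (fun i => ?_) i
    · simp only [B, Fin.append_left, eval_rename, hI x hx]
      congr 2
      funext j; simp
    · simp only [B, Fin.append_right, eval_rename, hI y hy]
      congr 2
      funext j
      exact Fin.append_right x y j
  have hA : (fun i => eval (Fin.append x y) (A i)) =
      Fin.append (H.mul x y) (H.mul (H.inv x) (H.inv y)) := by
    funext i
    refine Fin.addCases (fun i => ?_) (fun i => ?_) i
    · simp only [A, Fin.append_left, hP x hx y hy]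
    · simp only [A, Fin.append_right, eval_bind₁_apply, hB,
        hP _ (H.inv_mem hx) _ (H.inv_mem hy)]
  rw [eval_bind₁_apply, hA, hP _ (H.mul_mem hx hy) _ (H.mul_mem (H.inv_mem hx) (H.inv_mem hy))]

variable {H}

lemma tvec_lie {F} (hF : IsCommutatorRep H F) (δ ε : H.reg.PD) (i : Fin H.n) :
    H.tvec ⁅δ, ε⁆ i = ∑ j, ∑ k, H.tvec δ j * H.tvec ε k *
      eval (Fin.append H.one H.one)
        (pderiv (Fin.castAdd H.n j) (pderiv (Fin.natAdd H.n k) (F i))) := by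
  obtain ⟨m, ρ, hρ, hl⟩ := exists_rep H.reg {H.toReg (X i)}
  obtain ⟨l, hl⟩ := hl _ (Finset.mem_singleton_self _)
  have hc := isAlgHom_conjRep hρ
  let E := diff hρ ε
  let Q : MvPolynomial (Fin H.n) ℂ :=
    ∑ k, C (H.tvec ε k) * specR H.one (pderiv (Fin.natAdd H.n k) (F i))
  have hQ : ∀ g : H.Gp, (H.toReg Q).1 g = l (ρ g * (E * ρ g⁻¹)) - l E := by
    intro g
    have h1 : ε.1 (H.toReg (specL (pt g) (F i))) = (H.toReg Q).1 g := by
      rw [PD_toReg, toReg_apply]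
      simp only [Q, map_sum, map_mul, eval_C, eval_specR, pderiv_specL, eval_specL]
    have h2 : H.toReg (specL (pt g) (F i)) =
        coeff hc (l ∘ₗ LinearMap.mulLeft ℂ (ρ g) ∘ₗ
          (LinearMap.applyₗ (ρ g⁻¹) : Module.End ℂ (Matrix (Fin m) (Fin m) ℂ) →ₗ[ℂ] _)) := by
      ext y
      rw [toReg_apply, eval_specL, ← hF _ (pt_mem g) _ (pt_mem y)]
      have h3 := congrArg (fun f => f.1 (g * y * (g⁻¹ * y⁻¹))) hl
      simp only [toReg_apply, eval_X, pt_mul, pt_inv, coeff_apply] at h3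
      rw [h3]
      simp [conjRep_apply, mul_assoc]
    rw [← h1, h2, ← diff_spec hc]
    simp only [LinearMap.comp_apply, LinearMap.applyₗ_apply_apply, diff_conjRep hρ hc,
      LinearMap.mulLeft_apply, map_sub]
    rw [← mul_assoc (ρ g) (ρ g⁻¹), ← map_mul, mul_inv_cancel, map_one, one_mul]
  have h4 : δ.1 (H.toReg Q) = l (diff hρ ⁅δ, ε⁆) := by
    have h5 : H.toReg Q = coeff hc (l ∘ₗ
          (LinearMap.applyₗ E : Module.End ℂ (Matrix (Fin m) (Fin m) ℂ) →ₗ[ℂ] _)) -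
          algebraMap ℂ _ (l E) := by
      ext g
      rw [hQ]
      simp [conjRep_apply]
    rw [h5, map_sub, ← diff_spec hc, PD_eq_zero_of_const δ (algebraMap ℂ _ (l E)) (by simp),
      sub_zero, diff_lie]
    simp only [LinearMap.comp_apply, LinearMap.applyₗ_apply_apply, diff_conjRep hρ hc, E]
  rw [tvec_apply, hl, ← diff_spec, ← h4, PD_toReg]
  refine Finset.sum_congr rfl fun j _ => ?_
  simp only [Q, map_sum, Finset.mul_sum]
  refine Finset.sum_congr rfl fun k _ => ?_
  rw [pderiv_C_mul, map_mul, eval_C, pderiv_specR, eval_specR]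
  ring

end AffAlgGroup

/-! ### Identification of the Lie algebras -/

lemma LieEquiv.mem_radical {L L' : Type*} [LieRing L] [LieAlgebra ℂ L] [LieRing L']
    [LieAlgebra ℂ L'] [FiniteDimensional ℂ L] [FiniteDimensional ℂ L'] (η : L ≃ₗ⁅ℂ⁆ L') {z : L}
    (hz : z ∈ LieAlgebra.radical ℂ L) : η z ∈ LieAlgebra.radical ℂ L' := by
  let I : LieIdeal ℂ L' := (LieAlgebra.radical ℂ L).comap η.symm.toLieHom
  have hI : ∀ w, w ∈ I ↔ η.symm w ∈ LieAlgebra.radical ℂ L := fun w => LieIdeal.mem_comap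
  let ψ : I →ₗ⁅ℂ⁆ LieAlgebra.radical ℂ L :=
    { toFun := fun w => ⟨η.symm w, (hI w).1 w.2⟩
      map_add' := fun a b => Subtype.ext (map_add η.symm a.1 b.1)
      map_smul' := fun t a => Subtype.ext (map_smul η.symm t a.1)
      map_lie' := fun {a b} => Subtype.ext (LieEquiv.map_lie η.symm a.1 b.1) }
  have hψ : Function.Injective ψ := fun a b h =>
    Subtype.ext (η.symm.injective (congrArg Subtype.val h))
  have : LieAlgebra.IsSolvable (LieAlgebra.radical ℂ L) := inferInstance
  have hs : LieAlgebra.IsSolvable I := hψ.lieAlgebra_isSolvable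
  exact (LieAlgebra.LieIdeal.solvable_iff_le_radical ℂ L' I).1 hs ((hI _).2 (by simpa using hz))

lemma IsLieAlgebraOf.exists_lieEquiv {G : AffAlgGroup} {𝔤 : Type} [LieRing 𝔤] [LieAlgebra ℂ 𝔤]
    {e : 𝔤 →ₗ[ℂ] Pt G.n} (h : IsLieAlgebraOf G 𝔤 e) :
    ∃ θ : 𝔤 ≃ₗ⁅ℂ⁆ G.reg.PD, ∀ u, G.tvec (θ u) = e u := by
  have hr : LinearMap.range e = LinearMap.range G.tvec := by
    ext v
    rw [LinearMap.mem_range, LinearMap.mem_range, h.range_eq, AffAlgGroup.mem_range_tvec]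
  let θ : 𝔤 ≃ₗ[ℂ] G.reg.PD := (LinearEquiv.ofInjective e h.inj).trans
    ((LinearEquiv.ofEq _ _ hr).trans
      (LinearEquiv.ofInjective G.tvec AffAlgGroup.tvec_injective).symm)
  have hθ : ∀ u, G.tvec (θ u) = e u := fun u => by
    have := (LinearEquiv.ofInjective G.tvec AffAlgGroup.tvec_injective).apply_symm_apply
      (LinearEquiv.ofEq _ _ hr (LinearEquiv.ofInjective e h.inj u))
    exact congrArg Subtype.val this
  refine ⟨{ θ with map_lie' := fun {u v} => ?_ }, hθ⟩
  apply AffAlgGroup.tvec_injective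
  change G.tvec (θ ⁅u, v⁆) = G.tvec ⁅θ u, θ v⁆
  obtain ⟨F, hF⟩ := G.exists_commutatorRep
  funext i
  rw [hθ, h.bracket_eq F hF, AffAlgGroup.tvec_lie hF]
  simp only [hθ]

lemma exists_restrict_lieEquiv {𝔤 P P' : Type*} [LieRing 𝔤] [LieAlgebra ℂ 𝔤] [LieRing P]
    [LieAlgebra ℂ P] [LieRing P'] [LieAlgebra ℂ P'] (θ : 𝔤 ≃ₗ⁅ℂ⁆ P) (s : P' →ₗ[ℂ] P)
    (hs : Function.Injective s) (hsl : ∀ a b, s ⁅a, b⁆ = ⁅s a, s b⁆) (𝔥 : LieSubalgebra ℂ 𝔤)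
    (h𝔥 : ∀ u, u ∈ 𝔥 ↔ ∃ a, s a = θ u) :
    ∃ η : 𝔥 ≃ₗ⁅ℂ⁆ P', ∀ u : 𝔥, s (η u) = θ u := by
  choose f hf using fun u : 𝔥 => (h𝔥 u).1 u.2
  refine ⟨{ toFun := f
            map_add' := fun a b => hs (by simp [hf])
            map_smul' := fun t a => hs (by simp [hf])
            map_lie' := fun {a b} => hs (by simp [hf, hsl, LieEquiv.map_lie])
            invFun := fun a => ⟨θ.symm (s a), (h𝔥 _).2 ⟨a, by simp⟩⟩
            left_inv := fun u => Subtype.ext (by simp [hf])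
            right_inv := fun a => hs (by simp [hf]) }, hf⟩

/-- The explicit form of injectivity, for the Lie algebra of a Levi decomposition. -/
lemma RegGroup.IsLevi.exists_relative_primitive {Γ ΓU ΓL : Type} [Group Γ] [Group ΓU] [Group ΓL]
    {𝒜 : RegGroup Γ} {𝒰 : RegGroup ΓU} {ℒ : RegGroup ΓL} {ιU : ΓU →* Γ} {ιL : ΓL →* Γ}
    (D : IsLevi 𝒜 𝒰 ℒ ιU ιL) {𝔤 : Type} [LieRing 𝔤] [LieAlgebra ℂ 𝔤] [FiniteDimensional ℂ 𝔤]
    (θ : 𝔤 ≃ₗ⁅ℂ⁆ 𝒜.PD) (𝔥 : LieSubalgebra ℂ 𝔤) (hinj : Function.Injective (push D.regL))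
    (h𝔥 : ∀ u, u ∈ 𝔥 ↔ ∃ a, push D.regL a = θ u) {M : Type} [AddCommGroup M] [Module ℂ M]
    [FiniteDimensional ℂ M] [LieRingModule 𝔤 M] [LieModule ℂ 𝔤 M]
    {B : Type} [Ring B] [Algebra ℂ B] [FiniteDimensional ℂ B] {ρ : Γ →* B} (hρ : 𝒜.IsAlgHom ρ)
    (T : B →ₐ[ℂ] Module.End ℂ M) (hT : ∀ u, LieModule.toEnd ℂ 𝔤 M u = T (diff hρ (θ u)))
    (ω : 𝔤 → 𝔤 → M) (hω : ∀ x ∈ 𝔥, ∀ y, ω x y = 0) (h : 𝔤 →ₗ[ℂ] M)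
    (hh : ∀ x y, ω x y = ⁅x, h y⁆ - ⁅y, h x⁆ - h ⁅x, y⁆) :
    ∃ f : 𝔤 →ₗ[ℂ] M, (∀ x ∈ 𝔥, f x = 0) ∧ (∀ x ∈ 𝔥, ∀ y, f ⁅x, y⁆ = ⁅x, f y⁆) ∧
      ∀ x y, ω x y = ⁅x, f y⁆ - ⁅y, f x⁆ - f ⁅x, y⁆ := by
  obtain ⟨η, hη⟩ := exists_restrict_lieEquiv θ (push D.regL) hinj (push_lie D.regL) 𝔥 h𝔥
  have : FiniteDimensional ℂ ℒ.PD := η.toLinearEquiv.finiteDimensional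
  have hcen : ∀ z ∈ LieAlgebra.radical ℂ 𝔥, ∀ x : 𝔥, ⁅x, z⁆ = 0 := by
    intro z hz x
    refine η.toLinearEquiv.injective ?_
    change η ⁅x, z⁆ = η 0
    rw [LieEquiv.map_lie, D.lie_radical_eq_zero (LieEquiv.mem_radical η hz)]
    simp
  have hss : ∀ z ∈ LieAlgebra.radical ℂ 𝔥, (LieModule.toEnd ℂ 𝔤 𝔤 (z : 𝔤)).IsSemisimple := by
    intro z hz
    obtain ⟨p, hp, h0⟩ := D.squarefree_ad_of_mem_radical (LieEquiv.mem_radical η hz)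
    refine Module.End.isSemisimple_of_squarefree_aeval_eq_zero hp ?_
    ext v
    apply θ.injective
    have := aeval_intertwine (f := LieModule.toEnd ℂ 𝔤 𝔤 (z : 𝔤))
      (f' := LieModule.toEnd ℂ 𝒜.PD 𝒜.PD (push D.regL (η z))) θ.toLinearEquiv.toLinearMap
      (fun v => by simp [hη, LieEquiv.map_lie]) p v
    rw [h0] at this
    exact this.trans (by simp)
  have hsM : ∀ z ∈ LieAlgebra.radical ℂ 𝔥, (LieModule.toEnd ℂ 𝔤 M (z : 𝔤)).IsSemisimple := by
    intro z hz
    obtain ⟨p, hp, h0⟩ := D.squarefree_of_mem_radical (LieEquiv.mem_radical η hz) (hρ.comp D.regL)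
    refine Module.End.isSemisimple_of_squarefree_aeval_eq_zero hp ?_
    rw [hT, ← hη, ← diff_comp hρ, Polynomial.aeval_algHom_apply, h0, map_zero]
  have hab : ∀ x ∈ 𝔥, x ∈ Submodule.span ℂ {w : 𝔤 | ∃ a b : 𝔤, w = ⁅a, b⁆} →
      x ∈ Submodule.span ℂ {w : 𝔤 | ∃ a ∈ 𝔥, ∃ b ∈ 𝔥, w = ⁅a, b⁆} := by
    intro x hx hx'
    have h1 : push D.regL (η ⟨x, hx⟩) ∈ Submodule.span ℂ {w : 𝒜.PD | ∃ a b : 𝒜.PD, w = ⁅a, b⁆} := by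
      rw [hη]
      have := Submodule.mem_map_of_mem (f := θ.toLinearEquiv.toLinearMap) hx'
      rw [Submodule.map_span] at this
      refine Submodule.span_mono ?_ this
      rintro _ ⟨_, ⟨a, b, rfl⟩, rfl⟩
      exact ⟨θ a, θ b, LieEquiv.map_lie θ a b⟩
    have h2 := Submodule.mem_map_of_mem
      (f := 𝔥.toSubmodule.subtype ∘ₗ η.symm.toLinearEquiv.toLinearMap) (D.mem_derived h1)
    rw [Submodule.map_span] at h2
    have h3 : (𝔥.toSubmodule.subtype ∘ₗ η.symm.toLinearEquiv.toLinearMap) (η ⟨x, hx⟩) = x := by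
      simp
    rw [h3] at h2
    refine Submodule.span_mono ?_ h2
    rintro _ ⟨_, ⟨a, b, rfl⟩, rfl⟩
    exact ⟨_, (η.symm a).2, _, (η.symm b).2, congrArg Subtype.val (LieEquiv.map_lie η.symm a b)⟩
  exact _root_.exists_relative_primitive 𝔥 hcen hss hsM hab ω hω h hh

/-! ### Matrix representations of affine algebraic groups -/

/-- The matrix of a point of `ℂ^{m·m}`. -/
def toMat {m : ℕ} (x : Pt (m * m)) : Matrix (Fin m) (Fin m) ℂ := fun i j => matEntry x i j

lemma toMat_apply {m : ℕ} (x : Pt (m * m)) (i j : Fin m) :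
    toMat x i j = x (finProdFinEquiv (i, j)) := rfl

lemma toMat_injective {m : ℕ} : Function.Injective (toMat (m := m)) := by
  intro x y h
  funext idx
  obtain ⟨⟨i, j⟩, rfl⟩ := finProdFinEquiv.surjective idx
  exact congrFun (congrFun h i) j

lemma toMat_matMulPt {m : ℕ} (x y : Pt (m * m)) : toMat (matMulPt m x y) = toMat x * toMat y := by
  ext i j
  simp only [toMat_apply, matMulPt, Matrix.mul_apply, Equiv.symm_apply_apply]
  rfl

lemma toMat_idMatPt (m : ℕ) : toMat (idMatPt m) = 1 := by
  ext i j
  simp [toMat_apply, idMatPt, Matrix.one_apply]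

lemma Matrix.isNilpotent_of_strictUpper {m : ℕ} (M : Matrix (Fin m) (Fin m) ℂ)
    (h : ∀ i j, j ≤ i → M i j = 0) : IsNilpotent M := by
  refine ⟨m, ?_⟩
  have h1 := Matrix.charpoly_of_isUpperTriangular M (fun i j hij => h i j (le_of_lt hij))
  have h2 := Matrix.aeval_self_charpoly M
  rw [h1] at h2
  simpa [h] using h2

namespace AffAlgGroup
open RegGroup

variable {H : AffAlgGroup}

lemma isAlgHom_matrix {m : ℕ} {ρ : H.Gp →* Matrix (Fin m) (Fin m) ℂ}
    {R : Fin m → Fin m → MvPolynomial (Fin H.n) ℂ}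
    (hR : ∀ g i j, ρ g i j = eval (pt g) (R i j)) : H.reg.IsAlgHom ρ := by
  intro l
  refine mem_reg_of_eval (∑ i, ∑ j, C (l (Matrix.single i j 1)) * R i j) fun g => ?_
  conv_lhs => rw [Matrix.matrix_eq_sum_single (ρ g)]
  simp only [map_sum, map_mul, eval_C, ← hR]
  refine Finset.sum_congr rfl fun i _ => Finset.sum_congr rfl fun j _ => ?_
  rw [← mul_one (ρ g i j), ← smul_eq_mul, ← Matrix.smul_single, map_smul]
  simp [mul_comm]

lemma diff_matrix {m : ℕ} {ρ : H.Gp →* Matrix (Fin m) (Fin m) ℂ}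
    {R : Fin m → Fin m → MvPolynomial (Fin H.n) ℂ}
    (hR : ∀ g i j, ρ g i j = eval (pt g) (R i j)) (hρ : H.reg.IsAlgHom ρ) (δ : H.reg.PD)
    (i j : Fin m) : diff hρ δ i j = ∑ k, H.tvec δ k * eval H.one (pderiv k (R i j)) := by
  rw [← PD_toReg]
  have h1 := diff_spec hρ δ (Matrix.entryLinearMap ℂ ℂ i j)
  have h2 : coeff hρ (Matrix.entryLinearMap ℂ ℂ i j) = H.toReg (R i j) := by
    ext g
    rw [toReg_apply, ← hR]; rfl
  rw [h2] at h1
  exact h1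

lemma IsUnipotent.exists_rep (h : H.IsUnipotent) :
    ∃ (m : ℕ) (φ : H.Gp →* Matrix (Fin m) (Fin m) ℂ) (hφ : H.reg.IsAlgHom φ),
      Function.Injective φ ∧ ∀ δ, IsNilpotent (diff hφ δ) := by
  obtain ⟨m, φ, ⟨R, hR⟩, hinj, hut, hmul⟩ := h
  have hmul' : ∀ x y : H.Gp, toMat (φ (pt (x * y))) = toMat (φ (pt x)) * toMat (φ (pt y)) :=
    fun x y => by rw [pt_mul, hmul _ (pt_mem x) _ (pt_mem y), toMat_matMulPt]
  have hone : toMat (φ (pt (1 : H.Gp))) = 1 := by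
    have h1 : (toMat (φ (pt (1 : H.Gp)))).det = 1 := by
      rw [Matrix.det_of_isUpperTriangular (M := toMat _) fun i j hij => (hut _ (pt_mem 1)).2 i j hij]
      exact Finset.prod_eq_one fun i _ => (hut _ (pt_mem 1)).1 i
    have h2 : IsUnit (toMat (φ (pt (1 : H.Gp)))) := by
      rw [Matrix.isUnit_iff_isUnit_det, h1]; exact isUnit_one
    have h3 := hmul' 1 1
    rw [mul_one] at h3
    exact h2.mul_left_cancel (by rw [← h3, mul_one])
  let ψ : H.Gp →* Matrix (Fin m) (Fin m) ℂ :=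
    { toFun := fun x => toMat (φ (pt x)), map_one' := hone, map_mul' := hmul' }
  have hψ : ∀ g i j, ψ g i j = eval (pt g) (R (finProdFinEquiv (i, j))) := fun g i j =>
    hR _ (pt_mem g) _
  have hA := isAlgHom_matrix (R := fun i j => R (finProdFinEquiv (i, j))) hψ
  refine ⟨m, ψ, hA, fun x y hxy =>
    Subtype.ext (hinj (pt_mem x) (pt_mem y) (toMat_injective hxy)), fun δ => ?_⟩
  refine Matrix.isNilpotent_of_strictUpper _ fun i j hij => ?_
  refine diff_eq_zero_of_const hA δ (Matrix.entryLinearMap ℂ ℂ i j) fun g => ?_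
  rcases hij.eq_or_lt with rfl | hij
  · exact ((hut _ (pt_mem g)).1 j).trans (by simp)
  · exact ((hut _ (pt_mem g)).2 i j hij).trans (by simp [hij.ne'])

end AffAlgGroup

namespace AlgSubgroup
open RegGroup AffAlgGroup
variable {G : AffAlgGroup} (H : AlgSubgroup G)

lemma isRegHom_incl : IsRegHom G.reg H.toGrp.reg H.incl := by
  intro f hf
  obtain ⟨p, hp⟩ := G.toReg_surjective ⟨f, hf⟩
  refine mem_reg_of_eval (H := H.toGrp) p fun x => ?_
  exact (congrFun (congrArg Subtype.val hp) (H.incl x)).symm.trans (G.toReg_apply p _)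

lemma exists_extend {f : H.toGrp.Gp → ℂ} (hf : f ∈ H.toGrp.reg.A) :
    ∃ f' ∈ G.reg.A, ∀ l, f l = f' (H.incl l) := by
  obtain ⟨p, hp⟩ := H.toGrp.toReg_surjective ⟨f, hf⟩
  refine ⟨(G.toReg p).1, (G.toReg p).2, fun l => ?_⟩
  exact ((congrFun (congrArg Subtype.val hp) l).symm.trans (H.toGrp.toReg_apply p l)).trans
    (G.toReg_apply p (H.incl l)).symm

lemma tvec_push (δ : H.toGrp.reg.PD) : G.tvec (push H.isRegHom_incl δ) = H.toGrp.tvec δ := by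
  funext i
  rw [tvec_apply, push_apply]
  refine Eq.trans ?_ (tvec_apply (H := H.toGrp) δ i).symm
  congr 1
  ext x
  exact (G.toReg_apply _ _).trans (H.toGrp.toReg_apply (X i) x).symm

lemma push_injective : Function.Injective (push H.isRegHom_incl) := by
  intro δ ε h
  apply tvec_injective
  rw [← tvec_push, ← tvec_push, h]

end AlgSubgroup

/-! ### Reductive groups and nilpotent ideals -/

section NilpotentIdeal
variable {E : Type} [Ring E] [Algebra ℂ E]

lemma exists_triangular_family {J : Ideal E} [J.IsTwoSided] (hJ : IsNilpotent J) (m : ℕ)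
    (hm : m ≤ Module.finrank ℂ E) :
    ∃ b : Fin m → E, LinearIndependent ℂ b ∧
      ∀ j ∈ J, ∀ k, j * b k ∈ Submodule.span ℂ (b '' Set.Iio k) := by
  induction m with
  | zero => exact ⟨Fin.elim0, linearIndependent_empty_type, fun _ _ k => k.elim0⟩
  | succ m ih =>
    obtain ⟨b, hb, hbJ⟩ := ih (Nat.le_of_succ_le hm)
    let W := Submodule.span ℂ (Set.range b)
    have hW : ∃ k, ∀ x ∈ J ^ k, x ∈ W := by
      obtain ⟨N, hN⟩ := hJ
      refine ⟨N, fun x hx => ?_⟩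
      rw [hN] at hx
      rw [show x = 0 from hx]
      exact zero_mem _
    classical
    have h0 : Nat.find hW ≠ 0 := by
      intro h
      have h1 := Nat.find_spec hW
      have hJ0 : J ^ 0 = ⊤ := J.pow_zero.trans Ideal.one_eq_top
      have h2 : W = ⊤ := eq_top_iff.2 fun x _ => h1 x (by rw [h, hJ0]; trivial)
      have h3 := finrank_span_eq_card hb
      rw [show Submodule.span ℂ (Set.range b) = ⊤ from h2, finrank_top, Fintype.card_fin] at h3
      omega
    obtain ⟨k, hk⟩ := Nat.exists_eq_succ_of_ne_zero h0
    have h1 := Nat.find_min hW (m := k) (by omega)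
    push Not at h1
    obtain ⟨v, hv, hvW⟩ := h1
    refine ⟨Fin.snoc b v, hb.finSnoc hvW, fun j hj i => ?_⟩
    refine Fin.lastCases ?_ (fun i => ?_) i
    · rw [Fin.snoc_last]
      have h2 : j * v ∈ W := Nat.find_spec hW _ (by
        rw [hk]
        exact (Ideal.IsTwoSided.pow_succ (I := J) (n := k)) ▸ Ideal.mul_mem_mul hj hv)
      refine Submodule.span_mono ?_ h2
      rintro _ ⟨i, rfl⟩
      exact ⟨i.castSucc, Fin.castSucc_lt_last i, by simp⟩
    · rw [Fin.snoc_castSucc]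
      refine Submodule.span_mono ?_ (hbJ j hj i)
      rintro _ ⟨i', hi', rfl⟩
      exact ⟨i'.castSucc, Fin.castSucc_lt_castSucc_iff.2 hi', by simp⟩

lemma exists_triangular_basis [FiniteDimensional ℂ E] {J : Ideal E} [J.IsTwoSided] (hJ : IsNilpotent J) :
    ∃ b : Module.Basis (Fin (Module.finrank ℂ E)) ℂ E,
      ∀ j ∈ J, ∀ i k, k ≤ i → Algebra.leftMulMatrix b j i k = 0 := by
  obtain ⟨b, hb, hbJ⟩ := exists_triangular_family hJ _ le_rfl
  let B := Module.Basis.mk hb (hb.span_eq_top_of_card_eq_finrank' (by simp)).ge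
  have hB : ⇑B = b := Module.Basis.coe_mk _ _
  refine ⟨B, fun j hj i k hik => ?_⟩
  rw [Algebra.leftMulMatrix_eq_repr_mul]
  have h1 := hbJ j hj k
  rw [← hB, Module.Basis.mem_span_image] at h1
  by_contra h
  exact absurd (h1 (Finsupp.mem_support_iff.2 h)) (not_lt.2 hik)

lemma exists_poly_pow {a : E} (ha : IsNilpotent (a - 1)) (l : Module.Dual ℂ E) :
    ∃ q : Polynomial ℂ, ∀ k : ℕ, l (a ^ k) = q.eval (k : ℂ) := by
  obtain ⟨N, hN⟩ := ha
  refine ⟨∑ i ∈ Finset.range N,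
    Polynomial.C (l ((a - 1) ^ i) / (i.factorial : ℂ)) * descPochhammer ℂ i, fun k => ?_⟩
  have h1 : a ^ k = ∑ i ∈ Finset.range N, (k.choose i : ℂ) • (a - 1) ^ i := by
    have h2 := (Commute.one_right (a - 1)).add_pow k
    rw [sub_add_cancel] at h2
    have h3 : ∑ i ∈ Finset.range (max N (k + 1)), (k.choose i : ℂ) • (a - 1) ^ i =
      ∑ i ∈ Finset.range (k + 1), (k.choose i : ℂ) • (a - 1) ^ i := by
      refine (Finset.sum_subset (by simp) fun i _ hi => ?_).symm
      rw [Nat.choose_eq_zero_of_lt (by simpa using hi)]; simp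
    have h4 : ∑ i ∈ Finset.range (max N (k + 1)), (k.choose i : ℂ) • (a - 1) ^ i =
      ∑ i ∈ Finset.range N, (k.choose i : ℂ) • (a - 1) ^ i := by
      refine (Finset.sum_subset (by simp) fun i _ hi => ?_).symm
      rw [pow_eq_zero_of_le (by simpa using hi) hN, smul_zero]
    rw [← h4, h3, h2]
    refine Finset.sum_congr rfl fun i _ => ?_
    rw [one_pow, mul_one, Nat.cast_smul_eq_nsmul, nsmul_eq_mul, Nat.cast_comm]
  rw [h1, map_sum, Polynomial.eval_finsetSum]
  refine Finset.sum_congr rfl fun i _ => ?_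
  rw [map_smul, Polynomial.eval_mul, Polynomial.eval_C, descPochhammer_eval_eq_descFactorial,
    Nat.descFactorial_eq_factorial_mul_choose]
  have : (i.factorial : ℂ) ≠ 0 := Nat.cast_ne_zero.2 i.factorial_ne_zero
  push_cast
  field_simp
  rw [smul_eq_mul, mul_comm]

end NilpotentIdeal

namespace AffAlgGroup
open RegGroup

variable {H : AffAlgGroup} {E : Type} [Ring E] [Algebra ℂ E] {ρ : H.Gp →* E}
  (hρ : H.reg.IsAlgHom ρ) (J : Ideal E)

/-- The algebraic subgroup of elements congruent to `1` modulo a two-sided ideal. -/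
def congruenceSubgroup [J.IsTwoSided] : AlgSubgroup H where
  carrier := {x | ∃ g : H.Gp, pt g = x ∧ ρ g - 1 ∈ J}
  subset := by rintro _ ⟨g, rfl, -⟩; exact pt_mem g
  isAlgebraic := by
    refine ⟨{p | ∀ g : H.Gp, ρ g - 1 ∈ J → eval (pt g) p = 0}, ?_⟩
    ext x
    constructor
    · rintro ⟨g, rfl, hg⟩ p hp
      exact hp g hg
    · intro hx
      have hxH : x ∈ H.carrier := by
        obtain ⟨S, hS⟩ := H.isAlgebraic
        rw [hS]
        exact fun p hp => hx p fun g _ => (Set.ext_iff.1 hS (pt g)).1 (pt_mem g) p hp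
      let g : H.Gp := ⟨x, hxH⟩
      refine ⟨g, rfl, ?_⟩
      by_contra hg
      obtain ⟨l, hl, hlJ⟩ := Submodule.exists_le_ker_of_notMem
        (p := J.restrictScalars ℂ) (v := ρ g - 1) hg
      obtain ⟨p, hp⟩ := H.toReg_surjective (coeff hρ l)
      have hp' : ∀ g' : H.Gp, eval (pt g') (p - C (l 1)) = l (ρ g' - 1) := fun g' => by
        rw [map_sub, eval_C, ← toReg_apply, hp, coeff_apply, map_sub]
      refine hl ?_
      rw [← hp' g]
      exact hx _ fun g' hg' => by rw [hp']; exact hlJ hg'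
  one_mem := ⟨1, rfl, by simp⟩
  mul_mem := by
    rintro _ _ ⟨g, rfl, hg⟩ ⟨h, rfl, hh⟩
    refine ⟨g * h, rfl, ?_⟩
    rw [map_mul, show ρ g * ρ h - 1 = (ρ g - 1) * ρ h + (ρ h - 1) by noncomm_ring]
    exact J.add_mem (J.mul_mem_right _ hg) hh
  inv_mem := by
    rintro _ ⟨g, rfl, hg⟩
    refine ⟨g⁻¹, rfl, ?_⟩
    rw [show ρ g⁻¹ - 1 = -ρ g⁻¹ * (ρ g - 1) by
      rw [mul_sub, neg_mul, ← map_mul, inv_mul_cancel, map_one]; noncomm_ring]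
    exact J.mul_mem_left _ hg

lemma congruenceSubgroup_isNormal [J.IsTwoSided] : (congruenceSubgroup hρ J).IsNormal := by
  rintro g hg _ ⟨x, rfl, hx⟩
  obtain ⟨g, rfl⟩ : ∃ g' : H.Gp, pt g' = g := ⟨⟨g, hg⟩, rfl⟩
  refine ⟨g * (x * g⁻¹), rfl, ?_⟩
  rw [show ρ (g * (x * g⁻¹)) - 1 = ρ g * ((ρ x - 1) * ρ g⁻¹) by
    rw [sub_mul, mul_sub, one_mul, ← map_mul, ← map_mul, ← map_mul, mul_inv_cancel, map_one]]
  exact J.mul_mem_left _ (J.mul_mem_right _ hx)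

variable (hgen : Algebra.adjoin ℂ (Set.range (coeff hρ)) = ⊤)
include hgen

lemma injective_of_adjoin_coeff : Function.Injective ρ := by
  intro g h hgh
  have key : ∀ f : H.reg.A, f.1 g = f.1 h := by
    intro f
    have hf : f ∈ Algebra.adjoin ℂ (Set.range (coeff hρ)) := hgen ▸ trivial
    induction hf using Algebra.adjoin_induction with
    | mem x hx => obtain ⟨l, rfl⟩ := hx; simp [hgh]
    | algebraMap r => rfl
    | add x y _ _ hx hy => simp [hx, hy]
    | mul x y _ _ hx hy => simp [hx, hy]
  refine Subtype.ext (funext fun i => ?_)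
  have := key (H.toReg (X i))
  rw [toReg_apply, toReg_apply, eval_X, eval_X] at this
  exact this

variable {J} (hJ : IsNilpotent J)
include hJ

lemma congruenceSubgroup_isUnipotent [FiniteDimensional ℂ E] [J.IsTwoSided] :
    (congruenceSubgroup hρ J).toGrp.IsUnipotent := by
  obtain ⟨b, hb⟩ := exists_triangular_basis hJ
  choose P hP using fun idx : Fin (Module.finrank ℂ E * Module.finrank ℂ E) =>
    H.toReg_surjective (coeff hρ (Matrix.entryLinearMap ℂ ℂ (finProdFinEquiv.symm idx).1
      (finProdFinEquiv.symm idx).2 ∘ₗ (Algebra.leftMulMatrix b).toLinearMap))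
  let φ : Pt H.n → Pt (Module.finrank ℂ E * Module.finrank ℂ E) := fun x idx => eval x (P idx)
  have hφ : ∀ g : H.Gp, toMat (φ (pt g)) = Algebra.leftMulMatrix b (ρ g) := by
    intro g
    ext i k
    rw [toMat_apply]
    change eval (pt g) (P _) = _
    rw [← toReg_apply, hP, coeff_apply]
    simp
  refine ⟨_, φ, ⟨P, fun _ _ _ => rfl⟩, ?_, ?_, ?_⟩
  · rintro _ ⟨g, rfl, -⟩ _ ⟨h, rfl, -⟩ hgh
    have h1 := congrArg toMat hgh
    rw [hφ, hφ] at h1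
    rw [injective_of_adjoin_coeff hρ hgen (Algebra.leftMulMatrix_injective b h1)]
  · rintro _ ⟨g, rfl, hg⟩
    have h1 : ∀ i k, k ≤ i → toMat (φ (pt g)) i k = (1 : Matrix _ _ ℂ) i k := by
      intro i k hik
      have h2 := hb _ hg i k hik
      rw [map_sub, map_one, Matrix.sub_apply, sub_eq_zero] at h2
      rw [hφ, h2]
    exact ⟨fun i => (h1 i i le_rfl).trans (by simp),
      fun i j hij => (h1 i j hij.le).trans (by simp [hij.ne'])⟩
  · rintro _ ⟨g, rfl, -⟩ _ ⟨h, rfl, -⟩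
    apply toMat_injective
    rw [toMat_matMulPt, hφ, hφ, ← map_mul, ← map_mul, ← hφ]
    rfl

lemma exists_poly_eval_pow (g : H.Gp) (hg : ρ g - 1 ∈ J) (f : H.reg.A) :
    ∃ q : Polynomial ℂ, ∀ k : ℕ, f.1 (g ^ k) = q.eval (k : ℂ) := by
  have hn : IsNilpotent (ρ g - 1) := by
    obtain ⟨N, hN⟩ := hJ
    refine ⟨N, ?_⟩
    have := Ideal.pow_mem_pow hg N
    rwa [hN] at this
  have hf : f ∈ Algebra.adjoin ℂ (Set.range (coeff hρ)) := hgen ▸ trivial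
  induction hf using Algebra.adjoin_induction with
  | mem x hx =>
    obtain ⟨l, rfl⟩ := hx
    simpa using exists_poly_pow hn l
  | algebraMap r => exact ⟨Polynomial.C r, fun k => by simp⟩
  | add x y _ _ hx hy =>
    obtain ⟨p, hp⟩ := hx
    obtain ⟨q, hq⟩ := hy
    exact ⟨p + q, fun k => by simp [hp, hq]⟩
  | mul x y _ _ hx hy =>
    obtain ⟨p, hp⟩ := hx
    obtain ⟨q, hq⟩ := hy
    exact ⟨p * q, fun k => by simp [hp, hq]⟩

lemma subset_of_one_mem_of_disjoint [J.IsTwoSided] {V W : Set (Pt H.n)} (hV : IsAlgebraicSet V)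
    (hW : IsAlgebraicSet W) (h : (congruenceSubgroup hρ J).carrier ⊆ V ∪ W)
    (h1 : H.one ∉ W) : (congruenceSubgroup hρ J).carrier ⊆ V := by
  rintro _ ⟨g, rfl, hg⟩
  by_contra hgV
  obtain ⟨S, rfl⟩ := hV
  obtain ⟨T, rfl⟩ := hW
  simp only [Set.mem_ofPred_eq, not_forall] at hgV h1
  obtain ⟨p, hpS, hp⟩ := hgV
  obtain ⟨q, hqT, hq⟩ := h1
  obtain ⟨P, hP⟩ := exists_poly_eval_pow hρ hgen hJ g hg (H.toReg p)
  obtain ⟨Q, hQ⟩ := exists_poly_eval_pow hρ hgen hJ g hg (H.toReg q)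
  have hPQ : P * Q = 0 := by
    refine Polynomial.eq_of_infinite_eval_eq _ _ (Set.Infinite.mono ?_
      (Set.infinite_range_of_injective (Nat.cast_injective (R := ℂ))))
    rintro _ ⟨k, rfl⟩
    have hk : pt (g ^ k) ∈ (congruenceSubgroup hρ J).carrier := by
      induction k with
      | zero => rw [pow_zero]; exact (congruenceSubgroup hρ J).one_mem
      | succ k ih =>
        rw [pow_succ]
        exact (congruenceSubgroup hρ J).mul_mem ih ⟨g, rfl, hg⟩
    rw [Set.mem_ofPred_eq, Polynomial.eval_mul, Polynomial.eval_zero, ← hP, ← hQ, toReg_apply,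
      toReg_apply]
    rcases h hk with h2 | h2
    · rw [h2 p hpS, zero_mul]
    · rw [h2 q hqT, mul_zero]
  rcases mul_eq_zero.1 hPQ with h2 | h2
  · have := hP 1
    rw [h2, pow_one, toReg_apply, Polynomial.eval_zero] at this
    exact hp this
  · have := hQ 0
    rw [h2, pow_zero, toReg_apply, Polynomial.eval_zero] at this
    exact hq this

lemma congruenceSubgroup_isConnected [J.IsTwoSided] :
    (congruenceSubgroup hρ J).toGrp.IsConnected := by
  intro V W hV hW h hd
  by_cases h1 : H.one ∈ W
  · refine Or.inr (subset_of_one_mem_of_disjoint hρ hgen hJ hW hV ?_ fun h2 => ?_)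
    · exact fun x hx => (h hx).symm
    · exact (Set.eq_empty_iff_forall_notMem.1 hd) H.one
        ⟨(congruenceSubgroup hρ J).one_mem, h2, h1⟩
  · exact Or.inl (subset_of_one_mem_of_disjoint hρ hgen hJ hV hW h h1)

lemma IsReductive.eq_one_of_sub_one_mem [FiniteDimensional ℂ E] (hr : H.IsReductive)
    [J.IsTwoSided] (g : H.Gp) (hg : ρ g - 1 ∈ J) : g = 1 := by
  have h := hr (congruenceSubgroup hρ J) (congruenceSubgroup_isNormal hρ J)
    (congruenceSubgroup_isConnected hρ hgen hJ) (congruenceSubgroup_isUnipotent hρ hgen hJ)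
  have h1 : pt g ∈ (congruenceSubgroup hρ J).carrier := ⟨g, rfl, hg⟩
  rw [h] at h1
  exact Subtype.ext h1

end AffAlgGroup

/-! ### Levi decompositions and algebraic representations -/

open RegGroup AffAlgGroup in
lemma LeviDecomposition.isLevi {G : AffAlgGroup} (LD : LeviDecomposition G) :
    IsLevi G.reg LD.Gu.toGrp.reg LD.L.toGrp.reg LD.Gu.incl LD.L.incl where
  regU := LD.Gu.isRegHom_incl
  regL := LD.L.isRegHom_incl
  connU := LD.Gu_radical.2.1.conn
  connL := LD.L_connected.conn
  normal g u :=
    ⟨⟨_, LD.Gu_radical.1 _ (pt_mem g) _ (pt_mem u)⟩, (mul_assoc _ _ _).trans (Subtype.ext rfl)⟩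
  decomp g := by
    obtain ⟨u, hu, l, hl, h⟩ := LD.decomp _ (pt_mem g)
    exact ⟨⟨u, hu⟩, ⟨l, hl⟩, Subtype.ext h⟩
  surjL _ hf := LD.L.exists_extend hf
  unip := LD.Gu_radical.2.2.1.exists_rep
  red _ hρ hgen _ _ hJ g hg := LD.L_reductive.eq_one_of_sub_one_mem hρ hgen hJ g hg

namespace AlgRep
open RegGroup AffAlgGroup
variable {G : AffAlgGroup} {m : ℕ} (r : AlgRep G m)

/-- An algebraic representation as a matrix-valued homomorphism on the group of points. -/
def toMatHom : G.Gp →* Matrix (Fin m) (Fin m) ℂ where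
  toFun g := toMat (r.ρ (pt g))
  map_one' := by rw [pt_one, r.map_one, toMat_idMatPt]
  map_mul' g h := by rw [pt_mul, r.map_mul (pt_mem g) (pt_mem h), toMat_matMulPt]

lemma isAlgHom_toMatHom : G.reg.IsAlgHom r.toMatHom := by
  obtain ⟨R, hR⟩ := r.regular
  exact isAlgHom_matrix (R := fun i j => R (finProdFinEquiv (i, j)))
    fun g i j => hR _ (pt_mem g) _

lemma lie_eq_diff {𝔤 : Type} [LieRing 𝔤] [LieAlgebra ℂ 𝔤] {e : 𝔤 →ₗ[ℂ] Pt G.n}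
    [LieRingModule 𝔤 (Pt m)] (hder : IsDerivedAction r e) {u : 𝔤} {δ : G.reg.PD}
    (hδ : G.tvec δ = e u) (w : Pt m) :
    ⁅u, w⁆ = (diff r.isAlgHom_toMatHom δ).mulVec w := by
  obtain ⟨R, hR⟩ := r.regular
  funext i
  rw [hder R hR u w i]
  refine Finset.sum_congr rfl fun k _ => ?_
  have h := diff_matrix (R := fun i j => R (finProdFinEquiv (i, j)))
    (fun g i j => hR _ (pt_mem g) _) r.isAlgHom_toMatHom δ i k
  rw [hδ] at h
  exact congrArg (· * w k) h.symm

end AlgRep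

lemma IsLieSubalgebraOf.mem_iff_push {G : AffAlgGroup} {H : AlgSubgroup G} {𝔤 : Type} [LieRing 𝔤]
    [LieAlgebra ℂ 𝔤] {e : 𝔤 →ₗ[ℂ] Pt G.n} {𝔥 : LieSubalgebra ℂ 𝔤} (h : IsLieSubalgebraOf H e 𝔥)
    {u : 𝔤} {δ : G.reg.PD} (hδ : G.tvec δ = e u) :
    u ∈ 𝔥 ↔ ∃ a, RegGroup.push H.isRegHom_incl a = δ := by
  rw [h u]
  refine (AffAlgGroup.mem_range_tvec (H := H.toGrp) (v := e u)).symm.trans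
    (exists_congr fun a => ?_)
  rw [← G.tvec_injective.eq_iff, H.tvec_push, hδ]
  rfl

/-- For a connected algebraic group `G` with Levi subgroup
`G_red` and a finite-dimensional algebraic `G`-module `𝔞_u`, the restriction
map `H²(𝔤, 𝔤_red, 𝔞_u) → H²(𝔤, 𝔞_u)` is injective.  Equivalently: every
relative 2-cocycle `ω` (alternating bilinear, `𝔤_red`-invariant, vanishing on
`𝔤_red`) which is a coboundary `ω = d_𝔤 h` of some linear map `h : 𝔤 → 𝔞_u`
is the coboundary `ω = d_𝔤 f` of a linear map `f` vanishing on `𝔤_red` and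
`𝔤_red`-equivariant. -/
theorem relative_H2_injects_into_H2
    (G : AffAlgGroup) (hG : G.IsConnected) (LD : LeviDecomposition G)
    (𝔤 : Type) [LieRing 𝔤] [LieAlgebra ℂ 𝔤] (e𝔤 : 𝔤 →ₗ[ℂ] Pt G.n)
    (h𝔤 : IsLieAlgebraOf G 𝔤 e𝔤)
    (𝔥 : LieSubalgebra ℂ 𝔤) (h𝔥 : IsLieSubalgebraOf LD.L e𝔤 𝔥)
    (m : ℕ) (r : AlgRep G m) [LieRingModule 𝔤 (Pt m)] [LieModule ℂ 𝔤 (Pt m)]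
    (hder : IsDerivedAction r e𝔤) :
    -- the restriction map `H²(𝔤, 𝔥, 𝔞) → H²(𝔤, 𝔞)` is injective: a relative
    -- cocycle which is an absolute coboundary is a relative coboundary
    (∀ c : (Fin 2 → 𝔤) → Pt m, c ∈ relZ 𝔥 (Pt m) 2 →
      c ∈ relB (⊥ : LieSubalgebra ℂ 𝔤) (Pt m) 1 → c ∈ relB 𝔥 (Pt m) 1) ∧
    -- equivalent explicit form
    (∀ ω : 𝔤 → 𝔤 → Pt m,
      (∀ x y z : 𝔤, ω (x + y) z = ω x z + ω y z) →
      (∀ (t : ℂ) (x y : 𝔤), ω (t • x) y = t • ω x y) →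
      (∀ x y z : 𝔤, ω x (y + z) = ω x y + ω x z) →
      (∀ (t : ℂ) (x y : 𝔤), ω x (t • y) = t • ω x y) →
      (∀ x : 𝔤, ω x x = 0) →
      (∀ x ∈ 𝔥, ∀ y : 𝔤, ω x y = 0) →
      (∀ x ∈ 𝔥, ∀ y z : 𝔤, ⁅x, ω y z⁆ = ω ⁅x, y⁆ z + ω y ⁅x, z⁆) →
      (∀ x y z : 𝔤, ⁅x, ω y z⁆ - ⁅y, ω x z⁆ + ⁅z, ω x y⁆
        - ω ⁅x, y⁆ z + ω ⁅x, z⁆ y - ω ⁅y, z⁆ x = 0) →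
      ∀ h : 𝔤 →ₗ[ℂ] Pt m,
        (∀ x y : 𝔤, ω x y = ⁅x, h y⁆ - ⁅y, h x⁆ - h ⁅x, y⁆) →
        ∃ f : 𝔤 →ₗ[ℂ] Pt m,
          (∀ x ∈ 𝔥, f x = 0) ∧
          (∀ x ∈ 𝔥, ∀ y : 𝔤, f ⁅x, y⁆ = ⁅x, f y⁆) ∧
          (∀ x y : 𝔤, ω x y = ⁅x, f y⁆ - ⁅y, f x⁆ - f ⁅x, y⁆)) := by
  obtain ⟨θ, hθ⟩ := h𝔤.exists_lieEquiv
  have : FiniteDimensional ℂ 𝔤 := FiniteDimensional.of_injective e𝔤 h𝔤.inj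
  have key := LD.isLevi.exists_relative_primitive θ 𝔥 LD.L.push_injective
    (fun u => h𝔥.mem_iff_push (hθ u)) r.isAlgHom_toMatHom
    (Matrix.toLinAlgEquiv' (R := ℂ) (n := Fin m)).toAlgHom fun u =>
      LinearMap.ext fun w => r.lie_eq_diff hder (hθ u) w
  exact ⟨fun c => mem_relB_of_explicit 𝔥 key c, fun ω _ _ _ _ _ hω _ _ => key ω hω⟩
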